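/- Let (T^s, ν^s) and (T^u, ν^u) be a transverse pair of measured turbulations on Σ which have partial flowboxes, and suppose there is a countable collection R_i of compatible tartans with μ(⋃_i R_i^⋔) = 1. Then for every non-empty open subset U of Σ there is a positive measure compatible tartan all of whose fibers are contained in U; hence the pair of turbulations is full. -/

import Mathlib

open MeasureTheory Set Function Topology Filter
open scoped ENNReal

noncomputable section

variable {S : Type} [TopologicalSpace S] [MeasurableSpace S]

/-- `d` is (the distance function of) a metric on `S` compatible with its topology. -/
def IsCompatibleMetric (S : Type) [TopologicalSpace S] (d : S → S → ℝ) : Prop :=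
  (∀ x y, d x y = d y x) ∧ (∀ x y, d x y = 0 ↔ x = y) ∧
  (∀ x y z, d x z ≤ d x y + d y z) ∧
  (∀ s : Set S, IsOpen s ↔ ∀ x ∈ s, ∃ ε > (0 : ℝ), ∀ y, d x y < ε → y ∈ s)

/-- An immersed line: a continuous injective image of `ℝ`. -/
def IsImmersedLine (ℓ : Set S) : Prop :=
  ∃ f : ℝ → S, Continuous f ∧ Function.Injective f ∧ Set.range f = ℓ

/-- `A` is a closed stream arc of the immersed line `ℓ` with endpoints `x` and `y`. -/
def IsArcIn (ℓ A : Set S) (x y : S) : Prop :=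
  ∃ f : ℝ → S, Continuous f ∧ Function.Injective f ∧ Set.range f = ℓ ∧
    ∃ a b : ℝ, a ≤ b ∧ f a = x ∧ f b = y ∧ A = f '' Set.Icc a b

/-- `A` is a closed stream arc of the immersed line `ℓ`. -/
def IsArc (ℓ A : Set S) : Prop := ∃ x y, IsArcIn ℓ A x y

/-- Topological transversality of two immersed lines at a point `x`: local pieces (arcs) of the
two lines through `x` are, in some chart around `x`, the two coordinate axes. -/
def TransverseAt (ℓ ℓ' : Set S) (x : S) : Prop :=
  ∃ α β : Set S, x ∈ α ∧ x ∈ β ∧ IsArc ℓ α ∧ IsArc ℓ' β ∧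
    ∃ U : Set S, IsOpen U ∧ x ∈ U ∧ ∃ e : U ≃ₜ ℝ × ℝ,
      Subtype.val '' (⇑e ⁻¹' {p : ℝ × ℝ | p.2 = 0}) = α ∩ U ∧
      Subtype.val '' (⇑e ⁻¹' {p : ℝ × ℝ | p.1 = 0}) = β ∩ U

/-- The (manifold) boundary of the surface `S`: points having no neighbourhood
homeomorphic to the plane. -/
def ManifoldBdry (S : Type) [TopologicalSpace S] : Set S :=
  {x : S | ¬ ∃ U : Set S, IsOpen U ∧ x ∈ U ∧ Nonempty (U ≃ₜ ℝ × ℝ)}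

/-- An Oxtoby–Ulam (OU) measure on the compact surface `S`: Borel (via the ambient
`BorelSpace` assumption), non-atomic, positive on non-empty open sets, and vanishing on
the boundary of `S`. -/
structure IsOUMeasure (μ : Measure S) : Prop where
  noAtoms : ∀ x : S, μ {x} = 0
  openPos : ∀ U : Set S, IsOpen U → U.Nonempty → 0 < μ U
  boundaryNull : μ (ManifoldBdry S) = 0

/-- A measured turbulation on `S` (with ambient measure `μ`): a partition of a full
`μ`-measure Borel subset of `S` into streamlines (immersed lines), together with an
OU measure on each streamline which is finite on closed stream arcs. -/
structure MeasuredTurbulation (μ : Measure S) where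
  lines : Set (Set S)
  lines_immersed : ∀ ℓ ∈ lines, IsImmersedLine ℓ
  lines_disjoint : lines.PairwiseDisjoint id
  domain_borel : MeasurableSet (⋃₀ lines)
  domain_full : μ (⋃₀ lines) = 1
  ν : Set S → Measure S
  ν_supported : ∀ ℓ ∈ lines, ν ℓ ℓᶜ = 0
  ν_nonatomic : ∀ ℓ ∈ lines, ∀ x : S, ν ℓ {x} = 0
  ν_arc_pos : ∀ ℓ ∈ lines, ∀ A : Set S, ∀ x y : S, IsArcIn ℓ A x y → x ≠ y → 0 < ν ℓ A
  ν_arc_finite : ∀ ℓ ∈ lines, ∀ A : Set S, ∀ x y : S, IsArcIn ℓ A x y → ν ℓ A < ⊤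

namespace MeasuredTurbulation

variable {μ : Measure S}

/-- Tameness with respect to a given metric `d`: stream arcs of small stream measure are small. -/
def TameWith (T : MeasuredTurbulation μ) (d : S → S → ℝ) : Prop :=
  ∀ ε : ℝ, 0 < ε → ∃ δ : ℝ, 0 < δ ∧
    ∀ ℓ ∈ T.lines, ∀ A : Set S, ∀ x y : S,
      IsArcIn ℓ A x y → T.ν ℓ A < ENNReal.ofReal δ → d x y < ε

/-- A measured turbulation is tame if it is tame with respect to (every, equivalently some)
metric on `S` compatible with its topology. -/
def Tame (T : MeasuredTurbulation μ) : Prop :=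
  ∀ d : S → S → ℝ, IsCompatibleMetric S d → T.TameWith d

/-- Every streamline is dense in `S`. -/
def DenseStreamlines (T : MeasuredTurbulation μ) : Prop := ∀ ℓ ∈ T.lines, Dense ℓ

/-- Two measured turbulations are transverse if almost every point lies on streamlines of both
which intersect transversely there. -/
def TransversePair (Ts Tu : MeasuredTurbulation μ) : Prop :=
  ∃ W : Set S, MeasurableSet W ∧ μ W = 1 ∧
    ∀ x ∈ W, ∃ ℓ ∈ Ts.lines, ∃ ℓ' ∈ Tu.lines, x ∈ ℓ ∧ x ∈ ℓ' ∧ TransverseAt ℓ ℓ' x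

end MeasuredTurbulation

/-- A tartan for the (stable, unstable) pair of measured turbulations `(Ts, Tu)`. -/
structure Tartan {μ : Measure S} (Ts Tu : MeasuredTurbulation μ) where
  Rs : Set S
  Ru : Set S
  borel_s : MeasurableSet Rs
  borel_u : MeasurableSet Ru
  fibs : Set (Set S)
  fibu : Set (Set S)
  fibs_disjoint : fibs.PairwiseDisjoint id
  fibu_disjoint : fibu.PairwiseDisjoint id
  fibs_cover : ⋃₀ fibs = Rs
  fibu_cover : ⋃₀ fibu = Ru
  /-- (a) every stable fiber meets every unstable fiber in exactly one point. -/
  inter_unique : ∀ A ∈ fibs, ∀ B ∈ fibu, ∃! z : S, z ∈ A ∩ B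
  /-- The fibers are stream arcs of the corresponding turbulations, and (b) they can be
  oriented consistently: every stable fiber crosses the unstable fibers in the same order,
  and vice versa. -/
  oriented : ∃ ords ordu : Set S → S → S → Prop,
    (∀ A ∈ fibs, ∃ ℓ ∈ Ts.lines, ∃ f : ℝ → S, Continuous f ∧ Function.Injective f ∧
        Set.range f = ℓ ∧ ∃ a b : ℝ, a ≤ b ∧ A = f '' Set.Icc a b ∧
        ∀ s ∈ Set.Icc a b, ∀ t ∈ Set.Icc a b, (ords A (f s) (f t) ↔ s ≤ t)) ∧
    (∀ B ∈ fibu, ∃ ℓ ∈ Tu.lines, ∃ f : ℝ → S, Continuous f ∧ Function.Injective f ∧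
        Set.range f = ℓ ∧ ∃ a b : ℝ, a ≤ b ∧ B = f '' Set.Icc a b ∧
        ∀ s ∈ Set.Icc a b, ∀ t ∈ Set.Icc a b, (ordu B (f s) (f t) ↔ s ≤ t)) ∧
    (∀ A ∈ fibs, ∀ A' ∈ fibs, ∀ B ∈ fibu, ∀ B' ∈ fibu,
      ∀ p ∈ A ∩ B, ∀ q ∈ A ∩ B', ∀ p' ∈ A' ∩ B, ∀ q' ∈ A' ∩ B',
        (ords A p q ↔ ords A' p' q')) ∧
    (∀ B ∈ fibu, ∀ B' ∈ fibu, ∀ A ∈ fibs, ∀ A' ∈ fibs,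
      ∀ p ∈ B ∩ A, ∀ q ∈ B ∩ A', ∀ p' ∈ B' ∩ A, ∀ q' ∈ B' ∩ A',
        (ordu B p q ↔ ordu B' p' q'))
  /-- (c) the stream measures of the fibers are bounded above. -/
  bounded : ∃ L : ℝ≥0∞, L < ⊤ ∧
    (∀ A ∈ fibs, ∀ ℓ ∈ Ts.lines, A ⊆ ℓ → Ts.ν ℓ A ≤ L) ∧
    (∀ B ∈ fibu, ∀ ℓ ∈ Tu.lines, B ⊆ ℓ → Tu.ν ℓ B ≤ L)
  /-- (d) `Rs ∪ Ru` is contained in an open topological disk. -/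
  in_disk : ∃ U : Set S, IsOpen U ∧ Rs ∪ Ru ⊆ U ∧ Nonempty (U ≃ₜ ℝ × ℝ)

namespace Tartan

variable {μ : Measure S} {Ts Tu : MeasuredTurbulation μ}

/-- The set `R^⋔` of tartan intersection points. -/
def core (R : Tartan Ts Tu) : Set S := R.Rs ∩ R.Ru

/-- The tartan `R` is compatible with the ambient measure `μ`: for all stable and unstable
fibers `𝔰`, `𝔲`, the bijection `ψ : E^𝔰 × E^𝔲 → R^⋔`, `(x, y) ↦ 𝔲(x) ⋔ 𝔰(y)`, is
bi-measurable and pushes `ν_𝔰 × ν_𝔲` forward to `μ` restricted to `R^⋔`. -/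
def Compatible (R : Tartan Ts Tu) : Prop :=
  ∀ 𝔰 ∈ R.fibs, ∀ 𝔲 ∈ R.fibu,
  ∀ ℓs ∈ Ts.lines, 𝔰 ⊆ ℓs → ∀ ℓu ∈ Tu.lines, 𝔲 ⊆ ℓu →
  ∃ ψ : S × S → S,
    (∀ x ∈ 𝔰 ∩ R.core, ∀ y ∈ 𝔲 ∩ R.core,
      ∀ B ∈ R.fibu, x ∈ B → ∀ A ∈ R.fibs, y ∈ A → ψ (x, y) ∈ B ∩ A) ∧
    Set.InjOn ψ ((𝔰 ∩ R.core) ×ˢ (𝔲 ∩ R.core)) ∧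
    ψ '' ((𝔰 ∩ R.core) ×ˢ (𝔲 ∩ R.core)) = R.core ∧
    Measurable ψ ∧
    (∀ E : Set (S × S), E ⊆ (𝔰 ∩ R.core) ×ˢ (𝔲 ∩ R.core) → MeasurableSet E →
      MeasurableSet (ψ '' E)) ∧
    Measure.map ψ (((Ts.ν ℓs).restrict (𝔰 ∩ R.core)).prod
      ((Tu.ν ℓu).restrict (𝔲 ∩ R.core))) = μ.restrict R.core

/-- Image of `B ⊆ E^𝔰` under the holonomy map `h_{𝔰,𝔰'} : E^𝔰 → E^{𝔰'}`, `x ↦ 𝔲(x) ⋔ 𝔰'`. -/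
def holSS (R : Tartan Ts Tu) (𝔰' B : Set S) : Set S :=
  {x' : S | ∃ x ∈ B, ∃ Bu ∈ R.fibu, x ∈ Bu ∧ x' ∈ Bu ∩ 𝔰'}

/-- Image of `B ⊆ E^𝔲` under the holonomy map `h_{𝔲,𝔲'} : E^𝔲 → E^{𝔲'}`, `y ↦ 𝔰(y) ⋔ 𝔲'`. -/
def holUU (R : Tartan Ts Tu) (𝔲' B : Set S) : Set S :=
  {y' : S | ∃ y ∈ B, ∃ A ∈ R.fibs, y ∈ A ∧ y' ∈ A ∩ 𝔲'}

/-- "`𝔲(x) ⋔ 𝔰(y) ∈ A`": the intersection point of the unstable fiber through `x` and the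
stable fiber through `y` belongs to `A`. -/
def sectMem (R : Tartan Ts Tu) (A : Set S) (x y : S) : Prop :=
  ∃ B ∈ R.fibu, x ∈ B ∧ ∃ C ∈ R.fibs, y ∈ C ∧ ∃ z ∈ B ∩ C, z ∈ A

/-- `ν_{𝔲(x)}(A ∩ 𝔲(x))`: the stream measure of `A` along the unstable fiber through `x`. -/
def fiberMeasU (R : Tartan Ts Tu) (A : Set S) (x : S) : ℝ≥0∞ :=
  ⨆ (B : Set S) (_ : B ∈ R.fibu) (_ : x ∈ B) (ℓ : Set S) (_ : ℓ ∈ Tu.lines) (_ : B ⊆ ℓ),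
    Tu.ν ℓ (A ∩ B)

/-- `ν_{𝔰(y)}(A ∩ 𝔰(y))`: the stream measure of `A` along the stable fiber through `y`. -/
def fiberMeasS (R : Tartan Ts Tu) (A : Set S) (y : S) : ℝ≥0∞ :=
  ⨆ (C : Set S) (_ : C ∈ R.fibs) (_ : y ∈ C) (ℓ : Set S) (_ : ℓ ∈ Ts.lines) (_ : C ⊆ ℓ),
    Ts.ν ℓ (A ∩ C)

end Tartan

/-- The union of the stable streamlines containing fibers of `R`. -/
def stableSaturation {μ : Measure S} {Ts Tu : MeasuredTurbulation μ} (R : Tartan Ts Tu) :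
    Set S :=
  ⋃₀ {ℓ : Set S | ℓ ∈ Ts.lines ∧ ∃ A ∈ R.fibs, A ⊆ ℓ}

/-- The union of the unstable streamlines containing fibers of `R`. -/
def unstableSaturation {μ : Measure S} {Ts Tu : MeasuredTurbulation μ} (R : Tartan Ts Tu) :
    Set S :=
  ⋃₀ {ℓ : Set S | ℓ ∈ Tu.lines ∧ ∃ B ∈ R.fibu, B ⊆ ℓ}

/-- The pair `(Ts, Tu)` is full: countably many compatible tartans cover a full measure
subset of `S`, and every non-empty open set contains a positive measure compatible tartan. -/
def FullPair {μ : Measure S} (Ts Tu : MeasuredTurbulation μ) : Prop :=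
  (∃ R : ℕ → Tartan Ts Tu, (∀ i, (R i).Compatible) ∧ μ (⋃ i, (R i).core) = 1) ∧
  (∀ U : Set S, IsOpen U → U.Nonempty →
    ∃ R : Tartan Ts Tu, R.Compatible ∧ 0 < μ R.core ∧ R.Rs ∪ R.Ru ⊆ U)

/-- `(Ts, Tu)` are measurable pseudo-Anosov turbulations: transverse, tame, full, with
dense streamlines. -/
def MPATurbulations {μ : Measure S} (Ts Tu : MeasuredTurbulation μ) : Prop :=
  Ts.TransversePair Tu ∧ Ts.Tame ∧ Tu.Tame ∧ FullPair Ts Tu ∧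
    Ts.DenseStreamlines ∧ Tu.DenseStreamlines

/-- `F` is a measurable pseudo-Anosov homeomorphism with invariant turbulations `(Ts, Tu)`
and dilatation `lam > 1`. -/
structure IsMPA (μ : Measure S) (F : S ≃ₜ S) (Ts Tu : MeasuredTurbulation μ)
    (lam : ℝ) : Prop where
  measurePreserving : MeasurePreserving (⇑F) μ μ
  one_lt_lam : 1 < lam
  turbulations : MPATurbulations Ts Tu
  stable_image : ∀ ℓ ∈ Ts.lines, ⇑F '' ℓ ∈ Ts.lines
  unstable_image : ∀ ℓ ∈ Tu.lines, ⇑F '' ℓ ∈ Tu.lines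
  stable_contract : ∀ ℓ ∈ Ts.lines, ∀ A : Set S, ∀ x y : S, IsArcIn ℓ A x y →
    Ts.ν (⇑F '' ℓ) (⇑F '' A) = (ENNReal.ofReal lam)⁻¹ * Ts.ν ℓ A
  unstable_expand : ∀ ℓ ∈ Tu.lines, ∀ A : Set S, ∀ x y : S, IsArcIn ℓ A x y →
    Tu.ν (⇑F '' ℓ) (⇑F '' A) = ENNReal.ofReal lam * Tu.ν ℓ A

/-- `x` is a (two-sided) density point of `D` along the streamline `ℓ` of `T`. -/
def DensityPtAlong {μ : Measure S} (T : MeasuredTurbulation μ) (ℓ D : Set S) (x : S) :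
    Prop :=
  ∀ ε : ℝ, 0 < ε → ∃ δ : ℝ, 0 < δ ∧ ∀ A : Set S, ∀ y : S,
    IsArcIn ℓ A x y → T.ν ℓ A < ENNReal.ofReal δ →
      (1 - ε) * (T.ν ℓ A).toReal ≤ (T.ν ℓ (A ∩ D)).toReal

/-- The set `den_k(R)` of level `k` density points of the tartan `R`. -/
def denSet {μ : Measure S} {Ts Tu : MeasuredTurbulation μ} (R : Tartan Ts Tu) :
    ℕ → Set S
  | 0 => R.core
  | k + 1 =>
    {x : S | x ∈ denSet R k ∧
      (∀ ℓ ∈ Ts.lines, x ∈ ℓ → DensityPtAlong Ts ℓ (denSet R k) x) ∧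
      (∀ ℓ ∈ Tu.lines, x ∈ ℓ → DensityPtAlong Tu ℓ (denSet R k) x)}

/-- The set `X_{δ,η}(R)`: points of `R^⋔` all of whose stable and unstable stream arcs of
measure less than `η` contain points of `R^⋔` in density at least `1 - δ`. -/
def Xset {μ : Measure S} {Ts Tu : MeasuredTurbulation μ} (R : Tartan Ts Tu)
    (δ η : ℝ) : Set S :=
  {x : S | x ∈ R.core ∧
    (∀ ℓ ∈ Ts.lines, x ∈ ℓ → ∀ A : Set S, ∀ y : S, IsArcIn ℓ A x y →
      Ts.ν ℓ A < ENNReal.ofReal η →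
        ENNReal.ofReal (1 - δ) * Ts.ν ℓ A ≤ Ts.ν ℓ (A ∩ R.core)) ∧
    (∀ ℓ ∈ Tu.lines, x ∈ ℓ → ∀ A : Set S, ∀ y : S, IsArcIn ℓ A x y →
      Tu.ν ℓ A < ENNReal.ofReal η →
        ENNReal.ofReal (1 - δ) * Tu.ν ℓ A ≤ Tu.ν ℓ (A ∩ R.core))}

/-- A regular tartan: for `y ∈ 𝔰(x) ∩ R^⋔` and `z ∈ 𝔲(x) ∩ R^⋔` at small stream distance
from `x`, all the fibers of the subtartan `R(y,z)` (the subarcs of stable fibers running from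
`𝔲(y)` to `𝔲(z) = 𝔲(x)`, and of unstable fibers running from `𝔰(y) = 𝔰(x)` to `𝔰(z)`)
are contained in `U`. -/
def Tartan.Regular {μ : Measure S} {Ts Tu : MeasuredTurbulation μ}
    (R : Tartan Ts Tu) : Prop :=
  ∀ x ∈ R.core, ∀ U ∈ 𝓝 x, ∃ δ : ℝ, 0 < δ ∧
    ∀ 𝔰x ∈ R.fibs, x ∈ 𝔰x → ∀ 𝔲x ∈ R.fibu, x ∈ 𝔲x →
    ∀ y ∈ 𝔰x ∩ R.core, ∀ z ∈ 𝔲x ∩ R.core,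
    (∀ ℓ ∈ Ts.lines, 𝔰x ⊆ ℓ → ∀ α : Set S, IsArcIn ℓ α x y →
      Ts.ν ℓ α < ENNReal.ofReal δ) →
    (∀ ℓ ∈ Tu.lines, 𝔲x ⊆ ℓ → ∀ α : Set S, IsArcIn ℓ α x z →
      Tu.ν ℓ α < ENNReal.ofReal δ) →
    ∀ 𝔲y ∈ R.fibu, y ∈ 𝔲y → ∀ 𝔰z ∈ R.fibs, z ∈ 𝔰z →
      ((∀ A ∈ R.fibs, ∀ p q : S, p ∈ A ∩ 𝔲y → q ∈ A ∩ 𝔲x →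
          ∀ ℓ ∈ Ts.lines, A ⊆ ℓ → ∀ α : Set S, IsArcIn ℓ α p q → α ⊆ U) ∧
       (∀ B ∈ R.fibu, ∀ p q : S, p ∈ B ∩ 𝔰x → q ∈ B ∩ 𝔰z →
          ∀ ℓ ∈ Tu.lines, B ⊆ ℓ → ∀ β : Set S, IsArcIn ℓ β p q → β ⊆ U))

/-- A (stable) bi-Lipschitz regular tartan: for some metric compatible with the topology of
`S` and some `K ≥ 1`, stream measure and distance are `K`-bi-Lipschitz comparable along
stable fibers. -/
def Tartan.StableBiLipschitzRegular {μ : Measure S} {Ts Tu : MeasuredTurbulation μ}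
    (R : Tartan Ts Tu) : Prop :=
  ∃ d : S → S → ℝ, IsCompatibleMetric S d ∧ ∃ K : ℝ, 1 ≤ K ∧
    ∀ 𝔰 ∈ R.fibs, ∀ x ∈ 𝔰, ∀ y ∈ 𝔰, ∀ ℓ ∈ Ts.lines, 𝔰 ⊆ ℓ →
      ∀ α : Set S, IsArcIn ℓ α x y →
        d x y / K ≤ (Ts.ν ℓ α).toReal ∧ (Ts.ν ℓ α).toReal ≤ K * d x y

/-- The turbulation `T` has partial flowboxes: if `x` and `y` lie on the same streamline
`ℓ`, and arcs transverse to `ℓ` at `x` and `y` contain transverse intersections with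
streamlines of `T` arbitrarily close to `x` and `y` on the same side of `ℓ`, then every
neighbourhood `U` of the stream arc `[x,y]` contains other stream arcs with endpoints on the
two transversals.  (The transversals and the side are encoded via a chart straightening the
streamline.) -/
def HasPartialFlowboxes {μ : Measure S} (T : MeasuredTurbulation μ) : Prop :=
  ∀ ℓ ∈ T.lines, ∀ x y : S, ∀ A : Set S, IsArcIn ℓ A x y →
  ∀ V : Set S, IsOpen V → ∀ e : V ≃ₜ ℝ × ℝ, A ⊆ V →
  (Subtype.val '' (⇑e ⁻¹' {p : ℝ × ℝ | p.2 = 0}) ⊆ ℓ) →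
  (∃ hx : x ∈ V, e ⟨x, hx⟩ = (0, 0)) →
  (∃ hy : y ∈ V, e ⟨y, hy⟩ = (1, 0)) →
  (∀ ε : ℝ, 0 < ε → ∃ p : S, ∃ hp : p ∈ V,
      (e ⟨p, hp⟩).1 = 0 ∧ 0 < (e ⟨p, hp⟩).2 ∧ (e ⟨p, hp⟩).2 < ε ∧
      ∃ ℓ' ∈ T.lines, p ∈ ℓ' ∧
        TransverseAt ℓ' (Subtype.val '' (⇑e ⁻¹' {q : ℝ × ℝ | q.1 = 0})) p) →
  (∀ ε : ℝ, 0 < ε → ∃ p : S, ∃ hp : p ∈ V,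
      (e ⟨p, hp⟩).1 = 1 ∧ 0 < (e ⟨p, hp⟩).2 ∧ (e ⟨p, hp⟩).2 < ε ∧
      ∃ ℓ' ∈ T.lines, p ∈ ℓ' ∧
        TransverseAt ℓ' (Subtype.val '' (⇑e ⁻¹' {q : ℝ × ℝ | q.1 = 1})) p) →
  ∀ U : Set S, IsOpen U → A ⊆ U →
    ∃ ℓ'' ∈ T.lines, ∃ A'' : Set S, ∃ x'' y'' : S, IsArcIn ℓ'' A'' x'' y'' ∧
      A'' ⊆ U ∧ A'' ≠ A ∧
      x'' ∈ Subtype.val '' (⇑e ⁻¹' {q : ℝ × ℝ | q.1 = 0}) ∧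
      y'' ∈ Subtype.val '' (⇑e ⁻¹' {q : ℝ × ℝ | q.1 = 1})

/-- Forward Birkhoff averages of `φ` under the homeomorphism `F`. -/
def birkhoffFwd (F : S ≃ₜ S) (φ : S → ℝ) (x : S) (n : ℕ) : ℝ :=
  (n : ℝ)⁻¹ * ∑ i ∈ Finset.range n, φ ((⇑F)^[i] x)

/-- Backward Birkhoff averages of `φ` under the homeomorphism `F`. -/
def birkhoffBwd (F : S ≃ₜ S) (φ : S → ℝ) (x : S) (n : ℕ) : ℝ :=
  (n : ℝ)⁻¹ * ∑ i ∈ Finset.range n, φ ((⇑F.symm)^[i] x)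

/-- The set `Z` of points where the forward and backward Birkhoff averages of `φ` exist
and are equal. -/
def ZSet (F : S ≃ₜ S) (φ : S → ℝ) : Set S :=
  {x : S | ∃ c : ℝ, Tendsto (birkhoffFwd F φ x) atTop (𝓝 c) ∧
      Tendsto (birkhoffBwd F φ x) atTop (𝓝 c)}

/-- The relation `~` on `Z`: `x ~ y` if they are joined by a finite chain of stream arcs
whose consecutive intersections contain points of `Z`. -/
def StreamRel {μ : Measure S} (Ts Tu : MeasuredTurbulation μ) (F : S ≃ₜ S)
    (φ : S → ℝ) (x y : S) : Prop :=
  x ∈ ZSet F φ ∧ y ∈ ZSet F φ ∧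
  (x = y ∨ ∃ k : ℕ, ∃ α : Fin (k + 1) → Set S,
    (∀ i, (∃ ℓ ∈ Ts.lines, IsArc ℓ (α i)) ∨ (∃ ℓ ∈ Tu.lines, IsArc ℓ (α i))) ∧
    x ∈ α 0 ∧ y ∈ α (Fin.last k) ∧
    ∀ i : Fin k, ∃ z ∈ α i.castSucc ∩ α i.succ, z ∈ ZSet F φ)

/-- A path in the plane avoiding `ζ` has a continuous logarithm. -/
lemma exists_log_lift (γ : C(unitInterval, ℂ)) (ζ : ℂ) (h : ∀ s, γ s ≠ ζ) :
    ∃ L : C(unitInterval, ℂ), ∀ s, Complex.exp (L s) = γ s - ζ := by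
  let γ' : C(unitInterval, {z : ℂ // z ≠ 0}) :=
    ⟨fun s => ⟨γ s - ζ, sub_ne_zero.2 (h s)⟩, by fun_prop⟩
  obtain ⟨L, hL, -⟩ := Complex.isCoveringMap_exp.exists_path_lifts γ' (Complex.log (γ 0 - ζ))
    (Subtype.ext (by simp [γ', Complex.exp_log (sub_ne_zero.2 (h 0))]))
  exact ⟨L, fun s => congrArg Subtype.val (congrFun hL s)⟩

lemma eq_zero_of_exp_eq_one {z : ℂ} (h : Complex.exp z = 1) (hz : ‖z‖ < 1) : z = 0 := by
  obtain ⟨n, rfl⟩ := Complex.exp_eq_one_iff.1 h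
  rcases eq_or_ne n 0 with rfl | hn
  · simp
  · exfalso
    have : (1 : ℝ) ≤ |(n : ℝ)| := by exact_mod_cast Int.one_le_abs hn
    have h2 : ‖(n : ℂ) * (2 * Real.pi * Complex.I)‖ = |(n : ℝ)| * (2 * Real.pi) := by
      simp [abs_of_pos Real.pi_pos]
    rw [h2] at hz
    nlinarith [Real.pi_gt_three]

/-- Continuous functions with equal exponentials agree up to a constant. -/
lemma sub_const_of_exp_eq {X : Type*} [TopologicalSpace X] [PreconnectedSpace X] {L L' : X → ℂ}
    (hL : Continuous L) (hL' : Continuous L') (h : ∀ s, Complex.exp (L s) = Complex.exp (L' s))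
    (s t : X) : L s - L' s = L t - L' t := by
  have : IsLocallyConstant fun s => L s - L' s := by
    rw [IsLocallyConstant.iff_eventually_eq]
    intro x
    have hc : Continuous fun y => (L y - L' y) - (L x - L' x) := by fun_prop
    have : ∀ᶠ y in 𝓝 x, ‖(L y - L' y) - (L x - L' x)‖ < 1 :=
      (hc.norm.tendsto x).eventually_lt_const (by simp)
    filter_upwards [this] with y hy
    refine sub_eq_zero.1 (eq_zero_of_exp_eq_one ?_ hy)
    simp [Complex.exp_sub, h]
  exact this.apply_eq_of_isPreconnected isPreconnected_univ (mem_univ _) (mem_univ _)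

open Classical in
/-- The variation of a continuous logarithm of `γ - ζ` along the path `γ`. -/
noncomputable def logVar (γ : C(unitInterval, ℂ)) (ζ : ℂ) : ℂ :=
  if h : ∀ s, γ s ≠ ζ then (exists_log_lift γ ζ h).choose 1 - (exists_log_lift γ ζ h).choose 0
  else 0

lemma logVar_eq {γ : C(unitInterval, ℂ)} {ζ : ℂ} {L : unitInterval → ℂ} (hL : Continuous L)
    (h : ∀ s, Complex.exp (L s) = γ s - ζ) : logVar γ ζ = L 1 - L 0 := by
  have h0 : ∀ s, γ s ≠ ζ := fun s hs => Complex.exp_ne_zero (L s) (by rw [h, hs, sub_self])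
  have := sub_const_of_exp_eq (exists_log_lift γ ζ h0).choose.continuous hL
    (fun s => by rw [(exists_log_lift γ ζ h0).choose_spec, h]) 1 0
  rw [logVar, dif_pos h0]
  linear_combination this

lemma exp_logVar {γ : C(unitInterval, ℂ)} {ζ : ℂ} (h : ∀ s, γ s ≠ ζ) :
    Complex.exp (logVar γ ζ) = (γ 1 - ζ) / (γ 0 - ζ) := by
  obtain ⟨L, hL⟩ := exists_log_lift γ ζ h
  rw [logVar_eq L.continuous hL, Complex.exp_sub, hL, hL]

lemma continuousAt_logVar {γ : C(unitInterval, ℂ)} {ζ₀ : ℂ} (h : ∀ s, γ s ≠ ζ₀) :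
    ContinuousAt (logVar γ) ζ₀ := by
  obtain ⟨L, hL⟩ := exists_log_lift γ ζ₀ h
  have hne : ∀ s, γ s - ζ₀ ≠ 0 := fun s => sub_ne_zero.2 (h s)
  have hc : IsCompact (range γ) := isCompact_range γ.continuous
  obtain ⟨δ, hδ, hball⟩ := Metric.isOpen_iff.1 hc.isClosed.isOpen_compl ζ₀
    (by rintro ⟨s, hs⟩; exact h s hs)
  have key : ∀ᶠ ζ in 𝓝 ζ₀, logVar γ ζ₀ + (Complex.log (1 + (ζ₀ - ζ) / (γ 1 - ζ₀)) -
      Complex.log (1 + (ζ₀ - ζ) / (γ 0 - ζ₀))) = logVar γ ζ := by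
    filter_upwards [Metric.ball_mem_nhds ζ₀ hδ] with ζ hζ
    have hlt : ∀ s, ‖(ζ₀ - ζ) / (γ s - ζ₀)‖ < 1 := by
      intro s
      rw [norm_div, div_lt_one (norm_pos_iff.2 (hne s))]
      have h1 : γ s ∉ Metric.ball ζ₀ δ := fun hs => hball hs ⟨s, rfl⟩
      rw [Metric.mem_ball, dist_eq_norm] at h1 hζ
      rw [norm_sub_rev]
      linarith
    have hs : ∀ s, 1 + (ζ₀ - ζ) / (γ s - ζ₀) ∈ Complex.slitPlane :=
      fun s => Complex.mem_slitPlane_of_norm_lt_one (hlt s)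
    have hcont : Continuous fun s => L s + Complex.log (1 + (ζ₀ - ζ) / (γ s - ζ₀)) := by
      refine L.continuous.add (Continuous.clog ?_ hs)
      exact continuous_const.add (continuous_const.div (by fun_prop) hne)
    rw [logVar_eq (ζ := ζ) hcont, logVar_eq L.continuous hL]
    · ring
    · intro s
      rw [Complex.exp_add, hL, Complex.exp_log (Complex.slitPlane_ne_zero (hs s))]
      field_simp [hne s]
      ring
  refine ContinuousAt.congr ?_ key
  have hlog : ∀ s, ContinuousAt (fun ζ => Complex.log (1 + (ζ₀ - ζ) / (γ s - ζ₀))) ζ₀ := by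
    intro s
    refine ContinuousAt.clog (by fun_prop) (by simp)
  exact continuousAt_const.add ((hlog 1).sub (hlog 0))

lemma abs_im_logVar_lt {γ : C(unitInterval, ℂ)} {P : Set ℂ} (hP : Convex ℝ P) (hPc : IsClosed P)
    (hγ : ∀ s, γ s ∈ P) {ζ : ℂ} (hζ : ζ ∉ P) : |(logVar γ ζ).im| < Real.pi := by
  obtain ⟨f, u, hu, hf⟩ := RCLike.geometric_hahn_banach_point_closed (𝕜 := ℂ) hP hPc hζ
  have hfw : ∀ z : ℂ, f z = f 1 * z := fun z => by
    have := f.map_smul z 1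
    simp only [smul_eq_mul, mul_one] at this
    rw [this, mul_comm]
  have hre : ∀ s, 0 < (f 1 * (γ s - ζ)).re := by
    intro s
    rw [← hfw, map_sub, Complex.sub_re]
    have := hf _ (hγ s)
    simp only [RCLike.re_eq_complex_re] at *
    linarith
  have hw : f 1 ≠ 0 := fun h => by simpa [h] using hre 0
  have hc : Continuous fun s => Complex.log (f 1 * (γ s - ζ)) - Complex.log (f 1) := by
    refine Continuous.sub (Continuous.clog (by fun_prop) fun s => Or.inl (hre s)) continuous_const
  have harg : ∀ s, |(Complex.log (f 1 * (γ s - ζ))).im| < Real.pi / 2 := by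
    intro s
    rw [Complex.log_im, Complex.abs_arg_lt_pi_div_two_iff]
    exact Or.inl (hre s)
  rw [logVar_eq hc]
  · have h1 := abs_lt.1 (harg 1)
    have h0 := abs_lt.1 (harg 0)
    simp only [Complex.sub_im] 
    rw [abs_lt]
    constructor <;> linarith
  · intro s
    have : f 1 * (γ s - ζ) ≠ 0 := fun h => by simpa [h] using hre s
    rw [Complex.exp_sub, Complex.exp_log this, Complex.exp_log hw]
    field_simp

/-- The plane region enclosed by a path from `q` to `p` and the segment `[p, q]`, near a point `m`
of the segment such that the path does not meet the vertical ray below `m`. -/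
lemma exists_enclosed_region {p m q : ℝ} (hpm : p < m) (hmq : m < q) (γ : C(unitInterval, ℂ))
    (h0 : γ 0 = q) (h1 : γ 1 = p) {P : Set ℂ} (hP : Convex ℝ P) (hPc : IsCompact P)
    (hγP : ∀ s, γ s ∈ P) (hray : ∀ s, ∀ t : ℝ, 0 ≤ t → γ s ≠ m - t * Complex.I) :
    ∃ Ω : Set ℂ, IsOpen Ω ∧ Ω ⊆ P ∧
      closure Ω ⊆ Ω ∪ range γ ∪ (Complex.ofReal '' Icc p q) ∧
      ∀ᶠ ζ in 𝓝 (m : ℂ), 0 < ζ.im → ζ ∈ Ω := by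
  have hpq : p < q := hpm.trans hmq
  set N : Set ℂ := range γ ∪ Complex.ofReal '' Icc p q with hN
  have hNc : IsClosed N := (isCompact_range γ.continuous).isClosed.union
    (isCompact_Icc.image Complex.continuous_ofReal).isClosed
  set ρ : ℂ → ℂ := fun ζ => (p - ζ) / (q - ζ) with hρ
  have hρim : ∀ ζ : ℂ, ζ ≠ q → (ρ ζ).im = -(ζ.im * (q - p)) / Complex.normSq (q - ζ) := by
    intro ζ hζ
    simp only [hρ, Complex.div_im, Complex.sub_re, Complex.sub_im, Complex.ofReal_re,
      Complex.ofReal_im]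
    ring
  have hslit : ∀ ζ ∉ N, ρ ζ ∈ Complex.slitPlane := by
    intro ζ hζ
    have hq : ζ ≠ q := fun h => hζ (Or.inr ⟨q, ⟨hpq.le, le_rfl⟩, h.symm⟩)
    have hsq : 0 < Complex.normSq (q - ζ) := Complex.normSq_pos.2 (sub_ne_zero.2 hq.symm)
    by_cases him : ζ.im = 0
    · left
      obtain ⟨x, rfl⟩ : ∃ x : ℝ, (x : ℂ) = ζ := ⟨ζ.re, Complex.ext (by simp) (by simp [him])⟩
      have hx : x ∉ Icc p q := fun h => hζ (Or.inr ⟨x, h, rfl⟩)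
      have : ρ x = (((p - x) / (q - x) : ℝ) : ℂ) := by simp [hρ]
      rw [this, Complex.ofReal_re]
      rw [mem_Icc, not_and_or, not_le, not_le] at hx
      rcases hx with hx | hx
      · exact div_pos (by linarith) (by linarith)
      · exact div_pos_of_neg_of_neg (by linarith) (by linarith)
    · right
      rw [hρim ζ hq]
      have : q - p ≠ 0 := by linarith
      exact div_ne_zero (neg_ne_zero.2 (mul_ne_zero him this)) hsq.ne'
  have hne : ∀ ζ ∉ N, ∀ s, γ s ≠ ζ := fun ζ hζ s h => hζ (Or.inl ⟨s, h⟩)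
  set D : ℂ → ℂ := fun ζ => logVar γ ζ - Complex.log (ρ ζ) with hD
  have hDexp : ∀ ζ ∉ N, Complex.exp (D ζ) = 1 := by
    intro ζ hζ
    have h3 := Complex.slitPlane_ne_zero (hslit ζ hζ)
    rw [hD, Complex.exp_sub, exp_logVar (hne ζ hζ), Complex.exp_log h3, h0, h1]
    exact div_self h3
  have hDcont : ∀ ζ ∉ N, ContinuousAt D ζ := by
    intro ζ hζ
    have hq : (q : ℂ) - ζ ≠ 0 := sub_ne_zero.2 fun h => hζ (Or.inr ⟨q, ⟨hpq.le, le_rfl⟩, h⟩)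
    refine (continuousAt_logVar (hne ζ hζ)).sub (ContinuousAt.clog ?_ (hslit ζ hζ))
    exact ContinuousAt.div (by fun_prop) (by fun_prop) hq
  have hDloc : ∀ ζ ∉ N, ∀ᶠ z in 𝓝 ζ, D z = D ζ := by
    intro ζ hζ
    have h2 : ∀ᶠ z in 𝓝 ζ, ‖D z - D ζ‖ < 1 :=
      (((hDcont ζ hζ).sub (continuousAt_const (y := D ζ))).norm).eventually_lt_const (by simp)
    filter_upwards [h2, hNc.isOpen_compl.mem_nhds hζ] with z hz hzN
    refine sub_eq_zero.1 (eq_zero_of_exp_eq_one ?_ hz)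
    rw [Complex.exp_sub, hDexp z hzN, hDexp ζ hζ, div_one]
  refine ⟨{ζ | ζ ∉ N ∧ D ζ ≠ 0}, ?_, ?_, ?_, ?_⟩
  · rw [isOpen_iff_mem_nhds]
    rintro ζ ⟨hζ, hD0⟩
    filter_upwards [hDloc ζ hζ, hNc.isOpen_compl.mem_nhds hζ] with z hz hzN
    exact ⟨hzN, hz ▸ hD0⟩
  · rintro ζ ⟨hζ, hD0⟩
    by_contra hζP
    apply hD0
    have him := abs_lt.1 (abs_im_logVar_lt hP hPc.isClosed hγP hζP)
    refine sub_eq_zero.2 ?_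
    have := exp_logVar (hne ζ hζ)
    rw [h0, h1] at this
    change _ = Complex.log (_ / _)
    rw [← this, Complex.log_exp him.1 him.2.le]
  · intro ζ hζ
    by_cases hζN : ζ ∈ N
    · rcases hζN with h | h
      exacts [Or.inl (Or.inr h), Or.inr h]
    · refine Or.inl (Or.inl ⟨hζN, fun hD0 => ?_⟩)
      obtain ⟨z, hz, hz2⟩ := (mem_closure_iff_frequently.1 hζ).and_eventually (hDloc ζ hζN) |>.exists
      exact hz.2 (hz2.trans hD0)
  · have hmΓ : ∀ s, γ s ≠ m := fun s => by simpa using hray s 0 le_rfl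
    have hrayN : ∀ t : ℝ, 0 < t → (m : ℂ) - t * Complex.I ∉ N := by
      rintro t ht (⟨s, hs⟩ | ⟨x, -, hx⟩)
      · exact hray s t ht.le hs
      · have := congrArg Complex.im hx
        simp at this
        linarith
    have hmcont := continuousAt_logVar hmΓ
    have hray0 : ∀ t : ℝ, 0 < t → D (m - t * Complex.I) = 0 := by
      intro t ht
      obtain ⟨C, hC⟩ := hPc.isBounded.exists_norm_le
      set T := max t (|m| + C + 1)
      have hTt : t ≤ T := le_max_left _ _
      have hTC : |m| + C + 1 ≤ T := le_max_right _ _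
      have hT : D (m - T * Complex.I) = 0 := by
        by_contra hD0
        have hTP : (m : ℂ) - T * Complex.I ∉ P := by
          intro h
          have h2 := hC _ h
          have h3 : |((m : ℂ) - T * Complex.I).im| ≤ _ := Complex.abs_im_le_norm _
          simp at h3
          have := le_abs_self T
          have := abs_nonneg m
          linarith
        have him := abs_lt.1 (abs_im_logVar_lt hP hPc.isClosed hγP hTP)
        apply hD0
        refine sub_eq_zero.2 ?_
        have := exp_logVar (hne _ (hrayN T (by linarith)))
        rw [h0, h1] at this
        change _ = Complex.log (_ / _)
        rw [← this, Complex.log_exp him.1 him.2.le]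
      have hcst : IsLocallyConstant fun y : Ioi (0 : ℝ) => D (m - (y : ℝ) * Complex.I) := by
        rw [IsLocallyConstant.iff_eventually_eq]
        intro x
        have hc : Continuous fun y : Ioi (0 : ℝ) => (m : ℂ) - (y : ℝ) * Complex.I := by fun_prop
        exact hc.continuousAt.eventually (hDloc _ (hrayN x x.2))
      have hpc : PreconnectedSpace (Ioi (0 : ℝ)) :=
        isPreconnected_iff_preconnectedSpace.1 isPreconnected_Ioi
      exact (hcst.apply_eq_of_isPreconnected isPreconnected_univ (x := ⟨t, ht⟩)
        (y := ⟨T, ht.trans_le hTt⟩) (mem_univ _) (mem_univ _)).trans hT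
    have himm : 0 ≤ (logVar γ m).im := by
      have hc : Tendsto (fun t : ℝ => (logVar γ (m - t * Complex.I)).im) (𝓝[>] 0)
          (𝓝 (logVar γ m).im) := by
        have h2 : Tendsto (fun t : ℝ => (m : ℂ) - t * Complex.I) (𝓝 0) (𝓝 m) := by
          have : Continuous (fun t : ℝ => (m : ℂ) - t * Complex.I) := by fun_prop
          simpa using this.tendsto 0
        exact (Complex.continuous_im.continuousAt.tendsto.comp (hmcont.tendsto.comp h2)).mono_left
          nhdsWithin_le_nhds
      refine ge_of_tendsto hc ?_
      filter_upwards [self_mem_nhdsWithin] with t ht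
      have h2 := sub_eq_zero.1 (hray0 t ht)
      rw [h2, Complex.log_im, Complex.arg_nonneg_iff, hρim]
      · have : 0 ≤ Complex.normSq (q - (m - t * Complex.I)) := Complex.normSq_nonneg _
        have ht' : 0 < t := ht
        apply div_nonneg _ this
        simp
        nlinarith
      · intro h
        have := congrArg Complex.re h
        simp at this
        linarith
    by_contra hcon
    have hfr : ∃ᶠ ζ in 𝓝 (m : ℂ), (logVar γ ζ).im ≤ 0 := by
      rw [Filter.not_eventually] at hcon
      refine (hcon.and_eventually ((isCompact_range γ.continuous).isClosed.isOpen_compl.mem_nhds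
        (by rintro ⟨s, hs⟩; exact hmΓ s hs))).mono ?_
      rintro ζ ⟨hζ, hζΓ⟩
      rw [Classical.not_imp] at hζ
      have hζN : ζ ∉ N := by
        rintro (h | ⟨x, -, hx⟩)
        · exact hζΓ h
        · have := hζ.1
          rw [← hx] at this
          simp at this
      have hD0 : D ζ = 0 := by
        by_contra h
        exact hζ.2 ⟨hζN, h⟩
      rw [sub_eq_zero.1 hD0, Complex.log_im]
      have hq : ζ ≠ q := fun h => hζN (Or.inr ⟨q, ⟨hpq.le, le_rfl⟩, h.symm⟩)
      refine (Complex.arg_neg_iff.2 ?_).le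
      rw [hρim ζ hq]
      have hsq : 0 < Complex.normSq (q - ζ) := Complex.normSq_pos.2 (sub_ne_zero.2 hq.symm)
      have := hζ.1
      apply div_neg_of_neg_of_pos _ hsq
      nlinarith
    have himm' : (logVar γ m).im ≤ 0 := by
      by_contra h
      push Not at h
      have hev : ∀ᶠ ζ in 𝓝 (m : ℂ), 0 < (logVar γ ζ).im :=
        (Complex.continuous_im.continuousAt.comp hmcont).eventually_const_lt h
      obtain ⟨ζ, h1, h2⟩ := (hfr.and_eventually hev).exists
      linarith
    have him0 : (logVar γ m).im = 0 := le_antisymm himm' himm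
    have hexp := exp_logVar hmΓ
    rw [h0, h1] at hexp
    have h2 := congrArg Complex.re hexp
    rw [Complex.exp_re, him0, Real.cos_zero, mul_one] at h2
    have h3 : ((p - m : ℂ) / (q - m)) = (((p - m) / (q - m) : ℝ) : ℂ) := by simp
    rw [h3, Complex.ofReal_re] at h2
    have h4 : (p - m) / (q - m) < 0 := div_neg_of_neg_of_pos (by linarith) (by linarith)
    have := Real.exp_pos (logVar γ m).re
    linarith

section LineComparison
variable {M : Type} [TopologicalSpace M] {a g : ℝ → M} {χ : ℝ → ℝ}

lemma reparam_bounded_or_tendsto_of_strictMonoOn (ha : Continuous a)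
    (hχ : ∀ u, g (χ u) = a u) {p q : ℝ} (hpq : p < q) (hc : ContinuousOn χ (Ioo p q))
    (hm : StrictMonoOn χ (Ioo p q)) :
    (∃ n, ∀ᶠ v in 𝓝[>] p, |χ v| ≤ n) ∨ Tendsto g atBot (𝓝 (a p)) := by
  obtain ⟨c, hc1, hc2⟩ := exists_between hpq
  by_cases hb : ∃ b, ∀ v ∈ Ioo p c, b ≤ χ v
  · left
    obtain ⟨b, hb⟩ := hb
    refine ⟨max |b| |χ c|, ?_⟩
    filter_upwards [Ioo_mem_nhdsGT hc1] with v hv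
    exact abs_le_max_abs_abs (hb v hv) (hm ⟨hv.1, hv.2.trans hc2⟩ ⟨hc1, hc2⟩ hv.2).le
  · right
    push Not at hb
    intro V hV
    have h1 : ∀ᶠ v in 𝓝[>] p, a v ∈ V := (ha.continuousAt.mono_left nhdsWithin_le_nhds) hV
    obtain ⟨d, hd, hdV⟩ := (mem_nhdsGT_iff_exists_Ioo_subset' hpq).1 h1
    obtain ⟨e, he1, he2⟩ := exists_between (lt_min hd hc1)
    rw [lt_min_iff] at he2
    have heI : e ∈ Ioo p q := ⟨he1, he2.2.trans hc2⟩
    rw [mem_map]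
    filter_upwards [Iio_mem_atBot (χ e)] with t ht
    obtain ⟨v, hv, hvt⟩ := hb t
    have hvI : v ∈ Ioo p q := ⟨hv.1, hv.2.trans hc2⟩
    obtain ⟨w, hw, rfl⟩ := (isPreconnected_Ioo.intermediate_value hvI heI hc) ⟨hvt.le, ht.le⟩
    have := (hm.lt_iff_lt hw heI).1 ht
    rw [mem_preimage, hχ]
    exact hdV ⟨hw.1, this.trans he2.1⟩

lemma reparam_bounded_right (ha : Continuous a) (hai : Injective a)
    (hχ : ∀ u, g (χ u) = a u) {p q : ℝ} (hpq : p < q) (hc : ContinuousOn χ (Ioo p q))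
    (hb : ¬ Tendsto g atBot (𝓝 (a p))) (ht : ¬ Tendsto g atTop (𝓝 (a p))) :
    ∃ n, ∀ᶠ v in 𝓝[>] p, |χ v| ≤ n := by
  have hχi : Injective χ := fun u v h => hai (by rw [← hχ, ← hχ, h])
  rcases ContinuousOn.strictMonoOn_of_injOn_Ioo hpq hc hχi.injOn with hm | hm
  · exact (reparam_bounded_or_tendsto_of_strictMonoOn ha hχ hpq hc hm).resolve_right hb
  · have h := reparam_bounded_or_tendsto_of_strictMonoOn (a := a) (g := g ∘ Neg.neg)
      (χ := fun u => - χ u) ha (by simpa using hχ) hpq hc.neg hm.neg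
    simp only [abs_neg] at h
    refine h.resolve_right fun h => ht ?_
    have := h.comp tendsto_neg_atTop_atBot
    simpa [comp_def] using this

variable [T2Space M]

lemma reparam_continuousWithinAt (ha : Continuous a) (hg : Continuous g) (hgi : Injective g)
    (hχ : ∀ u, g (χ u) = a u) {s : Set ℝ} {u n : ℝ} (h : ∀ᶠ v in 𝓝[s] u, |χ v| ≤ n) :
    ContinuousWithinAt χ s u := by
  refine (isCompact_Icc (a := -n) (b := n)).tendsto_nhds_of_unique_mapClusterPt
    (h.mono fun v hv => abs_le.1 hv) fun y _ hy => ?_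
  have h1 : MapClusterPt (g y) (𝓝[s] u) (g ∘ χ) := hy.continuousAt_comp hg.continuousAt
  have h2 : g ∘ χ = a := funext hχ
  rw [h2] at h1
  have h3 : Tendsto a (𝓝[s] u) (𝓝 (a u)) := ha.continuousAt.mono_left nhdsWithin_le_nhds
  have h4 : ClusterPt (g y) (𝓝 (a u)) := h1.clusterPt.mono h3
  exact hgi ((eq_of_nhds_neBot h4).trans (hχ u).symm)

/-- Boundedness of the reparametrization to the right of a point `u`, assuming it is bounded on
the set of its unbounded points in an interval `[u, v)`. -/
lemma reparam_bounded_right_of_bounded_on (ha : Continuous a) (hai : Injective a)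
    (hg : Continuous g) (hgi : Injective g) (hχ : ∀ u, g (χ u) = a u) {D : Set ℝ}
    (hD : IsClosed D) (hDc : ∀ u ∉ D, ContinuousAt χ u) {u r n : ℝ} (hur : u < r) (huD : u ∈ D)
    (hDn : ∀ v ∈ D ∩ Ico u r, |χ v| ≤ n)
    (hS : ∀ v ∈ Ico u r, ¬ Tendsto g atBot (𝓝 (a v)) ∧ ¬ Tendsto g atTop (𝓝 (a v))) :
    ∃ n, ∀ᶠ v in 𝓝[>] u, |χ v| ≤ n := by
  have hχi : Injective χ := fun u v h => hai (by rw [← hχ, ← hχ, h])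
  by_cases hex : ∃ q ∈ D, u < q ∧ q < r
  · obtain ⟨q₀, hq₀D, huq₀, hq₀r⟩ := hex
    refine ⟨n, ?_⟩
    filter_upwards [Ioo_mem_nhdsGT huq₀] with v hv
    by_cases hvD : v ∈ D
    · exact hDn v ⟨hvD, hv.1.le, hv.2.trans hq₀r⟩
    obtain ⟨p, ⟨hpD, hup, hpv⟩, hpmax⟩ := ((isCompact_Icc (a := u) (b := v)).inter_left
      hD).exists_isGreatest ⟨u, huD, le_rfl, hv.1.le⟩
    obtain ⟨q, ⟨hqD, hvq, hqq₀⟩, hqmin⟩ := ((isCompact_Icc (a := v) (b := q₀)).inter_left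
      hD).exists_isLeast ⟨q₀, hq₀D, hv.2.le, le_rfl⟩
    have hpv' : p < v := hpv.lt_of_ne fun h => hvD (h ▸ hpD)
    have hvq' : v < q := hvq.lt_of_ne fun h => hvD (h ▸ hqD)
    have hgap : ∀ w ∈ Ioo p q, w ∉ D := by
      intro w hw hwD
      rcases le_total w v with h | h
      · exact absurd (hpmax ⟨hwD, hup.trans hw.1.le, h⟩) (not_le.2 hw.1)
      · exact absurd (hqmin ⟨hwD, h, hw.2.le.trans hqq₀⟩) (not_le.2 hw.2)
    have hpq := hpv'.trans hvq'
    have hcI : ContinuousOn χ (Ioo p q) := fun w hw => (hDc w (hgap w hw)).continuousWithinAt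
    have hpr : p ∈ Ico u r := ⟨hup, hpv.trans_lt (hv.2.trans hq₀r)⟩
    have hqr : q ∈ Ico u r := ⟨hv.1.le.trans hvq, hqq₀.trans_lt hq₀r⟩
    obtain ⟨n1, h1⟩ := reparam_bounded_right ha hai hχ hpq hcI (hS p hpr).1 (hS p hpr).2
    have hp : ContinuousWithinAt χ (Ioi p) p := reparam_continuousWithinAt ha hg hgi hχ h1
    have hq : ContinuousWithinAt χ (Iio q) q := by
      have hχ' : ∀ u, g ((χ ∘ Neg.neg) u) = (a ∘ Neg.neg) u := fun u => hχ _
      have hc' : ContinuousOn (χ ∘ Neg.neg) (Ioo (-q) (-p)) :=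
        hcI.comp continuousOn_neg fun w hw => ⟨by linarith [hw.2], by linarith [hw.1]⟩
      obtain ⟨n2, h2⟩ := reparam_bounded_right (a := a ∘ Neg.neg) (ha.comp continuous_neg)
        (hai.comp neg_injective) hχ' (neg_lt_neg hpq) hc' (by simpa using (hS q hqr).1)
        (by simpa using (hS q hqr).2)
      have h3 : ∀ᶠ v in 𝓝[<] q, |χ v| ≤ n2 := by
        have := (tendsto_neg_nhdsLT (a := q)).eventually h2
        simpa using this
      exact reparam_continuousWithinAt ha hg hgi hχ h3
    have hcc : ContinuousOn χ (Icc p q) := by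
      intro w hw
      rcases hw.1.eq_or_lt with rfl | h1
      · exact (continuousWithinAt_Ioi_iff_Ici.1 hp).mono Icc_subset_Ici_self
      rcases hw.2.eq_or_lt with rfl | h2
      · exact (continuousWithinAt_Iio_iff_Iic.1 hq).mono Icc_subset_Iic_self
      exact (hDc w (hgap w ⟨h1, h2⟩)).continuousWithinAt
    have hvI : v ∈ Icc p q := ⟨hpv, hvq⟩
    have hnp := abs_le.1 (hDn p ⟨hpD, hpr⟩)
    have hnq := abs_le.1 (hDn q ⟨hqD, hqr⟩)
    rw [abs_le]
    rcases hcc.strictMonoOn_of_injOn_Icc' hpq.le hχi.injOn with hm | hm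
    · have h1 := hm.monotoneOn ⟨le_rfl, hpq.le⟩ hvI hpv
      have h2 := hm.monotoneOn hvI ⟨hpq.le, le_rfl⟩ hvq
      constructor <;> linarith
    · have h1 := hm.antitoneOn ⟨le_rfl, hpq.le⟩ hvI hpv
      have h2 := hm.antitoneOn hvI ⟨hpq.le, le_rfl⟩ hvq
      constructor <;> linarith
  · push Not at hex
    refine reparam_bounded_right ha hai hχ hur (fun w hw => ?_) (hS u ⟨le_rfl, hur⟩).1
      (hS u ⟨le_rfl, hur⟩).2
    exact (hDc w fun h => absurd (hex w h hw.1) (not_le.2 hw.2)).continuousWithinAt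

/-- If an immersed line is contained in another one, then near each common point which is not an
end limit of the larger line, the larger line is contained in the smaller one. -/
lemma eventually_mem_range_of_range_subset (ha : Continuous a) (hai : Injective a)
    (hg : Continuous g) (hgi : Injective g) (hsub : range a ⊆ range g) {r₀ t₀ : ℝ}
    (h0 : a r₀ = g t₀) (ht : ¬ Tendsto g atTop (𝓝 (a r₀))) (hb : ¬ Tendsto g atBot (𝓝 (a r₀))) :
    ∀ᶠ t in 𝓝 t₀, g t ∈ range a := by
  choose χ hχ using fun u => hsub ⟨u, rfl⟩
  have hχi : Injective χ := fun u v h => hai (by rw [← hχ, ← hχ, h])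
  set D : Set ℝ := {u | ∃ n, ∀ᶠ v in 𝓝 u, |χ v| ≤ n}ᶜ with hDdef
  have hD : IsClosed D := by
    rw [hDdef, isClosed_compl_iff, isOpen_iff_mem_nhds]
    rintro u ⟨n, hn⟩
    filter_upwards [hn.eventually_nhds] with v hv
    exact ⟨n, hv⟩
  have hDc : ∀ u ∉ D, ContinuousAt χ u := by
    intro u hu
    obtain ⟨n, hn⟩ := not_not.1 hu
    rw [← continuousWithinAt_univ]
    exact reparam_continuousWithinAt ha hg hgi hχ (by rwa [nhdsWithin_univ])
  set Sp : Set ℝ := {u | Tendsto g atBot (𝓝 (a u)) ∨ Tendsto g atTop (𝓝 (a u))} with hSp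
  have hSpc : IsClosed Sp := by
    have h1 : {u | Tendsto g atBot (𝓝 (a u))}.Subsingleton := fun u hu v hv =>
      hai (tendsto_nhds_unique hu hv)
    have h2 : {u | Tendsto g atTop (𝓝 (a u))}.Subsingleton := fun u hu v hv =>
      hai (tendsto_nhds_unique hu hv)
    exact (h1.finite.union h2.finite).isClosed
  have hDS : D \ Sp = ∅ := by
    by_contra hne
    have hne' : Nonempty ↥(D \ Sp) := (nonempty_iff_ne_empty.2 hne).to_subtype
    have hlc : LocallyCompactSpace ↥(D \ Sp) :=
      (hD.isLocallyClosed.inter hSpc.isOpen_compl.isLocallyClosed).locallyCompactSpace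
    have hbase := nonempty_interior_of_iUnion_of_closed (X := ↥(D \ Sp))
      (f := fun n : ℕ => {u | a u ∈ g '' Icc (-(n : ℝ)) n})
      (fun n => (isCompact_Icc.image hg).isClosed.preimage (ha.comp continuous_subtype_val))
      (by
        refine eq_univ_of_forall fun u => mem_iUnion.2 ?_
        obtain ⟨n, hn⟩ := exists_nat_ge |χ u|
        exact ⟨n, χ u, abs_le.1 hn, hχ u⟩)
    obtain ⟨n, ⟨u, huDS⟩, hu⟩ := hbase
    obtain ⟨huD, huS⟩ := huDS
    rw [mem_interior_iff_mem_nhds, mem_nhds_subtype] at hu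
    obtain ⟨V, hV, hVn⟩ := hu
    have hV2 : V ∩ Spᶜ ∈ 𝓝 u := inter_mem hV (hSpc.isOpen_compl.mem_nhds huS)
    obtain ⟨ε, hε, hball⟩ := Metric.mem_nhds_iff.1 hV2
    have hbd : ∀ v ∈ D, |v - u| < ε → |χ v| ≤ n := by
      intro v hv hvu
      have hvV := hball (by simpa [Real.dist_eq] using hvu)
      obtain ⟨t, ht, hgt⟩ := hVn (a := ⟨v, hv, hvV.2⟩) hvV.1
      rw [← hgi (hgt.trans (hχ v).symm)]
      exact abs_le.2 ht
    have hS' : ∀ v, |v - u| < ε → ¬ Tendsto g atBot (𝓝 (a v)) ∧ ¬ Tendsto g atTop (𝓝 (a v)) := by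
      intro v hvu
      exact not_or.1 (hball (by simpa [Real.dist_eq] using hvu)).2
    obtain ⟨n1, h1⟩ := reparam_bounded_right_of_bounded_on ha hai hg hgi hχ hD hDc (u := u)
      (r := u + ε) (n := n) (by linarith) huD
      (fun v hv => hbd v hv.1 (by rw [abs_lt]; constructor <;> linarith [hv.2.1, hv.2.2]))
      (fun v hv => hS' v (by rw [abs_lt]; constructor <;> linarith [hv.1, hv.2]))
    obtain ⟨n2, h2⟩ := reparam_bounded_right_of_bounded_on (a := a ∘ Neg.neg) (χ := χ ∘ Neg.neg)
      (ha.comp continuous_neg) (hai.comp neg_injective) hg hgi (fun u => hχ _)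
      (D := Neg.neg ⁻¹' D) (hD.preimage continuous_neg)
      (fun v hv => (hDc _ hv).comp continuous_neg.continuousAt) (u := -u)
      (r := -u + ε) (n := n) (by linarith) (by simpa using huD)
      (fun v hv => hbd _ hv.1 (by rw [abs_lt]; constructor <;> linarith [hv.2.1, hv.2.2]))
      (fun v hv => hS' _ (by rw [abs_lt]; constructor <;> linarith [hv.1, hv.2]))
    have h3 : ∀ᶠ v in 𝓝[<] u, |χ v| ≤ n2 := by
      have := (tendsto_neg_nhdsLT (a := u)).eventually h2
      simpa using this
    refine huD ⟨max (max n1 n2) |χ u|, ?_⟩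
    rw [← nhdsLT_sup_nhdsGE, ← Ioi_insert, nhdsWithin_insert, eventually_sup, eventually_sup]
    refine ⟨h3.mono fun v hv => ?_, ?_, h1.mono fun v hv => ?_⟩
    · exact hv.trans (by simp)
    · simp
    · exact hv.trans (by simp)
  have hr₀ : r₀ ∉ D := fun h => by
    have : r₀ ∈ D \ Sp := ⟨h, not_or.2 ⟨hb, ht⟩⟩
    simp [hDS] at this
  obtain ⟨ε, hε, hball⟩ := Metric.isOpen_iff.1 hD.isOpen_compl r₀ hr₀
  have hcc : ContinuousOn χ (Icc (r₀ - ε / 2) (r₀ + ε / 2)) := fun v hv =>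
    (hDc v (hball (by
      rw [Metric.mem_ball, Real.dist_eq, abs_lt]; constructor <;> linarith [hv.1, hv.2]))).continuousWithinAt
  have hχ0 : χ r₀ = t₀ := hgi ((hχ r₀).trans h0)
  have hle : r₀ - ε / 2 ≤ r₀ + ε / 2 := by linarith
  rcases hcc.strictMonoOn_of_injOn_Icc' hle hχi.injOn with hm | hm
  · have h1 := hm (a := r₀ - ε / 2) (b := r₀) ⟨by linarith, by linarith⟩ ⟨by linarith, by linarith⟩
      (by linarith)
    have h2 := hm (a := r₀) (b := r₀ + ε / 2) ⟨by linarith, by linarith⟩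
      ⟨by linarith, by linarith⟩ (by linarith)
    rw [hχ0] at h1 h2
    filter_upwards [Ioo_mem_nhds h1 h2] with t ht
    obtain ⟨u, -, rfl⟩ := intermediate_value_Icc hle hcc ⟨ht.1.le, ht.2.le⟩
    exact ⟨u, (hχ u).symm⟩
  · have h1 := hm (a := r₀ - ε / 2) (b := r₀) ⟨by linarith, by linarith⟩ ⟨by linarith, by linarith⟩
      (by linarith)
    have h2 := hm (a := r₀) (b := r₀ + ε / 2) ⟨by linarith, by linarith⟩
      ⟨by linarith, by linarith⟩ (by linarith)
    rw [hχ0] at h1 h2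
    filter_upwards [Ioo_mem_nhds h2 h1] with t ht
    obtain ⟨u, -, rfl⟩ := intermediate_value_Icc' hle hcc ⟨ht.1.le, ht.2.le⟩
    exact ⟨u, (hχ u).symm⟩

end LineComparison

/-- A product-like family of arcs: arcs of `g y`, for `y ∈ Y`, and of `h x`, for `x ∈ X`, such
that each arc of the first family crosses each arc of the second family exactly once, in a
consistent order. -/
structure ArcGrid (M : Type) [TopologicalSpace M] where
  X : Set ℝ
  Y : Set ℝ
  g : ℝ → ℝ → M
  h : ℝ → ℝ → M
  ga : ℝ → ℝ
  gb : ℝ → ℝ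
  ha : ℝ → ℝ
  hb : ℝ → ℝ
  τ : ℝ → ℝ → ℝ
  σ : ℝ → ℝ → ℝ
  g_cont : ∀ y ∈ Y, Continuous (g y)
  h_cont : ∀ x ∈ X, Continuous (h x)
  g_inj : ∀ y ∈ Y, Injective (g y)
  h_inj : ∀ x ∈ X, Injective (h x)
  τ_mem : ∀ y ∈ Y, ∀ x ∈ X, τ y x ∈ Icc (ga y) (gb y)
  σ_mem : ∀ x ∈ X, ∀ y ∈ Y, σ x y ∈ Icc (ha x) (hb x)
  τ_mono : ∀ y ∈ Y, StrictMonoOn (τ y) X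
  σ_mono : ∀ x ∈ X, StrictMonoOn (σ x) Y
  cross : ∀ x ∈ X, ∀ y ∈ Y, g y (τ y x) = h x (σ x y)
  g_disj : ∀ y ∈ Y, ∀ y' ∈ Y, ∀ s ∈ Icc (ga y) (gb y), ∀ s' ∈ Icc (ga y') (gb y'),
    g y s = g y' s' → y = y'
  h_disj : ∀ x ∈ X, ∀ x' ∈ X, ∀ t ∈ Icc (ha x) (hb x), ∀ t' ∈ Icc (ha x') (hb x'),
    h x t = h x' t' → x = x'
  cross_unique : ∀ x ∈ X, ∀ y ∈ Y, ∀ s ∈ Icc (ga y) (gb y), ∀ t ∈ Icc (ha x) (hb x),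
    g y s = h x t → s = τ y x ∧ t = σ x y

namespace ArcGrid
variable {M : Type} [TopologicalSpace M] (G : ArcGrid M)

/-- Exchange the two families of arcs. -/
def swap : ArcGrid M where
  X := G.Y
  Y := G.X
  g := G.h
  h := G.g
  ga := G.ha
  gb := G.hb
  ha := G.ga
  hb := G.gb
  τ := G.σ
  σ := G.τ
  g_cont := G.h_cont
  h_cont := G.g_cont
  g_inj := G.h_inj
  h_inj := G.g_inj
  τ_mem := G.σ_mem
  σ_mem := G.τ_mem
  τ_mono := G.σ_mono
  σ_mono := G.τ_mono
  cross x hx y hy := (G.cross y hy x hx).symm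
  g_disj := G.h_disj
  h_disj := G.g_disj
  cross_unique x hx y hy s hs t ht e := (G.cross_unique y hy x hx t ht s hs e.symm).symm

/-- Reverse the order of the index set `Y`. -/
def reverse : ArcGrid M where
  X := G.X
  Y := Neg.neg ⁻¹' G.Y
  g y := G.g (-y)
  h x t := G.h x (-t)
  ga y := G.ga (-y)
  gb y := G.gb (-y)
  ha x := - G.hb x
  hb x := - G.ha x
  τ y := G.τ (-y)
  σ x y := - G.σ x (-y)
  g_cont y hy := G.g_cont _ hy
  h_cont x hx := (G.h_cont x hx).comp continuous_neg
  g_inj y hy := G.g_inj _ hy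
  h_inj x hx := (G.h_inj x hx).comp neg_injective
  τ_mem y hy := G.τ_mem _ hy
  σ_mem x hx y hy := by
    have := G.σ_mem x hx _ hy
    exact ⟨neg_le_neg this.2, neg_le_neg this.1⟩
  τ_mono y hy := G.τ_mono _ hy
  σ_mono x hx y hy y' hy' hyy := neg_lt_neg (G.σ_mono x hx hy' hy (neg_lt_neg hyy))
  cross x hx y hy := by rw [neg_neg]; exact G.cross x hx _ hy
  g_disj y hy y' hy' s hs s' hs' e := neg_injective (G.g_disj _ hy _ hy' s hs s' hs' e)
  h_disj x hx x' hx' t ht t' ht' e := G.h_disj x hx x' hx' (-t)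
    ⟨by linarith [ht.2], by linarith [ht.1]⟩ (-t') ⟨by linarith [ht'.2], by linarith [ht'.1]⟩ e
  cross_unique x hx y hy s hs t ht e := by
    have := G.cross_unique x hx _ hy s hs (-t) ⟨by linarith [ht.2], by linarith [ht.1]⟩ e
    exact ⟨this.1, by rw [← this.2, neg_neg]⟩

/-- The part of the arc of `g y` between its crossings with the arcs of `h x₁` and `h x₂`. -/
def seg (x₁ x₂ y : ℝ) : Set M := G.g y '' Icc (G.τ y x₁) (G.τ y x₂)

/-- The crossing point of the arcs of indices `x` and `y`. -/
def pt (x y : ℝ) : M := G.g y (G.τ y x)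

variable {G}

lemma τ_Icc_subset {x₁ x₂ y : ℝ} (hx₁ : x₁ ∈ G.X) (hx₂ : x₂ ∈ G.X) (hy : y ∈ G.Y) :
    Icc (G.τ y x₁) (G.τ y x₂) ⊆ Icc (G.ga y) (G.gb y) :=
  Icc_subset_Icc (G.τ_mem y hy x₁ hx₁).1 (G.τ_mem y hy x₂ hx₂).2

lemma σ_Icc_subset {x y₁ y₂ : ℝ} (hx : x ∈ G.X) (hy₁ : y₁ ∈ G.Y) (hy₂ : y₂ ∈ G.Y) :
    Icc (G.σ x y₁) (G.σ x y₂) ⊆ Icc (G.ha x) (G.hb x) :=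
  Icc_subset_Icc (G.σ_mem x hx y₁ hy₁).1 (G.σ_mem x hx y₂ hy₂).2

lemma pt_mem_seg {x₁ x x₂ y : ℝ} (hx₁ : x₁ ∈ G.X) (hx : x ∈ G.X) (hx₂ : x₂ ∈ G.X) (hy : y ∈ G.Y)
    (h₁ : x₁ ≤ x) (h₂ : x ≤ x₂) : G.pt x y ∈ G.seg x₁ x₂ y :=
  ⟨_, ⟨(G.τ_mono y hy).monotoneOn hx₁ hx h₁, (G.τ_mono y hy).monotoneOn hx hx₂ h₂⟩, rfl⟩

lemma isCompact_seg {x₁ x₂ y : ℝ} (hy : y ∈ G.Y) : IsCompact (G.seg x₁ x₂ y) :=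
  isCompact_Icc.image (G.g_cont y hy)

/-- The closed box in the plane around the real segment `[p, q]`. -/
def _root_.planeBox (p q ε : ℝ) : Set ℂ := Icc (p - ε) (q + ε) ×ℂ Icc (-ε) ε

lemma _root_.convex_planeBox (p q ε : ℝ) : Convex ℝ (planeBox p q ε) :=
  ((convex_Icc _ _).linear_preimage Complex.reLm).inter
    ((convex_Icc _ _).linear_preimage Complex.imLm)

lemma _root_.isCompact_planeBox {p q ε : ℝ} : IsCompact (planeBox p q ε) :=
  isCompact_Icc.reProdIm isCompact_Icc

lemma _root_.ball_subset_planeBox {p q ε c : ℝ} (h₁ : p ≤ c) (h₂ : c ≤ q) :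
    Metric.ball (c : ℂ) ε ⊆ planeBox p q ε := by
  intro z hz
  rw [Metric.mem_ball, dist_eq_norm] at hz
  have hre := abs_lt.1 ((Complex.abs_re_le_norm _).trans_lt hz)
  have him := abs_lt.1 ((Complex.abs_im_le_norm _).trans_lt hz)
  simp at hre him
  exact ⟨⟨by linarith, by linarith⟩, ⟨by linarith, by linarith⟩⟩

variable [T2Space M]

/-- An arc of the first family close to the arc of `g y` in a chart traps all arcs in between. -/
lemma seg_subset_of_trap {x₀ x₁ xm x₂ x₃ y c : ℝ} (hx₀ : x₀ ∈ G.X) (hx₁ : x₁ ∈ G.X)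
    (hxm : xm ∈ G.X) (hx₂ : x₂ ∈ G.X) (hx₃ : x₃ ∈ G.X) (hy : y ∈ G.Y) (hc : c ∈ G.Y)
    (h01 : x₀ < x₁) (h1m : x₁ < xm) (hm2 : xm < x₂) (h23 : x₂ < x₃)
    {k : ℂ → M} (hk : IsOpenEmbedding k) {r : ℝ → ℝ}
    (hrk : ∀ t ∈ Icc (G.τ y x₀) (G.τ y x₃), G.g y t = k (r t))
    (hrc : ContinuousOn r (Icc (G.τ y x₀) (G.τ y x₃))) {ε : ℝ}
    (hε0 : r (G.τ y x₀) < r (G.τ y x₁) - ε) (hε1 : r (G.τ y x₁) + ε < r (G.τ y xm))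
    (hε2 : r (G.τ y xm) < r (G.τ y x₂) - ε) (hε3 : r (G.τ y x₂) + ε < r (G.τ y x₃))
    (hS : ∀ z ∈ G.seg x₁ x₂ c, ∃ ζ ∈ planeBox (r (G.τ y x₁)) (r (G.τ y x₂)) ε,
      0 < ζ.im ∧ k ζ = z)
    (hU₁ : ∀ t ∈ Icc (G.σ x₁ y) (G.σ x₁ c), G.h x₁ t ∈ k '' Metric.ball (r (G.τ y x₁)) ε)
    (hUm : ∀ t ∈ Icc (G.σ xm y) (G.σ xm c), G.h xm t ∈ k '' Metric.ball (r (G.τ y xm)) ε)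
    (hU₂ : ∀ t ∈ Icc (G.σ x₂ y) (G.σ x₂ c), G.h x₂ t ∈ k '' Metric.ball (r (G.τ y x₂)) ε)
    {w : ℝ} (hw : w ∈ G.Y) (hyw : y < w) (hwc : w < c) :
    G.seg x₁ x₂ w ⊆ k '' planeBox (r (G.τ y x₁)) (r (G.τ y x₂)) ε := by
  have hyc := hyw.trans hwc
  set p₀ := r (G.τ y x₀)
  set p₁ := r (G.τ y x₁)
  set pm := r (G.τ y xm)
  set p₂ := r (G.τ y x₂)
  set p₃ := r (G.τ y x₃)
  have hmono := (G.τ_mono y hy).monotoneOn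
  have hI : ∀ x ∈ G.X, x₀ ≤ x → x ≤ x₃ → G.τ y x ∈ Icc (G.τ y x₀) (G.τ y x₃) :=
    fun x hx h h' => ⟨hmono hx₀ hx h, hmono hx hx₃ h'⟩
  have h12 := h1m.trans hm2
  have hkp : ∀ x ∈ G.X, x₀ ≤ x → x ≤ x₃ → k (r (G.τ y x)) = G.h x (G.σ x y) :=
    fun x hx h h' => by rw [← hrk _ (hI x hx h h'), G.cross x hx y hy]
  have haxis : ∀ v ∈ Icc p₀ p₃, ∃ s ∈ Icc (G.τ y x₀) (G.τ y x₃), G.g y s = k v := by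
    intro v hv
    obtain ⟨s, hs, rfl⟩ := intermediate_value_Icc (hmono hx₀ hx₃ (by linarith)) hrc hv
    exact ⟨s, hs, hrk s hs⟩
  have hgaxis : ∀ v ∈ Icc p₀ p₃, ∃ s ∈ Icc (G.ga y) (G.gb y), G.g y s = k v := fun v hv =>
    let ⟨s, hs, e⟩ := haxis v hv
    ⟨s, τ_Icc_subset hx₀ hx₃ hy hs, e⟩
  set F : Set M := G.h x₂ '' Icc (G.σ x₂ y) (G.σ x₂ c) ∪ G.seg x₁ x₂ c ∪
    G.h x₁ '' Icc (G.σ x₁ y) (G.σ x₁ c) with hF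
  have hσ₁ := (G.σ_mono x₁ hx₁ hy hc hyc).le
  have hσ₂ := (G.σ_mono x₂ hx₂ hy hc hyc).le
  have hFpc : IsPathConnected F := by
    refine IsPathConnected.union (IsPathConnected.union ?_ ?_ ?_) ?_ ?_
    · exact ((convex_Icc _ _).isPathConnected (nonempty_Icc.2 hσ₂)).image (G.h_cont x₂ hx₂)
    · exact ((convex_Icc _ _).isPathConnected (nonempty_Icc.2
        ((G.τ_mono c hc).monotoneOn hx₁ hx₂ h12.le))).image (G.g_cont c hc)
    · exact ⟨G.pt x₂ c, ⟨_, ⟨hσ₂, le_rfl⟩, (G.cross x₂ hx₂ c hc).symm⟩,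
        pt_mem_seg hx₁ hx₂ hx₂ hc h12.le le_rfl⟩
    · exact ((convex_Icc _ _).isPathConnected (nonempty_Icc.2 hσ₁)).image (G.h_cont x₁ hx₁)
    · exact ⟨G.pt x₁ c, Or.inr (pt_mem_seg hx₁ hx₁ hx₂ hc le_rfl h12.le),
        ⟨_, ⟨hσ₁, le_rfl⟩, (G.cross x₁ hx₁ c hc).symm⟩⟩
  have hm₂F : k p₂ ∈ F := Or.inl (Or.inl ⟨_, ⟨le_rfl, hσ₂⟩, (hkp x₂ hx₂ (by linarith) h23.le).symm⟩)
  have hm₁F : k p₁ ∈ F := Or.inr ⟨_, ⟨le_rfl, hσ₁⟩, (hkp x₁ hx₁ h01.le (by linarith)).symm⟩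
  have hε : 0 < ε := by
    obtain ⟨ζ, hζ, -⟩ := hUm _ ⟨le_rfl, (G.σ_mono xm hxm hy hc hyc).le⟩
    exact dist_nonneg.trans_lt hζ
  have hFk : ∀ z ∈ F, ∃ ζ ∈ planeBox p₁ p₂ ε, k ζ = z ∧ (0 < ζ.im ∨ ζ.re ≠ pm) := by
    rintro z ((⟨t, ht, rfl⟩ | hz) | ⟨t, ht, rfl⟩)
    · obtain ⟨ζ, hζ, e⟩ := hU₂ t ht
      refine ⟨ζ, ball_subset_planeBox (by linarith) le_rfl hζ, e, Or.inr fun hh => ?_⟩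
      rw [Metric.mem_ball, dist_eq_norm] at hζ
      have hre := abs_lt.1 ((Complex.abs_re_le_norm _).trans_lt hζ)
      simp at hre
      linarith
    · obtain ⟨ζ, hζ, h0, e⟩ := hS z hz
      exact ⟨ζ, hζ, e, Or.inl h0⟩
    · obtain ⟨ζ, hζ, e⟩ := hU₁ t ht
      refine ⟨ζ, ball_subset_planeBox le_rfl (by linarith) hζ, e, Or.inr fun hh => ?_⟩
      rw [Metric.mem_ball, dist_eq_norm] at hζ
      have hre := abs_lt.1 ((Complex.abs_re_le_norm _).trans_lt hζ)
      simp at hre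
      linarith
  obtain ⟨γ₀, hγ₀⟩ := hFpc.joinedIn _ hm₂F _ hm₁F
  choose! u huB huk huim using fun s => hFk _ (hγ₀ s)
  have hu : Continuous u := by
    rw [hk.isEmbedding.continuous_iff]
    exact γ₀.continuous.congr fun s => (huk s).symm
  obtain ⟨Ω, hΩo, hΩP, hΩcl, hΩm⟩ := exists_enclosed_region (p := p₁) (m := pm) (q := p₂)
    (by linarith) (by linarith) ⟨u, hu⟩
    (hk.injective (by simpa using huk 0)) (hk.injective (by simpa using huk 1))
    (P := planeBox p₁ p₂ ε) (convex_planeBox _ _ _)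
    isCompact_planeBox huB (by
      intro s t ht e
      simp only [ContinuousMap.coe_mk] at e
      have := huim s
      rw [e] at this
      simp at this
      linarith)
  have hcl : closure (k '' Ω) ⊆ k '' Ω ∪ F ∪ G.g y '' Icc (G.ga y) (G.gb y) := by
    have hcpt : IsCompact (closure Ω) :=
      isCompact_planeBox.closure_of_subset hΩP
    refine (closure_minimal (image_mono subset_closure)
      (hcpt.image hk.continuous).isClosed).trans ?_
    rintro _ ⟨ζ, hζ, rfl⟩
    rcases hΩcl hζ with (h | ⟨s, rfl⟩) | ⟨v, hv, rfl⟩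
    · exact Or.inl (Or.inl ⟨ζ, h, rfl⟩)
    · exact Or.inl (Or.inr (by simpa [huk s] using hγ₀ s))
    · exact Or.inr (hgaxis v ⟨by linarith [hv.1], by linarith [hv.2]⟩)
  have hopen : IsOpen (k '' Ω) := hk.isOpenMap _ hΩo
  have hptw : G.pt xm w ∈ k '' Ω := by
    have hlt := G.σ_mono xm hxm hy hc hyc
    have him : ∀ t ∈ Ioc (G.σ xm y) (G.σ xm c), ∃ ζ, 0 < ζ.im ∧ k ζ = G.h xm t := by
      choose! v hvb hvk using fun t ht => hUm t ht
      have hvc : ContinuousOn v (Icc (G.σ xm y) (G.σ xm c)) := by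
        rw [hk.isEmbedding.isInducing.continuousOn_iff]
        exact (G.h_cont xm hxm).continuousOn.congr fun t ht => hvk t ht
      have hne : ∀ t ∈ Ioc (G.σ xm y) (G.σ xm c), (v t).im ≠ 0 := by
        intro t ht h0
        have htI := Ioc_subset_Icc_self ht
        have hb := hvb t htI
        rw [Metric.mem_ball, dist_eq_norm] at hb
        have hre := abs_lt.1 ((Complex.abs_re_le_norm _).trans_lt hb)
        simp at hre
        obtain ⟨s, hs, e⟩ := hgaxis (v t).re ⟨by linarith, by linarith⟩
        have hvt : ((v t).re : ℂ) = v t := Complex.ext (by simp) (by simp [h0])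
        rw [hvt, hvk t htI] at e
        have := (G.cross_unique xm hxm y hy s hs t (σ_Icc_subset hxm hy hc htI) e).2
        exact ht.1.ne' this
      obtain ⟨ζ, -, h0, e⟩ := hS _ (pt_mem_seg hx₁ hxm hx₂ hc h1m.le hm2.le)
      have hcI : G.σ xm c ∈ Icc (G.σ xm y) (G.σ xm c) := ⟨hlt.le, le_rfl⟩
      have hvc0 : 0 < (v (G.σ xm c)).im := by
        have : v (G.σ xm c) = ζ := hk.injective (by
          rw [hvk _ hcI, e, pt, G.cross xm hxm c hc])
        rwa [this]
      intro t ht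
      refine ⟨v t, ?_, hvk t (Ioc_subset_Icc_self ht)⟩
      by_contra hneg
      have hcont : ContinuousOn (fun t => (v t).im) (Icc t (G.σ xm c)) :=
        Complex.continuous_im.comp_continuousOn (hvc.mono (Icc_subset_Icc_left ht.1.le))
      obtain ⟨t', ht', e⟩ := intermediate_value_Icc ht.2 hcont ⟨not_lt.1 hneg, hvc0.le⟩
      exact hne t' ⟨ht.1.trans_le ht'.1, ht'.2⟩ e
    have hsub : G.h xm '' Ioo (G.σ xm y) (G.σ xm c) ⊆ k '' Ω := by
      refine IsPreconnected.subset_of_closure_inter_subset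
        (isPreconnected_Ioo.image _ (G.h_cont xm hxm).continuousOn) hopen ?_ ?_
      · have h1 : ∀ᶠ t in 𝓝[>] (G.σ xm y), G.h xm t ∈ k '' {ζ | 0 < ζ.im → ζ ∈ Ω} := by
          have h2 : k '' {ζ | 0 < ζ.im → ζ ∈ Ω} ∈ 𝓝 (G.h xm (G.σ xm y)) := by
            rw [← hkp xm hxm (by linarith) (by linarith)]
            exact hk.isOpenMap.image_mem_nhds hΩm
          exact ((G.h_cont xm hxm).continuousAt.mono_left nhdsWithin_le_nhds) h2
        obtain ⟨t, ⟨ζ, hζ, e⟩, ht⟩ := (h1.and (Ioo_mem_nhdsGT hlt)).exists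
        obtain ⟨ζ', h0, e'⟩ := him t (Ioo_subset_Ioc_self ht)
        obtain rfl : ζ = ζ' := hk.injective (e.trans e'.symm)
        exact ⟨_, ⟨t, ht, rfl⟩, ζ, hζ h0, e⟩
      · rintro _ ⟨hz, t, ht, rfl⟩
        have htI := σ_Icc_subset hxm hy hc (Ioo_subset_Icc_self ht)
        rcases hcl hz with (h | ((⟨t', ht', e⟩ | ⟨s, hs, e⟩) | ⟨t', ht', e⟩)) | ⟨s, hs, e⟩
        · exact h
        · exact absurd (G.h_disj x₂ hx₂ xm hxm t' (σ_Icc_subset hx₂ hy hc ht') t htI e) hm2.ne'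
        · exact absurd (G.cross_unique xm hxm c hc s (τ_Icc_subset hx₁ hx₂ hc hs) t htI e).2 ht.2.ne
        · exact absurd (G.h_disj x₁ hx₁ xm hxm t' (σ_Icc_subset hx₁ hy hc ht') t htI e) h1m.ne
        · exact absurd (G.cross_unique xm hxm y hy s hs t htI e).2 ht.1.ne'
    rw [pt, G.cross xm hxm w hw]
    exact hsub ⟨_, ⟨G.σ_mono xm hxm hy hw hyw, G.σ_mono xm hxm hw hc hwc⟩, rfl⟩
  have hQ : G.g w '' Ioo (G.τ w x₁) (G.τ w x₂) ⊆ k '' Ω := by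
    refine IsPreconnected.subset_of_closure_inter_subset
      (isPreconnected_Ioo.image _ (G.g_cont w hw).continuousOn) hopen
      ⟨_, ⟨_, ⟨G.τ_mono w hw hx₁ hxm h1m, G.τ_mono w hw hxm hx₂ hm2⟩, rfl⟩, hptw⟩ ?_
    rintro _ ⟨hz, s, hs, rfl⟩
    have hsI := τ_Icc_subset hx₁ hx₂ hw (Ioo_subset_Icc_self hs)
    rcases hcl hz with (h | ((⟨t, ht, e⟩ | ⟨s', hs', e⟩) | ⟨t, ht, e⟩)) | ⟨s', hs', e⟩
    · exact h
    · exact absurd (G.cross_unique x₂ hx₂ w hw s hsI t (σ_Icc_subset hx₂ hy hc ht) e.symm).1 hs.2.ne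
    · exact absurd (G.g_disj c hc w hw s' (τ_Icc_subset hx₁ hx₂ hc hs') s hsI e) hwc.ne'
    · exact absurd (G.cross_unique x₁ hx₁ w hw s hsI t (σ_Icc_subset hx₁ hy hc ht) e.symm).1
        hs.1.ne'
    · exact absurd (G.g_disj y hy w hw s' hs' s hsI e) hyw.ne
  rintro _ ⟨s, hs, rfl⟩
  rcases hs.1.eq_or_lt with rfl | h1
  · obtain ⟨ζ, hζ, e⟩ := hU₁ (G.σ x₁ w) ⟨(G.σ_mono x₁ hx₁ hy hw hyw).le,
      (G.σ_mono x₁ hx₁ hw hc hwc).le⟩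
    exact ⟨ζ, ball_subset_planeBox le_rfl (by linarith) hζ, by rw [e, G.cross x₁ hx₁ w hw]⟩
  rcases hs.2.eq_or_lt with rfl | h2
  · obtain ⟨ζ, hζ, e⟩ := hU₂ (G.σ x₂ w) ⟨(G.σ_mono x₂ hx₂ hy hw hyw).le,
      (G.σ_mono x₂ hx₂ hw hc hwc).le⟩
    exact ⟨ζ, ball_subset_planeBox (by linarith) le_rfl hζ, by rw [e, G.cross x₂ hx₂ w hw]⟩
  exact image_mono hΩP (hQ ⟨s, ⟨h1, h2⟩, rfl⟩)

end ArcGrid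

lemma pos_or_neg_of_ne_zero {f : ℝ → ℝ} {a b : ℝ} (hf : ContinuousOn f (Icc a b))
    (h0 : ∀ t ∈ Icc a b, f t ≠ 0) :
    (∀ t ∈ Icc a b, 0 < f t) ∨ ∀ t ∈ Icc a b, f t < 0 := by
  by_contra! h
  obtain ⟨⟨t, ht, h1⟩, s, hs, h2⟩ := h
  obtain ⟨u, hu, e⟩ := isPreconnected_Icc.intermediate_value ht hs hf ⟨h1, h2⟩
  exact h0 u hu e

namespace ArcGrid
variable {M : Type} [TopologicalSpace M] {G : ArcGrid M} [T2Space M]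

lemma exists_closed_avoiding {x y : ℝ} (hx : x ∈ G.X) (hy : y ∈ G.Y) {N : Set M}
    (hN : N ∈ 𝓝 (G.pt x y)) :
    ∃ Z : Set M, IsClosed Z ∧ (∀ s ∈ Icc (G.ga y) (G.gb y), G.g y s ∉ Z) ∧
      ∀ c ∈ G.Y, y < c → G.pt x c ∉ Z → ∀ t ∈ Icc (G.σ x y) (G.σ x c), G.h x t ∈ N := by
  rw [pt, G.cross x hx y hy] at hN
  obtain ⟨δ, hδ, hball⟩ := Metric.mem_nhds_iff.1 ((G.h_cont x hx).continuousAt hN)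
  refine ⟨G.h x '' (Icc (G.ha x) (G.hb x) \ Metric.ball (G.σ x y) δ), ?_, ?_, ?_⟩
  · exact ((isCompact_Icc.diff Metric.isOpen_ball).image (G.h_cont x hx)).isClosed
  · rintro s hs ⟨t, ⟨ht, htb⟩, e⟩
    rw [(G.cross_unique x hx y hy s hs t ht e.symm).2] at htb
    exact htb (Metric.mem_ball_self hδ)
  · intro c hc hyc hZ t ht
    have hcb : G.σ x c ∈ Metric.ball (G.σ x y) δ := by
      by_contra hcb
      exact hZ ⟨G.σ x c, ⟨G.σ_mem x hx c hc, hcb⟩, (G.cross x hx c hc).symm⟩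
    apply hball
    rw [Metric.mem_ball, Real.dist_eq, abs_lt] at hcb ⊢
    constructor <;> linarith [ht.1, ht.2]

/-- If arcs of the first family accumulate on the arc of `g y` from the right, then nearby arcs on
the right stay in a small box of a chart straightening `g y`. -/
lemma exists_trap_right {x₀ x₁ xm x₂ x₃ y : ℝ} (hx₀ : x₀ ∈ G.X) (hx₁ : x₁ ∈ G.X)
    (hxm : xm ∈ G.X) (hx₂ : x₂ ∈ G.X) (hx₃ : x₃ ∈ G.X) (hy : y ∈ G.Y)
    (h01 : x₀ < x₁) (h1m : x₁ < xm) (hm2 : xm < x₂) (h23 : x₂ < x₃)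
    {k : ℂ → M} (hk : IsOpenEmbedding k) {r : ℝ → ℝ}
    (hrk : ∀ t ∈ Icc (G.τ y x₀) (G.τ y x₃), G.g y t = k (r t))
    (hr : StrictMonoOn r (Icc (G.τ y x₀) (G.τ y x₃)))
    (hlim : ∀ V : Set M, IsOpen V → G.seg x₁ x₂ y ⊆ V → ∃ c ∈ G.Y, y < c ∧ G.seg x₁ x₂ c ⊆ V)
    {ε : ℝ} (hε : 0 < ε)
    (hε0 : r (G.τ y x₀) < r (G.τ y x₁) - ε) (hε1 : r (G.τ y x₁) + ε < r (G.τ y xm))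
    (hε2 : r (G.τ y xm) < r (G.τ y x₂) - ε) (hε3 : r (G.τ y x₂) + ε < r (G.τ y x₃)) :
    ∃ c ∈ G.Y, y < c ∧ ∀ w ∈ G.Y, y < w → w < c →
      G.seg x₁ x₂ w ⊆ k '' planeBox (r (G.τ y x₁)) (r (G.τ y x₂)) ε ∧
      G.pt x₁ w ∈ k '' Metric.ball (r (G.τ y x₁)) ε ∧
      G.pt x₂ w ∈ k '' Metric.ball (r (G.τ y x₂)) ε := by
  have hmono := (G.τ_mono y hy).monotoneOn
  have hI : ∀ x ∈ G.X, x₀ ≤ x → x ≤ x₃ → G.τ y x ∈ Icc (G.τ y x₀) (G.τ y x₃) :=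
    fun x hx h h' => ⟨hmono hx₀ hx h, hmono hx hx₃ h'⟩
  have hrc : ContinuousOn r (Icc (G.τ y x₀) (G.τ y x₃)) := by
    have : ContinuousOn (fun t => (r t : ℂ)) (Icc (G.τ y x₀) (G.τ y x₃)) := by
      rw [hk.isEmbedding.isInducing.continuousOn_iff]
      exact (G.g_cont y hy).continuousOn.congr fun t ht => (hrk t ht).symm
    exact Complex.continuous_re.comp_continuousOn this
  have hball : ∀ x ∈ G.X, x₀ ≤ x → x ≤ x₃ →
      k '' Metric.ball (r (G.τ y x)) ε ∈ 𝓝 (G.pt x y) := fun x hx h h' => by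
    rw [pt, hrk _ (hI x hx h h')]
    exact hk.isOpenMap.image_mem_nhds (Metric.ball_mem_nhds _ hε)
  obtain ⟨Z₁, hZ₁c, hZ₁, hZ₁'⟩ := exists_closed_avoiding hx₁ hy (hball x₁ hx₁ h01.le (by linarith))
  obtain ⟨Zm, hZmc, hZm, hZm'⟩ := exists_closed_avoiding hxm hy
    (hball xm hxm (by linarith) (by linarith))
  obtain ⟨Z₂, hZ₂c, hZ₂, hZ₂'⟩ := exists_closed_avoiding hx₂ hy (hball x₂ hx₂ (by linarith) h23.le)
  set p₁ := r (G.τ y x₁)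
  set p₂ := r (G.τ y x₂)
  set B : Set ℂ := Ioo (p₁ - ε) (p₂ + ε) ×ℂ Ioo (-ε) ε with hB
  have hBbox : B ⊆ planeBox p₁ p₂ ε := fun z hz =>
    ⟨Ioo_subset_Icc_self hz.1, Ioo_subset_Icc_self hz.2⟩
  have hBo : IsOpen (k '' B) := hk.isOpenMap _ (isOpen_Ioo.reProdIm isOpen_Ioo)
  obtain ⟨c, hc, hyc, hcV⟩ := hlim (((k '' B \ Z₁) \ Zm) \ Z₂)
    (((hBo.sdiff hZ₁c).sdiff hZmc).sdiff hZ₂c) (by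
      rintro _ ⟨s, hs, rfl⟩
      have hs' := τ_Icc_subset hx₁ hx₂ hy hs
      refine ⟨⟨⟨⟨r s, ?_, ?_⟩, hZ₁ s hs'⟩, hZm s hs'⟩, hZ₂ s hs'⟩
      · have hsI : s ∈ Icc (G.τ y x₀) (G.τ y x₃) :=
          ⟨(hmono hx₀ hx₁ h01.le).trans hs.1, hs.2.trans (hmono hx₂ hx₃ h23.le)⟩
        have h1 := hr.monotoneOn (hI x₁ hx₁ h01.le (by linarith)) hsI hs.1
        have h2 := hr.monotoneOn hsI (hI x₂ hx₂ (by linarith) h23.le) hs.2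
        refine ⟨⟨?_, ?_⟩, ?_, ?_⟩ <;> simp <;> linarith
      · exact (hrk s ⟨(hmono hx₀ hx₁ h01.le).trans hs.1, hs.2.trans (hmono hx₂ hx₃ h23.le)⟩).symm)
  have hU₁ := hZ₁' c hc hyc (hcV (pt_mem_seg hx₁ hx₁ hx₂ hc le_rfl (by linarith))).1.1.2
  have hUm := hZm' c hc hyc (hcV (pt_mem_seg hx₁ hxm hx₂ hc h1m.le hm2.le)).1.2
  have hU₂ := hZ₂' c hc hyc (hcV (pt_mem_seg hx₁ hx₂ hx₂ hc (by linarith) le_rfl)).2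
  refine ⟨c, hc, hyc, fun w hw hyw hwc => ⟨?_, ?_, ?_⟩⟩
  · choose! v hvB hvk using fun t (ht : t ∈ Icc (G.τ c x₁) (G.τ c x₂)) =>
      (hcV ⟨t, ht, rfl⟩ : G.g c t ∈ ((k '' B \ Z₁) \ Zm) \ Z₂).1.1.1
    have hvc : ContinuousOn v (Icc (G.τ c x₁) (G.τ c x₂)) := by
      rw [hk.isEmbedding.isInducing.continuousOn_iff]
      exact (G.g_cont c hc).continuousOn.congr fun t ht => hvk t ht
    have hne : ∀ t ∈ Icc (G.τ c x₁) (G.τ c x₂), (v t).im ≠ 0 := by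
      intro t ht h0
      have hre := (hvB t ht).1
      obtain ⟨s, hs, e⟩ := intermediate_value_Icc (hmono hx₀ hx₃ (by linarith)) hrc
        (show (v t).re ∈ _ from ⟨by linarith [hre.1], by linarith [hre.2]⟩)
      have hvt : ((v t).re : ℂ) = v t := Complex.ext (by simp) (by simp [h0])
      have e2 : G.g y s = G.g c t := by rw [hrk s hs, e, hvt, hvk t ht]
      exact hyc.ne (G.g_disj y hy c hc s (τ_Icc_subset hx₀ hx₃ hy hs) t
        (τ_Icc_subset hx₁ hx₂ hc ht) e2)
    rcases pos_or_neg_of_ne_zero (Complex.continuous_im.comp_continuousOn hvc) hne with hs | hs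
    · refine seg_subset_of_trap hx₀ hx₁ hxm hx₂ hx₃ hy hc h01 h1m hm2 h23 hk hrk hrc hε0 hε1 hε2 hε3
        ?_ hU₁ hUm hU₂ hw hyw hwc
      rintro _ ⟨t, ht, rfl⟩
      exact ⟨v t, hBbox (hvB t ht), hs t ht, hvk t ht⟩
    · have hconj : ∀ x : ℝ, Metric.ball (x : ℂ) ε = starRingEnd ℂ '' Metric.ball (x : ℂ) ε := by
        intro x
        have := Complex.conjLIE.image_ball (x : ℂ) ε
        rw [Complex.conjLIE_apply, Complex.conj_ofReal] at this
        exact this.symm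
      have hboxconj : planeBox p₁ p₂ ε = starRingEnd ℂ '' planeBox p₁ p₂ ε := by
        have : ∀ z ∈ planeBox p₁ p₂ ε, starRingEnd ℂ z ∈ planeBox p₁ p₂ ε := by
          intro z hz
          refine ⟨by simpa using hz.1, ?_⟩
          have := hz.2
          simp only [mem_preimage, mem_Icc, Complex.conj_im] at this ⊢
          constructor <;> linarith
        ext z
        refine ⟨fun hz => ⟨_, this z hz, by simp⟩, ?_⟩
        rintro ⟨z, hz, rfl⟩
        exact this z hz
      rw [hconj, image_image] at hU₁ hU₂ hUm
      rw [hboxconj, image_image]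
      refine seg_subset_of_trap (k := fun z => k (starRingEnd ℂ z)) hx₀ hx₁ hxm hx₂ hx₃ hy hc h01 h1m
        hm2 h23 (hk.comp Complex.conjCLE.toHomeomorph.isOpenEmbedding)
        (by simpa using hrk) hrc hε0 hε1 hε2 hε3 ?_ hU₁ hUm hU₂ hw hyw hwc
      rintro _ ⟨t, ht, rfl⟩
      refine ⟨starRingEnd ℂ (v t), ?_, by simpa using hs t ht, by simpa using hvk t ht⟩
      change _ ∈ planeBox p₁ p₂ ε
      rw [hboxconj]
      exact ⟨_, hBbox (hvB t ht), rfl⟩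
  · rw [pt, G.cross x₁ hx₁ w hw]
    exact hU₁ _ ⟨(G.σ_mono x₁ hx₁ hy hw hyw).le, (G.σ_mono x₁ hx₁ hw hc hwc).le⟩
  · rw [pt, G.cross x₂ hx₂ w hw]
    exact hU₂ _ ⟨(G.σ_mono x₂ hx₂ hy hw hyw).le, (G.σ_mono x₂ hx₂ hw hc hwc).le⟩

/-- Two-sided version of `exists_trap_right`. -/
lemma eventually_trap {x₀ x₁ xm x₂ x₃ y : ℝ} (hx₀ : x₀ ∈ G.X) (hx₁ : x₁ ∈ G.X)
    (hxm : xm ∈ G.X) (hx₂ : x₂ ∈ G.X) (hx₃ : x₃ ∈ G.X) (hy : y ∈ G.Y)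
    (h01 : x₀ < x₁) (h1m : x₁ < xm) (hm2 : xm < x₂) (h23 : x₂ < x₃)
    {k : ℂ → M} (hk : IsOpenEmbedding k) {r : ℝ → ℝ}
    (hrk : ∀ t ∈ Icc (G.τ y x₀) (G.τ y x₃), G.g y t = k (r t))
    (hr : StrictMonoOn r (Icc (G.τ y x₀) (G.τ y x₃)))
    (hright : ∀ V : Set M, IsOpen V → G.seg x₁ x₂ y ⊆ V → ∃ c ∈ G.Y, y < c ∧ G.seg x₁ x₂ c ⊆ V)
    (hleft : ∀ V : Set M, IsOpen V → G.seg x₁ x₂ y ⊆ V → ∃ c ∈ G.Y, c < y ∧ G.seg x₁ x₂ c ⊆ V)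
    {ε : ℝ} (hε : 0 < ε)
    (hε0 : r (G.τ y x₀) < r (G.τ y x₁) - ε) (hε1 : r (G.τ y x₁) + ε < r (G.τ y xm))
    (hε2 : r (G.τ y xm) < r (G.τ y x₂) - ε) (hε3 : r (G.τ y x₂) + ε < r (G.τ y x₃)) :
    ∃ O ∈ 𝓝 y, ∀ w ∈ O ∩ G.Y,
      G.seg x₁ x₂ w ⊆ k '' planeBox (r (G.τ y x₁)) (r (G.τ y x₂)) ε ∧
      G.pt x₁ w ∈ k '' Metric.ball (r (G.τ y x₁)) ε ∧
      G.pt x₂ w ∈ k '' Metric.ball (r (G.τ y x₂)) ε := by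
  obtain ⟨c, hc, hyc, hcw⟩ := exists_trap_right hx₀ hx₁ hxm hx₂ hx₃ hy h01 h1m hm2 h23 hk hrk hr
    hright hε hε0 hε1 hε2 hε3
  have hnn : - -y = y := neg_neg y
  have hτ : G.reverse.τ (-y) = G.τ y := congrArg G.τ hnn
  have hg : G.reverse.g (-y) = G.g y := congrArg G.g hnn
  obtain ⟨d, hd, hyd, hdw⟩ := exists_trap_right (G := G.reverse) (y := -y) (r := r) hx₀ hx₁ hxm hx₂
    hx₃ (by change - -y ∈ G.Y; rwa [hnn]) h01 h1m hm2 h23 hk (by rw [hτ, hg]; exact hrk)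
    (by rw [hτ]; exact hr)
    (by
      intro V hV hsV
      have hsV' : G.seg x₁ x₂ y ⊆ V := by
        have : G.reverse.seg x₁ x₂ (-y) = G.seg x₁ x₂ y := by rw [seg, seg, hτ, hg]
        rwa [← this]
      obtain ⟨c, hc, hcy, hcV⟩ := hleft V hV hsV'
      refine ⟨-c, by change - -c ∈ G.Y; rwa [neg_neg], neg_lt_neg hcy, ?_⟩
      change G.g (- -c) '' Icc (G.τ (- -c) x₁) (G.τ (- -c) x₂) ⊆ V
      rwa [neg_neg])
    hε (by rwa [hτ]) (by rwa [hτ]) (by rwa [hτ]) (by rwa [hτ])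
  rw [hτ] at hdw
  have hmono := (G.τ_mono y hy).monotoneOn
  have hI : ∀ x ∈ G.X, x₀ ≤ x → x ≤ x₃ → G.τ y x ∈ Icc (G.τ y x₀) (G.τ y x₃) :=
    fun x hx h h' => ⟨hmono hx₀ hx h, hmono hx hx₃ h'⟩
  refine ⟨Ioo (-d) c, Ioo_mem_nhds (by linarith) hyc, fun w ⟨hw, hwY⟩ => ?_⟩
  rcases lt_trichotomy w y with h | rfl | h
  · have := hdw (-w) (by change - -w ∈ G.Y; rwa [neg_neg]) (neg_lt_neg h) (by linarith [hw.1])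
    change G.g (- -w) '' Icc (G.τ (- -w) x₁) (G.τ (- -w) x₂) ⊆ _ ∧ G.g (- -w) (G.τ (- -w) x₁) ∈ _ ∧
      G.g (- -w) (G.τ (- -w) x₂) ∈ _ at this
    rwa [neg_neg] at this
  · have h1 := hI x₁ hx₁ h01.le (by linarith)
    have h2 := hI x₂ hx₂ (by linarith) h23.le
    refine ⟨?_, ⟨_, Metric.mem_ball_self hε, (hrk _ h1).symm⟩,
      ⟨_, Metric.mem_ball_self hε, (hrk _ h2).symm⟩⟩
    rintro _ ⟨s, hs, rfl⟩
    have hsI : s ∈ Icc (G.τ w x₀) (G.τ w x₃) := ⟨h1.1.trans hs.1, hs.2.trans h2.2⟩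
    refine ⟨r s, ?_, (hrk s hsI).symm⟩
    have h3 := hr.monotoneOn h1 hsI hs.1
    have h4 := hr.monotoneOn hsI h2 hs.2
    refine ⟨⟨?_, ?_⟩, ?_, ?_⟩ <;> simp <;> linarith
  · exact hcw w hwY h hw.2

end ArcGrid

lemma countable_setOf_last {ι : Type*} {I : Set ι} (hI : I.Countable) (Y : Set ℝ)
    (F : ℝ → ι → Prop) :
    {y ∈ Y | ∃ i ∈ I, F y i ∧ ∀ c ∈ Y, y < c → ¬ F c i}.Countable := by
  have : {y ∈ Y | ∃ i ∈ I, F y i ∧ ∀ c ∈ Y, y < c → ¬ F c i} ⊆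
      ⋃ i ∈ I, {y ∈ Y | F y i ∧ ∀ c ∈ Y, y < c → ¬ F c i} := by
    rintro y ⟨hy, i, hi, h⟩
    exact mem_biUnion hi ⟨hy, h⟩
  refine (hI.biUnion fun i _ => Set.Subsingleton.countable ?_).mono this
  rintro y ⟨hy, h1, h2⟩ y' ⟨hy', h1', h2'⟩
  rcases lt_trichotomy y y' with h | h | h
  · exact (h2 y' hy' h h1').elim
  · exact h
  · exact (h2' y hy h h1).elim

lemma countable_setOf_first {ι : Type*} {I : Set ι} (hI : I.Countable) (Y : Set ℝ)
    (F : ℝ → ι → Prop) :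
    {y ∈ Y | ∃ i ∈ I, F y i ∧ ∀ c ∈ Y, c < y → ¬ F c i}.Countable := by
  have := (countable_setOf_last hI (Neg.neg ⁻¹' Y) fun y i => F (-y) i).preimage
    (neg_injective (G := ℝ))
  refine this.mono ?_
  rintro y ⟨hy, i, hi, h1, h2⟩
  refine ⟨by simpa using hy, i, hi, by simpa using h1, fun c hc hyc => h2 (-c) hc (by linarith)⟩

/-- The finite unions of members of a countable basis. -/
lemma exists_finite_basis_between {M : Type*} [TopologicalSpace M] [SecondCountableTopology M]
    {K V : Set M} (hK : IsCompact K) (hV : IsOpen V) (hKV : K ⊆ V) :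
    ∃ T ∈ {T : Set (Set M) | T.Finite ∧ T ⊆ TopologicalSpace.countableBasis M},
      K ⊆ ⋃₀ T ∧ ⋃₀ T ⊆ V := by
  have hB := TopologicalSpace.isBasis_countableBasis M
  choose! b hb hxb hbV using fun x (hx : x ∈ K) => hB.exists_subset_of_mem_open (hKV hx) hV
  obtain ⟨t, htK, ht⟩ := hK.elim_nhds_subcover b fun x hx => (hB.isOpen (hb x hx)).mem_nhds (hxb x hx)
  refine ⟨b '' t, ⟨t.finite_toSet.image b, ?_⟩, ?_, ?_⟩
  · rintro _ ⟨x, hx, rfl⟩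
    exact hb x (htK x hx)
  · rwa [sUnion_image]
  · rw [sUnion_image]
    exact iUnion₂_subset fun x hx => hbV x (htK x hx)

lemma exists_countable_between (X : Set ℝ) :
    ∃ D ⊆ X, D.Countable ∧ ∀ a b, ∀ x ∈ X, a < x → x < b → ∃ d ∈ D, a < d ∧ d < b := by
  classical
  choose! f hf using fun (q : ℚ × ℚ) (h : (X ∩ Ioo (q.1 : ℝ) q.2).Nonempty) => h
  refine ⟨f '' {q | (X ∩ Ioo (q.1 : ℝ) q.2).Nonempty}, ?_, (to_countable _).image f, ?_⟩
  · rintro _ ⟨q, hq, rfl⟩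
    exact (hf q hq).1
  · intro a b x hx hax hxb
    obtain ⟨p, hp, hp'⟩ := exists_rat_btwn hax
    obtain ⟨q, hq, hq'⟩ := exists_rat_btwn hxb
    have h : (X ∩ Ioo (((p, q) : ℚ × ℚ).1 : ℝ) ((p, q) : ℚ × ℚ).2).Nonempty := ⟨x, hx, hp', hq⟩
    have h2 := (hf (p, q) h).2
    exact ⟨f (p, q), ⟨_, h, rfl⟩, hp.trans h2.1, h2.2.trans hq'⟩

lemma exists_planeBox_subset {p q : ℝ} (hpq : p ≤ q) {V : Set ℂ} (hV : IsOpen V)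
    (h : ∀ r ∈ Icc p q, (r : ℂ) ∈ V) : ∃ ε > 0, planeBox p q ε ⊆ V := by
  obtain ⟨δ, hδ, hsub⟩ := (isCompact_Icc.image Complex.continuous_ofReal :
    IsCompact ((↑) '' Icc p q : Set ℂ)).exists_thickening_subset_open hV (by
      rintro _ ⟨r, hr, rfl⟩; exact h r hr)
  refine ⟨δ / 4, by linarith, fun z hz => hsub ?_⟩
  rw [Metric.mem_thickening_iff]
  obtain ⟨⟨h1, h2⟩, h3, h4⟩ := hz
  obtain ⟨c, hc, hc1, hc2⟩ : ∃ c ∈ Icc p q, z.re - c ≤ δ / 4 ∧ -(δ / 4) ≤ z.re - c := by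
    rcases le_total z.re p with h | h
    · exact ⟨p, ⟨le_rfl, hpq⟩, by linarith, by linarith⟩
    rcases le_total z.re q with h' | h'
    · exact ⟨z.re, ⟨h, h'⟩, by linarith, by linarith⟩
    · exact ⟨q, ⟨hpq, le_rfl⟩, by linarith, by linarith⟩
  refine ⟨_, mem_image_of_mem _ hc, ?_⟩
  rw [dist_eq_norm]
  refine (Complex.norm_le_abs_re_add_abs_im _).trans_lt ?_
  have a1 : |(z - (c : ℂ)).re| ≤ δ / 4 := by
    rw [Complex.sub_re, Complex.ofReal_re]
    exact abs_le.2 ⟨hc2, hc1⟩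
  have a2 : |(z - (c : ℂ)).im| ≤ δ / 4 := by
    rw [Complex.sub_im, Complex.ofReal_im, sub_zero]
    exact abs_le.2 ⟨h3, h4⟩
  linarith

lemma planeBox_mono {p q ε ε' : ℝ} (h : ε ≤ ε') : planeBox p q ε ⊆ planeBox p q ε' :=
  Complex.reProdIm_subset_iff.2 (prod_mono (Icc_subset_Icc (by linarith) (by linarith))
    (Icc_subset_Icc (by linarith) h))

namespace ArcGrid
variable {M : Type} [MetricSpace M] {G : ArcGrid M}

variable (G) in
/-- The indices at which `seg x₁ x₂` is locally contained in `U` and varies continuously. -/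
def contSet (x₁ x₂ : ℝ) (U : Set M) : Set ℝ :=
  {y ∈ G.Y | (∃ O, (IsOpen O ∧ ∀ w ∈ O ∩ G.Y, G.seg x₁ x₂ w ⊆ U) ∧ y ∈ O) ∧
    ∀ n : ℕ, ∃ O, (IsOpen O ∧ ∀ w ∈ O ∩ G.Y, ∀ w' ∈ O ∩ G.Y,
      G.seg x₁ x₂ w ⊆ Metric.thickening (1 / (n + 1)) (G.seg x₁ x₂ w')) ∧ y ∈ O}

lemma measurableSet_contSet (hY : MeasurableSet G.Y) (x₁ x₂ : ℝ) (U : Set M) :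
    MeasurableSet (G.contSet x₁ x₂ U) := by
  have : G.contSet x₁ x₂ U = G.Y ∩ ((⋃₀ {O | IsOpen O ∧ ∀ w ∈ O ∩ G.Y, G.seg x₁ x₂ w ⊆ U}) ∩
      ⋂ n : ℕ, ⋃₀ {O | IsOpen O ∧ ∀ w ∈ O ∩ G.Y, ∀ w' ∈ O ∩ G.Y,
        G.seg x₁ x₂ w ⊆ Metric.thickening (1 / (n + 1)) (G.seg x₁ x₂ w')}) := by
    ext y
    simp only [contSet, mem_ofPred_eq, mem_inter_iff, mem_iInter, mem_sUnion]
  rw [this]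
  exact hY.inter ((isOpen_sUnion fun O hO => hO.1).measurableSet.inter
    (MeasurableSet.iInter fun n => (isOpen_sUnion fun O hO => hO.1).measurableSet))

lemma contSet_subset {x₁ x₂ : ℝ} {U : Set M} : G.contSet x₁ x₂ U ⊆ G.Y := fun _ h => h.1

lemma seg_subset_of_mem_contSet {x₁ x₂ y : ℝ} {U : Set M} (hy : y ∈ G.contSet x₁ x₂ U) :
    G.seg x₁ x₂ y ⊆ U := by
  obtain ⟨hy, ⟨O, ⟨-, hO⟩, hyO⟩, -⟩ := hy
  exact hO y ⟨hyO, hy⟩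

lemma isCompact_biUnion_seg {x₁ x₂ : ℝ} {U : Set M} {K : Set ℝ} (hK : IsCompact K)
    (hKC : K ⊆ G.contSet x₁ x₂ U) : IsCompact (⋃ y ∈ K, G.seg x₁ x₂ y) := by
  refine isCompact_of_finite_subcover fun {ι} c hc hsub => ?_
  have key : ∀ y ∈ K, ∃ t : Finset ι, ∃ O ∈ 𝓝 y, ∀ w ∈ O ∩ G.Y, G.seg x₁ x₂ w ⊆ ⋃ i ∈ t, c i := by
    intro y hy
    obtain ⟨hyY, -, hn⟩ := hKC hy
    obtain ⟨t, ht⟩ := (isCompact_seg hyY (x₁ := x₁) (x₂ := x₂)).elim_finite_subcover c hc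
      ((subset_biUnion_of_mem (u := fun y => G.seg x₁ x₂ y) hy).trans hsub)
    obtain ⟨δ, hδ, hδt⟩ := (isCompact_seg hyY).exists_thickening_subset_open
      (isOpen_biUnion fun i _ => hc i) ht
    obtain ⟨n, hnδ⟩ := exists_nat_one_div_lt hδ
    obtain ⟨O, ⟨hO, hOw⟩, hyO⟩ := hn n
    exact ⟨t, O, hO.mem_nhds hyO, fun w hw => (hOw w hw y ⟨hyO, hyY⟩).trans
      ((Metric.thickening_mono hnδ.le _).trans hδt)⟩
  choose! t O hO hOw using key
  classical
  obtain ⟨s, hsK, hs⟩ := hK.elim_nhds_subcover O hO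
  refine ⟨s.biUnion t, iUnion₂_subset fun y hy => ?_⟩
  obtain ⟨z, hz, hyz⟩ := mem_iUnion₂.1 (hs hy)
  refine (hOw z (hsK z hz) y ⟨hyz, (hKC hy).1⟩).trans ?_
  refine biUnion_subset_biUnion_left fun i hi => ?_
  exact Finset.mem_biUnion.2 ⟨z, hz, hi⟩

lemma mem_contSet {x₀ x₁ xm x₂ x₃ y : ℝ} (hx₀ : x₀ ∈ G.X) (hx₁ : x₁ ∈ G.X)
    (hxm : xm ∈ G.X) (hx₂ : x₂ ∈ G.X) (hx₃ : x₃ ∈ G.X) (hy : y ∈ G.Y)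
    (h01 : x₀ < x₁) (h1m : x₁ < xm) (hm2 : xm < x₂) (h23 : x₂ < x₃)
    {k : ℂ → M} (hk : IsOpenEmbedding k) {r : ℝ → ℝ}
    (hrk : ∀ t ∈ Icc (G.τ y x₀) (G.τ y x₃), G.g y t = k (r t))
    (hr : StrictMonoOn r (Icc (G.τ y x₀) (G.τ y x₃)))
    (hright : ∀ V : Set M, IsOpen V → G.seg x₁ x₂ y ⊆ V → ∃ c ∈ G.Y, y < c ∧ G.seg x₁ x₂ c ⊆ V)
    (hleft : ∀ V : Set M, IsOpen V → G.seg x₁ x₂ y ⊆ V → ∃ c ∈ G.Y, c < y ∧ G.seg x₁ x₂ c ⊆ V)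
    {U : Set M} (hU : IsOpen U) (hyU : G.seg x₁ x₂ y ⊆ U) : y ∈ G.contSet x₁ x₂ U := by
  have hmono := (G.τ_mono y hy).monotoneOn
  have hI : ∀ x ∈ G.X, x₀ ≤ x → x ≤ x₃ → G.τ y x ∈ Icc (G.τ y x₀) (G.τ y x₃) :=
    fun x hx h h' => ⟨hmono hx₀ hx h, hmono hx hx₃ h'⟩
  have hlt : ∀ x ∈ G.X, ∀ x' ∈ G.X, x₀ ≤ x → x < x' → x' ≤ x₃ → r (G.τ y x) < r (G.τ y x') :=
    fun x hx x' hx' h h' h'' => hr (hI x hx h (h'.le.trans h'')) (hI x' hx' (h.trans h'.le) h'')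
      (G.τ_mono y hy hx hx' h')
  have d0 := hlt x₀ hx₀ x₁ hx₁ le_rfl h01 (by linarith)
  have d1 := hlt x₁ hx₁ xm hxm (by linarith) h1m (by linarith)
  have d2 := hlt xm hxm x₂ hx₂ (by linarith) hm2 (by linarith)
  have d3 := hlt x₂ hx₂ x₃ hx₃ (by linarith) h23 le_rfl
  have hrc : ContinuousOn r (Icc (G.τ y x₀) (G.τ y x₃)) := by
    have : ContinuousOn (fun t => (r t : ℂ)) (Icc (G.τ y x₀) (G.τ y x₃)) := by
      rw [hk.isEmbedding.isInducing.continuousOn_iff]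
      exact (G.g_cont y hy).continuousOn.congr fun t ht => (hrk t ht).symm
    exact Complex.continuous_re.comp_continuousOn this
  have i1 := hI x₁ hx₁ h01.le (by linarith)
  have i2 := hI x₂ hx₂ (by linarith) h23.le
  have hsub12 : Icc (G.τ y x₁) (G.τ y x₂) ⊆ Icc (G.τ y x₀) (G.τ y x₃) :=
    Icc_subset_Icc i1.1 i2.2
  set p₁ := r (G.τ y x₁)
  set p₂ := r (G.τ y x₂)
  set gap := min (min (p₁ - r (G.τ y x₀)) (r (G.τ y xm) - p₁))
    (min (p₂ - r (G.τ y xm)) (r (G.τ y x₃) - p₂))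
  have hgap : 0 < gap := by
    simp only [gap, lt_min_iff, sub_pos]; exact ⟨⟨d0, d1⟩, d2, d3⟩
  have gap0 : gap ≤ p₁ - r (G.τ y x₀) := (min_le_left _ _).trans (min_le_left _ _)
  have gap1 : gap ≤ r (G.τ y xm) - p₁ := (min_le_left _ _).trans (min_le_right _ _)
  have gap2 : gap ≤ p₂ - r (G.τ y xm) := (min_le_right _ _).trans (min_le_left _ _)
  have gap3 : gap ≤ r (G.τ y x₃) - p₂ := (min_le_right _ _).trans (min_le_right _ _)
  have htrap := fun ε (h : 0 < ε) (h' : ε < gap) =>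
    eventually_trap hx₀ hx₁ hxm hx₂ hx₃ hy h01 h1m hm2 h23 hk hrk hr hright hleft (ε := ε) h
      (by linarith) (by linarith) (by linarith) (by linarith)
  refine ⟨hy, ?_, fun n => ?_⟩
  · obtain ⟨ε, hε, hεU⟩ := exists_planeBox_subset (p := p₁) (q := p₂) (by linarith)
      (hU.preimage hk.continuous) (by
        intro v hv
        obtain ⟨s, hs, rfl⟩ := intermediate_value_Icc (hmono hx₁ hx₂ (by linarith))
          (hrc.mono hsub12) hv
        exact hyU ⟨s, hs, hrk s (hsub12 hs)⟩)
    obtain ⟨O, hO, hOw⟩ := htrap (min ε (gap / 2)) (by positivity)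
      ((min_le_right _ _).trans_lt (by linarith))
    obtain ⟨O', hO', hO'o, hyO'⟩ := mem_nhds_iff.1 hO
    refine ⟨O', ⟨hO'o, fun w hw => (hOw w ⟨hO' hw.1, hw.2⟩).1.trans ?_⟩, hyO'⟩
    exact image_subset_iff.2 ((planeBox_mono (min_le_left _ _)).trans hεU)
  · obtain ⟨η, hη, hηk⟩ := Metric.uniformContinuousOn_iff.1
      ((isCompact_planeBox (p := p₁) (q := p₂) (ε := gap)).uniformContinuousOn_of_continuous
        hk.continuous.continuousOn) (1 / (n + 1)) (by positivity)
    set ε := min (η / 8) (gap / 2)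
    have hε : 0 < ε := by positivity
    have hεη : ε ≤ η / 8 := min_le_left _ _
    have hεg : ε ≤ gap / 2 := min_le_right _ _
    obtain ⟨O, hO, hOw⟩ := htrap ε hε (by linarith)
    obtain ⟨O', hO', hO'o, hyO'⟩ := mem_nhds_iff.1 hO
    refine ⟨O', ⟨hO'o, fun w hw w' hw' z hz => ?_⟩, hyO'⟩
    obtain ⟨ζ, hζ, rfl⟩ := (hOw w ⟨hO' hw.1, hw.2⟩).1 hz
    obtain ⟨b', ⟨ζ₁, hζ₁, e₁⟩, ⟨ζ₂, hζ₂, e₂⟩⟩ := hOw w' ⟨hO' hw'.1, hw'.2⟩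
    choose! v hvB hvk using fun t (ht : t ∈ Icc (G.τ w' x₁) (G.τ w' x₂)) =>
      b' (mem_image_of_mem (G.g w') ht)
    have hvc : ContinuousOn v (Icc (G.τ w' x₁) (G.τ w' x₂)) := by
      rw [hk.isEmbedding.isInducing.continuousOn_iff]
      exact (G.g_cont w' hw'.2).continuousOn.congr fun t ht => hvk t ht
    have hτ := (G.τ_mono w' hw'.2).monotoneOn hx₁ hx₂ (h1m.trans hm2).le
    have v1 : v (G.τ w' x₁) = ζ₁ := hk.injective ((hvk _ ⟨le_rfl, hτ⟩).trans e₁.symm)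
    have v2 : v (G.τ w' x₂) = ζ₂ := hk.injective ((hvk _ ⟨hτ, le_rfl⟩).trans e₂.symm)
    rw [Metric.mem_ball, dist_eq_norm] at hζ₁ hζ₂
    have n1 := abs_lt.1 ((Complex.abs_re_le_norm _).trans_lt hζ₁)
    have n2 := abs_lt.1 ((Complex.abs_re_le_norm _).trans_lt hζ₂)
    simp only [Complex.sub_re, Complex.ofReal_re] at n1 n2
    obtain ⟨⟨a1, a2⟩, a3, a4⟩ := hζ
    obtain ⟨c, hc1, hc2, hc3, hc4⟩ : ∃ c, p₁ + ε ≤ c ∧ c ≤ p₂ - ε ∧ ζ.re - c ≤ 2 * ε ∧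
        -(2 * ε) ≤ ζ.re - c := by
      rcases le_total ζ.re (p₁ + ε) with h | h
      · exact ⟨p₁ + ε, by linarith, by linarith, by linarith, by linarith⟩
      rcases le_total ζ.re (p₂ - ε) with h' | h'
      · exact ⟨ζ.re, h, h', by linarith, by linarith⟩
      · exact ⟨p₂ - ε, by linarith, by linarith, by linarith, by linarith⟩
    obtain ⟨t, ht, htc⟩ := intermediate_value_Icc hτ (Complex.continuous_re.comp_continuousOn hvc)
      (show c ∈ Icc _ _ by simp only [comp, v1, v2]; exact ⟨by linarith, by linarith⟩)
    obtain ⟨-, b3, b4⟩ := hvB t ht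
    rw [Metric.mem_thickening_iff]
    refine ⟨_, mem_image_of_mem _ ht, ?_⟩
    rw [← hvk t ht]
    refine hηk ζ (planeBox_mono (by linarith) ⟨⟨a1, a2⟩, a3, a4⟩) _
      (planeBox_mono (by linarith) (hvB t ht)) ?_
    rw [dist_eq_norm]
    refine (Complex.norm_le_abs_re_add_abs_im _).trans_lt ?_
    have q1 : |(ζ - v t).re| ≤ 2 * ε := by
      rw [Complex.sub_re, show (v t).re = c from htc]
      exact abs_le.2 ⟨hc4, hc3⟩
    have q2 : |(ζ - v t).im| ≤ 2 * ε := by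
      rw [Complex.sub_im]
      exact abs_le.2 ⟨by linarith, by linarith⟩
    linarith

end ArcGrid

namespace ArcGrid
variable {M : Type}

/-- Near the crossing point of indices `x` and `y`, the surface has a chart in which
a full line of the range of `g y` through the point is straight. -/
def Flat [TopologicalSpace M] (G : ArcGrid M) (x y : ℝ) : Prop :=
  ∃ k : ℂ → M, IsOpenEmbedding k ∧ (∃ r : ℝ, k r = G.pt x y) ∧ ∀ r : ℝ, k r ∈ range (G.g y)

lemma pt_injOn [TopologicalSpace M] {G : ArcGrid M} {y : ℝ} (hy : y ∈ G.Y) :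
    InjOn (fun x => G.pt x y) G.X :=
  (G.g_inj y hy).comp_injOn (G.τ_mono y hy).injOn

lemma exists_strictMonoOn_chart [TopologicalSpace M] {a : ℝ → M} (ha : Continuous a)
    (hai : Injective a) {k : ℂ → M} (hk : IsOpenEmbedding k) {p q : ℝ} (hpq : p ≤ q)
    (h : ∀ t ∈ Icc p q, a t ∈ range fun r : ℝ => k r) :
    ∃ k' : ℂ → M, IsOpenEmbedding k' ∧ ∃ r : ℝ → ℝ, (∀ t ∈ Icc p q, a t = k' (r t)) ∧
      StrictMonoOn r (Icc p q) := by
  choose! r hr using h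
  have hr' : ∀ t ∈ Icc p q, k (r t) = a t := hr
  have hrc : ContinuousOn r (Icc p q) := by
    have : ContinuousOn (fun t => (r t : ℂ)) (Icc p q) := by
      rw [hk.isEmbedding.isInducing.continuousOn_iff]
      exact ha.continuousOn.congr hr'
    exact Complex.continuous_re.comp_continuousOn this
  have hri : InjOn r (Icc p q) := fun s hs t ht e =>
    hai (by rw [← hr' s hs, ← hr' t ht, e])
  rcases hrc.strictMonoOn_of_injOn_Icc' hpq hri with hm | hm
  · exact ⟨k, hk, r, fun t ht => (hr' t ht).symm, hm⟩
  · refine ⟨fun z => k (-z), hk.comp (Homeomorph.neg ℂ).isOpenEmbedding, fun t => - r t,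
      fun t ht => ?_, fun s hs t ht hst => neg_lt_neg (hm hs ht hst)⟩
    simp [hr' t ht]

variable [MetricSpace M] [SecondCountableTopology M]

/-- For all but countably many `y`, all but countably many flat crossing points on the arc of `g y`
lie on a short arc at which the family is continuous. -/
lemma exists_countable_contSet (G : ArcGrid M) {U : Set M} (hU : IsOpen U) :
    ∃ D ⊆ G.X, D.Countable ∧ ∃ N : Set ℝ, N.Countable ∧ ∀ y ∈ G.Y, y ∉ N →
      {x ∈ G.X | G.pt x y ∈ U ∧ G.Flat x y ∧ ∀ x₁ ∈ D, ∀ x₂ ∈ D, x₁ < x → x < x₂ →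
        y ∉ G.contSet x₁ x₂ U}.Countable := by
  obtain ⟨D, hDX, hD, hDb⟩ := exists_countable_between G.X
  refine ⟨D, hDX, hD, ?_⟩
  have hI : {T : Set (Set M) | T.Finite ∧ T ⊆ TopologicalSpace.countableBasis M}.Countable :=
    countable_ofPred_finite_subset (TopologicalSpace.countable_countableBasis M)
  set I := {T : Set (Set M) | T.Finite ∧ T ⊆ TopologicalSpace.countableBasis M}
  refine ⟨⋃ x₁ ∈ D, ⋃ x₂ ∈ D,
    {y ∈ G.Y | ∃ T ∈ I, G.seg x₁ x₂ y ⊆ ⋃₀ T ∧ ∀ c ∈ G.Y, y < c → ¬ G.seg x₁ x₂ c ⊆ ⋃₀ T} ∪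
    {y ∈ G.Y | ∃ T ∈ I, G.seg x₁ x₂ y ⊆ ⋃₀ T ∧ ∀ c ∈ G.Y, c < y → ¬ G.seg x₁ x₂ c ⊆ ⋃₀ T},
    hD.biUnion fun x₁ _ => hD.biUnion fun x₂ _ =>
      (countable_setOf_last hI _ _).union (countable_setOf_first hI _ _), fun y hy hyN => ?_⟩
  have hright : ∀ x₁ ∈ D, ∀ x₂ ∈ D, ∀ V : Set M, IsOpen V → G.seg x₁ x₂ y ⊆ V →
      ∃ c ∈ G.Y, y < c ∧ G.seg x₁ x₂ c ⊆ V := by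
    intro x₁ h₁ x₂ h₂ V hV hsub
    by_contra! hcon
    obtain ⟨T, hT, h, h'⟩ := exists_finite_basis_between (isCompact_seg hy) hV hsub
    exact hyN (mem_iUnion₂.2 ⟨x₁, h₁, mem_iUnion₂.2 ⟨x₂, h₂, Or.inl
      ⟨hy, T, hT, h, fun c hc hyc h'' => hcon c hc hyc (h''.trans h')⟩⟩⟩)
  have hleft : ∀ x₁ ∈ D, ∀ x₂ ∈ D, ∀ V : Set M, IsOpen V → G.seg x₁ x₂ y ⊆ V →
      ∃ c ∈ G.Y, c < y ∧ G.seg x₁ x₂ c ⊆ V := by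
    intro x₁ h₁ x₂ h₂ V hV hsub
    by_contra! hcon
    obtain ⟨T, hT, h, h'⟩ := exists_finite_basis_between (isCompact_seg hy) hV hsub
    exact hyN (mem_iUnion₂.2 ⟨x₁, h₁, mem_iUnion₂.2 ⟨x₂, h₂, Or.inr
      ⟨hy, T, hT, h, fun c hc hyc h'' => hcon c hc hyc (h''.trans h')⟩⟩⟩)
  have hlim : ∀ F : Filter ℝ, F.NeBot →
      {x ∈ G.X | Tendsto (G.g y) F (𝓝 (G.pt x y))}.Countable := fun F _ => by
    refine Set.Subsingleton.countable ?_
    rintro x ⟨hx, h⟩ x' ⟨hx', h'⟩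
    exact pt_injOn hy hx hx' (tendsto_nhds_unique h h')
  refine ((((countable_setOf_last (countable_univ (α := ℚ)) G.X fun x q => G.τ y x < q).union
    (countable_setOf_first (countable_univ (α := ℚ)) G.X fun x q => (q : ℝ) < G.τ y x)).union
    (hlim atTop inferInstance)).union (hlim atBot inferInstance)).mono ?_
  rintro x ⟨hx, hxU, ⟨k, hk, ⟨r₀, hr₀⟩, hkg⟩, hC⟩
  by_contra hbad
  simp only [mem_union, not_or] at hbad
  obtain ⟨⟨⟨hr, hl⟩, htop⟩, hbot⟩ := hbad
  have hr' : ∀ b, G.τ y x < b → ∃ x' ∈ G.X, x < x' ∧ G.τ y x' < b := by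
    intro b hb
    by_contra! hcon
    obtain ⟨q, hq, hq'⟩ := exists_rat_btwn hb
    exact hr ⟨hx, q, mem_univ _, hq, fun c hc hxc h => absurd (hcon c hc hxc) (by linarith)⟩
  have hl' : ∀ b, b < G.τ y x → ∃ x' ∈ G.X, x' < x ∧ b < G.τ y x' := by
    intro b hb
    by_contra! hcon
    obtain ⟨q, hq, hq'⟩ := exists_rat_btwn hb
    exact hl ⟨hx, q, mem_univ _, hq', fun c hc hxc h => absurd (hcon c hc hxc) (by linarith)⟩
  have hev : ∀ᶠ t in 𝓝 (G.τ y x), G.g y t ∈ range (fun r : ℝ => k r) ∧ G.g y t ∈ U := by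
    refine (eventually_mem_range_of_range_subset (hk.continuous.comp Complex.continuous_ofReal)
      (hk.injective.comp Complex.ofReal_injective) (G.g_cont y hy) (G.g_inj y hy) ?_
      (r₀ := r₀) hr₀ ?_ ?_).and ((G.g_cont y hy).continuousAt (hU.mem_nhds hxU))
    · rintro _ ⟨r, rfl⟩
      exact hkg r
    · exact fun h => htop ⟨hx, by rwa [← hr₀]⟩
    · exact fun h => hbot ⟨hx, by rwa [← hr₀]⟩
  obtain ⟨a, b, ⟨ha, hb⟩, hab⟩ := mem_nhds_iff_exists_Ioo_subset.1 hev
  obtain ⟨x₃, hx₃, hxx₃, hx₃b⟩ := hr' b hb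
  obtain ⟨z, hz, hxz, hzx₃⟩ := hr' (G.τ y x₃) (G.τ_mono y hy hx hx₃ hxx₃)
  obtain ⟨x₀, hx₀, hxx₀, hx₀a⟩ := hl' a ha
  obtain ⟨z', hz', hxz', hzx₀⟩ := hl' (G.τ y x₀) (G.τ_mono y hy hx₀ hx hxx₀)
  obtain ⟨x₂, hx₂D, hxx₂, hx₂₃⟩ := hDb x x₃ z hz hxz (((G.τ_mono y hy).lt_iff_lt hz hx₃).1 hzx₃)
  obtain ⟨x₁, hx₁D, hx₀₁, hxx₁⟩ := hDb x₀ x z' hz' (((G.τ_mono y hy).lt_iff_lt hx₀ hz').1 hzx₀) hxz'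
  have hsub : Icc (G.τ y x₀) (G.τ y x₃) ⊆ Ioo a b := fun t ht =>
    ⟨hx₀a.trans_le ht.1, ht.2.trans_lt hx₃b⟩
  obtain ⟨k', hk', r, hrk, hrm⟩ := exists_strictMonoOn_chart (G.g_cont y hy) (G.g_inj y hy) hk
    ((G.τ_mono y hy hx₀ hx₃ (hxx₀.trans hxx₃)).le) fun t ht => (hab (hsub ht)).1
  refine hC x₁ hx₁D x₂ hx₂D hxx₁ hxx₂ (mem_contSet hx₀ (hDX hx₁D) hx (hDX hx₂D) hx₃ hy hx₀₁ hxx₁ hxx₂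
    hx₂₃ hk' hrk hrm (hright x₁ hx₁D x₂ hx₂D) (hleft x₁ hx₁D x₂ hx₂D) hU ?_)
  rintro _ ⟨t, ht, rfl⟩
  have hm := (G.τ_mono y hy).monotoneOn
  exact (hab (hsub ⟨(hm hx₀ (hDX hx₁D) hx₀₁.le).trans ht.1,
    ht.2.trans (hm (hDX hx₂D) hx₃ hx₂₃.le)⟩)).2

end ArcGrid

namespace ArcGrid
variable {M : Type}

lemma swap_pt [TopologicalSpace M] {G : ArcGrid M} {x y : ℝ} (hx : x ∈ G.X) (hy : y ∈ G.Y) :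
    G.swap.pt y x = G.pt x y :=
  (G.cross x hx y hy).symm

variable [MetricSpace M] [SecondCountableTopology M]

lemma exists_ae_covering (G : ArcGrid M) (hY : MeasurableSet G.Y) {lX lY : Measure ℝ}
    [SFinite lX] [SFinite lY] [NullSingletonClass lX] [NullSingletonClass lY] {U : Set M} (hU : IsOpen U)
    {P : Set (ℝ × ℝ)} (hP : MeasurableSet P) (hPXY : P ⊆ G.X ×ˢ G.Y)
    (hPU : ∀ p ∈ P, G.pt p.1 p.2 ∈ U) (hPF : ∀ p ∈ P, G.Flat p.1 p.2) :
    ∃ D ⊆ G.X, D.Countable ∧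
      (lX.prod lY) (P \ ⋃ x₁ ∈ D, ⋃ x₂ ∈ D, Ioo x₁ x₂ ×ˢ G.contSet x₁ x₂ U) = 0 := by
  obtain ⟨D, hDX, hD, N, hN, hDN⟩ := G.exists_countable_contSet hU
  refine ⟨D, hDX, hD, ?_⟩
  have hmeas : MeasurableSet (P \ ⋃ x₁ ∈ D, ⋃ x₂ ∈ D, Ioo x₁ x₂ ×ˢ G.contSet x₁ x₂ U) :=
    hP.diff (MeasurableSet.biUnion hD fun x₁ _ => MeasurableSet.biUnion hD fun x₂ _ =>
      measurableSet_Ioo.prod (measurableSet_contSet hY _ _ _))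
  rw [← Measure.prod_swap, Measure.map_apply measurable_swap hmeas,
    Measure.measure_prod_null (measurable_swap hmeas)]
  filter_upwards [compl_mem_ae_iff.2 (hN.measure_zero lY)] with y hyN
  by_cases hy : y ∈ G.Y
  · refine measure_mono_null ?_ ((hDN y hy hyN).measure_zero lX)
    rintro x ⟨hxP, hx⟩
    refine ⟨(hPXY hxP).1, hPU _ hxP, hPF _ hxP, fun x₁ h₁ x₂ h₂ h₁x hx₂ hC => hx ?_⟩
    exact mem_iUnion₂.2 ⟨x₁, h₁, mem_iUnion₂.2 ⟨x₂, h₂, ⟨h₁x, hx₂⟩, hC⟩⟩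
  · refine measure_mono_null (t := ∅) ?_ measure_empty
    rintro x ⟨hxP, -⟩
    exact hy (hPXY hxP).2

/-- A subgrid of positive measure all of whose arcs lie in `U`. -/
lemma exists_compact_subgrid (G : ArcGrid M) (hX : MeasurableSet G.X) (hY : MeasurableSet G.Y)
    {lX lY : Measure ℝ} [IsFiniteMeasure lX] [IsFiniteMeasure lY] [NullSingletonClass lX] [NullSingletonClass lY]
    {U : Set M} (hU : IsOpen U) {P : Set (ℝ × ℝ)} (hP : MeasurableSet P)
    (hPXY : P ⊆ G.X ×ˢ G.Y) (hPU : ∀ p ∈ P, G.pt p.1 p.2 ∈ U)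
    (hPF : ∀ p ∈ P, G.Flat p.1 p.2) (hPF' : ∀ p ∈ P, G.swap.Flat p.2 p.1)
    (hpos : (lX.prod lY) P ≠ 0) :
    ∃ x₁ ∈ G.X, ∃ x₂ ∈ G.X, ∃ y₁ ∈ G.Y, ∃ y₂ ∈ G.Y, ∃ Kx Ky : Set ℝ, IsCompact Kx ∧ IsCompact Ky ∧
      Kx ⊆ Ioo x₁ x₂ ∩ G.swap.contSet y₁ y₂ U ∧ Ky ⊆ Ioo y₁ y₂ ∩ G.contSet x₁ x₂ U ∧
      0 < lX Kx ∧ 0 < lY Ky := by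
  obtain ⟨D, hDX, hD, hnull⟩ := G.exists_ae_covering hY (lX := lX) (lY := lY) hU hP hPXY hPU hPF
  obtain ⟨E, hEY, hE, hnull'⟩ := G.swap.exists_ae_covering hX (lX := lY) (lY := lX) hU
    (measurable_swap hP) (fun p hp => ⟨(hPXY hp).2, (hPXY hp).1⟩)
    (fun p hp => (swap_pt (hPXY hp).1 (hPXY hp).2).symm ▸ hPU _ hp) (fun p hp => hPF' _ hp)
  set Qs := ⋃ x₁ ∈ D, ⋃ x₂ ∈ D, Ioo x₁ x₂ ×ˢ G.contSet x₁ x₂ U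
  set Qu := ⋃ y₁ ∈ E, ⋃ y₂ ∈ E, Ioo y₁ y₂ ×ˢ G.swap.contSet y₁ y₂ U with hQu
  have hQum : MeasurableSet Qu :=
    MeasurableSet.biUnion hE fun x₁ _ => MeasurableSet.biUnion hE fun x₂ _ =>
      measurableSet_Ioo.prod (measurableSet_contSet hX _ _ _)
  have hnull'' : (lX.prod lY) (P \ Prod.swap ⁻¹' Qu) = 0 := by
    rw [← Measure.prod_swap, Measure.map_apply measurable_swap (hP.diff (measurable_swap hQum))]
    exact hnull'
  by_contra! hcon
  apply hpos
  refine measure_mono_null (t := (P \ Qs) ∪ (P \ Prod.swap ⁻¹' Qu) ∪ ⋃ x₁ ∈ D, ⋃ x₂ ∈ D, ⋃ y₁ ∈ E,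
    ⋃ y₂ ∈ E, (Ioo x₁ x₂ ∩ G.swap.contSet y₁ y₂ U) ×ˢ (Ioo y₁ y₂ ∩ G.contSet x₁ x₂ U)) ?_ ?_
  · intro p hp
    by_cases h : p ∈ Qs
    · by_cases h' : p ∈ Prod.swap ⁻¹' Qu
      · right
        obtain ⟨x₁, h₁, x₂, h₂, hx, hy⟩ : ∃ x₁ ∈ D, ∃ x₂ ∈ D, p.1 ∈ Ioo x₁ x₂ ∧
            p.2 ∈ G.contSet x₁ x₂ U := by
          simpa only [Qs, mem_iUnion₂, mem_prod, exists_prop] using h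
        obtain ⟨y₁, h₁', y₂, h₂', hx', hy'⟩ : ∃ y₁ ∈ E, ∃ y₂ ∈ E, p.2 ∈ Ioo y₁ y₂ ∧
            p.1 ∈ G.swap.contSet y₁ y₂ U := by
          simpa only [Qu, mem_preimage, mem_iUnion₂, mem_prod, exists_prop, Prod.fst_swap, Prod.snd_swap] using h'
        simp only [mem_iUnion₂]
        exact ⟨x₁, h₁, x₂, h₂, y₁, h₁', y₂, h₂', ⟨hx, hy'⟩, hx', hy⟩
      · exact Or.inl (Or.inr ⟨hp, h'⟩)
    · exact Or.inl (Or.inl ⟨hp, h⟩)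
  · refine measure_union_null (measure_union_null hnull hnull'') ?_
    simp only [measure_biUnion_null_iff hD, measure_biUnion_null_iff hE]
    intro x₁ h₁ x₂ h₂ y₁ h₁' y₂ h₂'
    rw [Measure.prod_prod]
    by_contra hne
    obtain ⟨hne₁, hne₂⟩ := mul_ne_zero_iff.1 hne
    obtain ⟨Kx, hKx, hKxc, hKx0⟩ := (measurableSet_Ioo.inter
      (measurableSet_contSet (G := G.swap) hX y₁ y₂ U)).exists_lt_isCompact
      (pos_iff_ne_zero.2 hne₁)
    obtain ⟨Ky, hKy, hKyc, hKy0⟩ := (measurableSet_Ioo.inter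
      (measurableSet_contSet hY x₁ x₂ U)).exists_lt_isCompact (pos_iff_ne_zero.2 hne₂)
    exact (hcon x₁ (hDX h₁) x₂ (hDX h₂) y₁ (hEY h₁') y₂ (hEY h₂') Kx Ky hKxc hKyc hKx hKy
      hKx0).not_gt hKy0

end ArcGrid

namespace ArcGrid
variable {M : Type} [TopologicalSpace M] [TopologicalSpace.MetrizableSpace M]
  [SecondCountableTopology M]

/-- A subgrid of positive measure all of whose arcs lie in `U` and have closed union. -/
lemma exists_compact_subgrid' (G : ArcGrid M) (hX : MeasurableSet G.X) (hY : MeasurableSet G.Y)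
    {lX lY : Measure ℝ} [IsFiniteMeasure lX] [IsFiniteMeasure lY]
    [NullSingletonClass lX] [NullSingletonClass lY]
    {U : Set M} (hU : IsOpen U) {P : Set (ℝ × ℝ)} (hP : MeasurableSet P)
    (hPXY : P ⊆ G.X ×ˢ G.Y) (hPU : ∀ p ∈ P, G.pt p.1 p.2 ∈ U)
    (hPF : ∀ p ∈ P, G.Flat p.1 p.2) (hPF' : ∀ p ∈ P, G.swap.Flat p.2 p.1)
    (hpos : (lX.prod lY) P ≠ 0) :
    ∃ x₁ ∈ G.X, ∃ x₂ ∈ G.X, ∃ y₁ ∈ G.Y, ∃ y₂ ∈ G.Y, ∃ Kx Ky : Set ℝ,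
      Kx ⊆ Ioo x₁ x₂ ∩ G.X ∧ Ky ⊆ Ioo y₁ y₂ ∩ G.Y ∧ 0 < lX Kx ∧ 0 < lY Ky ∧
      IsClosed (⋃ y ∈ Ky, G.seg x₁ x₂ y) ∧ IsClosed (⋃ x ∈ Kx, G.swap.seg y₁ y₂ x) ∧
      (⋃ y ∈ Ky, G.seg x₁ x₂ y) ⊆ U ∧ (⋃ x ∈ Kx, G.swap.seg y₁ y₂ x) ⊆ U := by
  let := TopologicalSpace.metrizableSpaceMetric M
  obtain ⟨x₁, hx₁, x₂, hx₂, y₁, hy₁, y₂, hy₂, Kx, Ky, hKx, hKy, hKxs, hKys, hx, hy⟩ :=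
    G.exists_compact_subgrid hX hY hU hP hPXY hPU hPF hPF' hpos
  refine ⟨x₁, hx₁, x₂, hx₂, y₁, hy₁, y₂, hy₂, Kx, Ky, fun x h => ⟨(hKxs h).1, contSet_subset (hKxs h).2⟩,
    fun y h => ⟨(hKys h).1, contSet_subset (hKys h).2⟩, hx, hy,
    (isCompact_biUnion_seg hKy fun y h => (hKys h).2).isClosed,
    (isCompact_biUnion_seg hKx fun x h => (hKxs h).2).isClosed,
    iUnion₂_subset fun y h => seg_subset_of_mem_contSet (hKys h).2,
    iUnion₂_subset fun x h => seg_subset_of_mem_contSet (hKxs h).2⟩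

end ArcGrid

/-- The fibers of a tartan, parametrized by their crossings with a fixed pair of fibers. -/
structure TartanGrid {μ : Measure S} {Ts Tu : MeasuredTurbulation μ} (R : Tartan Ts Tu)
    (𝔰 𝔲 : Set S) extends ArcGrid S where
  A : ℝ → Set S
  B : ℝ → Set S
  g₀ : ℝ → S
  h₀ : ℝ → S
  A_mem : ∀ y ∈ Y, A y ∈ R.fibs
  B_mem : ∀ x ∈ X, B x ∈ R.fibu
  A_eq : ∀ y ∈ Y, A y = g y '' Icc (ga y) (gb y)
  B_eq : ∀ x ∈ X, B x = h x '' Icc (ha x) (hb x)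
  g_line : ∀ y ∈ Y, range (g y) ∈ Ts.lines
  h_line : ∀ x ∈ X, range (h x) ∈ Tu.lines
  g₀_cont : Continuous g₀
  h₀_cont : Continuous h₀
  g₀_inj : Injective g₀
  h₀_inj : Injective h₀
  g₀_line : range g₀ ∈ Ts.lines
  h₀_line : range h₀ ∈ Tu.lines
  𝔰_arc : ∃ a b, 𝔰 = g₀ '' Icc a b
  𝔲_arc : ∃ a b, 𝔲 = h₀ '' Icc a b
  X_eq : X = g₀ ⁻¹' (𝔰 ∩ R.core)
  Y_eq : Y = h₀ ⁻¹' (𝔲 ∩ R.core)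
  g₀_mem : ∀ x ∈ X, g₀ x ∈ B x
  h₀_mem : ∀ y ∈ Y, h₀ y ∈ A y

lemma Tartan.nonempty_tartanGrid {μ : Measure S} {Ts Tu : MeasuredTurbulation μ}
    (R : Tartan Ts Tu) {𝔰 𝔲 : Set S} (h𝔰 : 𝔰 ∈ R.fibs) (h𝔲 : 𝔲 ∈ R.fibu) :
    Nonempty (TartanGrid R 𝔰 𝔲) := by
  obtain ⟨ords, ordu, hs, hu, hos, hou⟩ := R.oriented
  have : Nonempty S := ⟨(R.inter_unique 𝔰 h𝔰 𝔲 h𝔲).choose⟩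
  choose! ls hls f hfc hfi hfr a b hab hA hsord using hs
  choose! lu hlu k hkc hki hkr c d hcd hB huord using hu
  have hXB : ∀ x ∈ f 𝔰 ⁻¹' (𝔰 ∩ R.core), ∃ B ∈ R.fibu, f 𝔰 x ∈ B := by
    rintro x ⟨-, -, hx⟩
    rwa [← R.fibu_cover] at hx
  have hYA : ∀ y ∈ k 𝔲 ⁻¹' (𝔲 ∩ R.core), ∃ A ∈ R.fibs, k 𝔲 y ∈ A := by
    rintro y ⟨-, hy, -⟩
    rwa [← R.fibs_cover] at hy
  choose! B hBm hBx using hXB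
  choose! A hAm hAy using hYA
  have huniq : ∀ F ∈ R.fibs, ∀ E ∈ R.fibu, ∀ z ∈ F ∩ E, ∀ w ∈ F ∩ E, z = w := fun F hF E hE z hz w hw =>
    (R.inter_unique F hF E hE).unique hz hw
  have hcross : ∀ F ∈ R.fibs, ∀ E ∈ R.fibu, ∃ s ∈ Icc (a F) (b F), ∃ t ∈ Icc (c E) (d E),
      f F s = k E t ∧ f F s ∈ F ∩ E := by
    intro F hF E hE
    obtain ⟨z, ⟨hzF, hzE⟩, -⟩ := R.inter_unique F hF E hE
    have h1 := hzF
    have h2 := hzE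
    rw [hA F hF] at h1
    rw [hB E hE] at h2
    obtain ⟨s, hs, rfl⟩ := h1
    obtain ⟨t, ht, e⟩ := h2
    exact ⟨s, hs, t, ht, e.symm, hzF, hzE⟩
  choose! s hs t ht hst hmem using hcross
  have hmem' : ∀ F ∈ R.fibs, ∀ E ∈ R.fibu, k E (t F E) ∈ F ∩ E := fun F hF E hE =>
    hst F hF E hE ▸ hmem F hF E hE
  have hX𝔰 : ∀ x ∈ f 𝔰 ⁻¹' (𝔰 ∩ R.core), x ∈ Icc (a 𝔰) (b 𝔰) := by
    rintro x ⟨hx, -⟩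
    exact (hfi 𝔰 h𝔰).mem_set_image.1 ((hA 𝔰 h𝔰).subset hx)
  have hY𝔲 : ∀ y ∈ k 𝔲 ⁻¹' (𝔲 ∩ R.core), y ∈ Icc (c 𝔲) (d 𝔲) := by
    rintro y ⟨hy, -⟩
    exact (hki 𝔲 h𝔲).mem_set_image.1 ((hB 𝔲 h𝔲).subset hy)
  have hsle : ∀ F ∈ R.fibs, ∀ x ∈ f 𝔰 ⁻¹' (𝔰 ∩ R.core), ∀ x' ∈ f 𝔰 ⁻¹' (𝔰 ∩ R.core),
      (s F (B x) ≤ s F (B x') ↔ x ≤ x') := by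
    intro F hF x hx x' hx'
    rw [← hsord F hF _ (hs F hF _ (hBm x hx)) _ (hs F hF _ (hBm x' hx')),
      hos F hF 𝔰 h𝔰 _ (hBm x hx) _ (hBm x' hx') _ (hmem F hF _ (hBm x hx)) _
      (hmem F hF _ (hBm x' hx')) (f 𝔰 x) ⟨hx.1, hBx x hx⟩ (f 𝔰 x') ⟨hx'.1, hBx x' hx'⟩,
      hsord 𝔰 h𝔰 _ (hX𝔰 x hx) _ (hX𝔰 x' hx')]
  have htle : ∀ E ∈ R.fibu, ∀ y ∈ k 𝔲 ⁻¹' (𝔲 ∩ R.core), ∀ y' ∈ k 𝔲 ⁻¹' (𝔲 ∩ R.core),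
      (t (A y) E ≤ t (A y') E ↔ y ≤ y') := by
    intro E hE y hy y' hy'
    rw [← huord E hE _ (ht _ (hAm y hy) E hE) _ (ht _ (hAm y' hy') E hE),
      hou E hE 𝔲 h𝔲 _ (hAm y hy) _ (hAm y' hy') _ (hmem' _ (hAm y hy) E hE).symm _
      (hmem' _ (hAm y' hy') E hE).symm (k 𝔲 y) ⟨hy.1, hAy y hy⟩ (k 𝔲 y') ⟨hy'.1, hAy y' hy'⟩,
      huord 𝔲 h𝔲 _ (hY𝔲 y hy) _ (hY𝔲 y' hy')]
  refine ⟨{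
    X := f 𝔰 ⁻¹' (𝔰 ∩ R.core)
    Y := k 𝔲 ⁻¹' (𝔲 ∩ R.core)
    g := fun y => f (A y)
    h := fun x => k (B x)
    ga := fun y => a (A y)
    gb := fun y => b (A y)
    ha := fun x => c (B x)
    hb := fun x => d (B x)
    τ := fun y x => s (A y) (B x)
    σ := fun x y => t (A y) (B x)
    A := A
    B := B
    g₀ := f 𝔰
    h₀ := k 𝔲
    g_cont := fun y hy => hfc _ (hAm y hy)
    h_cont := fun x hx => hkc _ (hBm x hx)
    g_inj := fun y hy => hfi _ (hAm y hy)
    h_inj := fun x hx => hki _ (hBm x hx)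
    τ_mem := fun y hy x hx => hs _ (hAm y hy) _ (hBm x hx)
    σ_mem := fun x hx y hy => ht _ (hAm y hy) _ (hBm x hx)
    τ_mono := fun y hy x hx x' hx' hlt => ?_
    σ_mono := fun x hx y hy y' hy' hlt => ?_
    cross := fun x hx y hy => hst _ (hAm y hy) _ (hBm x hx)
    g_disj := fun y hy y' hy' v hv v' hv' e => ?_
    h_disj := fun x hx x' hx' v hv v' hv' e => ?_
    cross_unique := fun x hx y hy v hv w hw e => ?_
    A_mem := hAm
    B_mem := hBm
    A_eq := fun y hy => hA _ (hAm y hy)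
    B_eq := fun x hx => hB _ (hBm x hx)
    g_line := fun y hy => (hfr _ (hAm y hy)).symm ▸ hls _ (hAm y hy)
    h_line := fun x hx => (hkr _ (hBm x hx)).symm ▸ hlu _ (hBm x hx)
    g₀_cont := hfc 𝔰 h𝔰
    h₀_cont := hkc 𝔲 h𝔲
    g₀_inj := hfi 𝔰 h𝔰
    h₀_inj := hki 𝔲 h𝔲
    g₀_line := (hfr 𝔰 h𝔰).symm ▸ hls 𝔰 h𝔰
    h₀_line := (hkr 𝔲 h𝔲).symm ▸ hlu 𝔲 h𝔲
    𝔰_arc := ⟨_, _, hA 𝔰 h𝔰⟩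
    𝔲_arc := ⟨_, _, hB 𝔲 h𝔲⟩
    X_eq := rfl
    Y_eq := rfl
    g₀_mem := hBx
    h₀_mem := hAy }⟩
  · exact lt_of_not_ge fun h => hlt.not_ge ((hsle _ (hAm y hy) x' hx' x hx).1 h)
  · exact lt_of_not_ge fun h => hlt.not_ge ((htle _ (hBm x hx) y' hy' y hy).1 h)
  · have h1 : f (A y) v ∈ A y := (hA _ (hAm y hy)).symm.subset (mem_image_of_mem _ hv)
    have h2 : f (A y') v' ∈ A y' := (hA _ (hAm y' hy')).symm.subset (mem_image_of_mem _ hv')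
    have hAA : A y = A y' := R.fibs_disjoint.elim_set (hAm y hy) (hAm y' hy') _ h1 (e ▸ h2)
    exact hki 𝔲 h𝔲 (huniq _ (hAm y hy) 𝔲 h𝔲 _ ⟨hAy y hy, hy.1⟩ _ ⟨hAA ▸ hAy y' hy', hy'.1⟩)
  · have h1 : k (B x) v ∈ B x := (hB _ (hBm x hx)).symm.subset (mem_image_of_mem _ hv)
    have h2 : k (B x') v' ∈ B x' := (hB _ (hBm x' hx')).symm.subset (mem_image_of_mem _ hv')
    have hBB : B x = B x' := R.fibu_disjoint.elim_set (hBm x hx) (hBm x' hx') _ h1 (e ▸ h2)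
    exact hfi 𝔰 h𝔰 (huniq 𝔰 h𝔰 _ (hBm x hx) _ ⟨hx.1, hBx x hx⟩ _ ⟨hx'.1, hBB ▸ hBx x' hx'⟩)
  · have h1 : f (A y) v ∈ A y := (hA _ (hAm y hy)).symm.subset (mem_image_of_mem _ hv)
    have h2 : k (B x) w ∈ B x := (hB _ (hBm x hx)).symm.subset (mem_image_of_mem _ hw)
    have e1 := huniq _ (hAm y hy) _ (hBm x hx) _ ⟨h1, e ▸ h2⟩ _ (hmem _ (hAm y hy) _ (hBm x hx))
    have e2 := huniq _ (hAm y hy) _ (hBm x hx) _ ⟨e ▸ h1, h2⟩ _ (hmem' _ (hAm y hy) _ (hBm x hx))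
    exact ⟨hfi _ (hAm y hy) e1, hki _ (hBm x hx) e2⟩

namespace ArcGrid
variable {M : Type} [TopologicalSpace M] {G : ArcGrid M}

lemma seg_subset {x₁ x₂ y : ℝ} (hx₁ : x₁ ∈ G.X) (hx₂ : x₂ ∈ G.X) (hy : y ∈ G.Y) :
    G.seg x₁ x₂ y ⊆ G.g y '' Icc (G.ga y) (G.gb y) :=
  image_mono (τ_Icc_subset hx₁ hx₂ hy)

lemma pt_mem_swap_seg {x y₁ y y₂ : ℝ} (hx : x ∈ G.X) (hy₁ : y₁ ∈ G.Y) (hy : y ∈ G.Y)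
    (hy₂ : y₂ ∈ G.Y) (h₁ : y₁ ≤ y) (h₂ : y ≤ y₂) : G.pt x y ∈ G.swap.seg y₁ y₂ x :=
  swap_pt hx hy ▸ pt_mem_seg (G := G.swap) hy₁ hy hy₂ hx h₁ h₂

lemma eq_pt {x y : ℝ} (hx : x ∈ G.X) (hy : y ∈ G.Y) {z : M}
    (h : z ∈ G.g y '' Icc (G.ga y) (G.gb y)) (h' : z ∈ G.h x '' Icc (G.ha x) (G.hb x)) :
    z = G.pt x y := by
  obtain ⟨s, hs, rfl⟩ := h
  obtain ⟨t, ht, e⟩ := h'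
  rw [pt, (G.cross_unique x hx y hy s hs t ht e.symm).1]

lemma eq_of_mem_of_mem {y y' : ℝ} (hy : y ∈ G.Y) (hy' : y' ∈ G.Y) {z : M}
    (h : z ∈ G.g y '' Icc (G.ga y) (G.gb y)) (h' : z ∈ G.g y' '' Icc (G.ga y') (G.gb y')) :
    y = y' := by
  obtain ⟨s, hs, rfl⟩ := h
  obtain ⟨t, ht, e⟩ := h'
  exact G.g_disj y hy y' hy' s hs t ht e.symm

variable (G) in
/-- The order along the arcs of the first family. -/
def Ord (F : Set M) (p q : M) : Prop :=
  ∃ y ∈ G.Y, F ⊆ G.g y '' Icc (G.ga y) (G.gb y) ∧ ∃ s t, s ≤ t ∧ G.g y s = p ∧ G.g y t = q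

lemma ord_iff {x₁ x₂ y s t : ℝ} (hx₁ : x₁ ∈ G.X) (hx₂ : x₂ ∈ G.X) (hy : y ∈ G.Y)
    (hs : s ∈ Icc (G.τ y x₁) (G.τ y x₂)) :
    G.Ord (G.seg x₁ x₂ y) (G.g y s) (G.g y t) ↔ s ≤ t := by
  constructor
  · rintro ⟨y', hy', hsub, s', t', hst, es, et⟩
    have hm := mem_image_of_mem (G.g y) hs
    obtain rfl := eq_of_mem_of_mem hy hy' (seg_subset hx₁ hx₂ hy hm) (hsub hm)
    rwa [← G.g_inj y hy es, ← G.g_inj y hy et]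
  · exact fun h => ⟨y, hy, seg_subset hx₁ hx₂ hy, s, t, h, rfl, rfl⟩

lemma ord_pt_iff {x₁ x₂ x x' y : ℝ} (hx₁ : x₁ ∈ G.X) (hx₂ : x₂ ∈ G.X) (hy : y ∈ G.Y)
    (hx : x ∈ Ioo x₁ x₂ ∩ G.X) (hx' : x' ∈ G.X) :
    G.Ord (G.seg x₁ x₂ y) (G.pt x y) (G.pt x' y) ↔ x ≤ x' := by
  have hm := G.τ_mono y hy
  rw [pt, pt, ord_iff hx₁ hx₂ hy ⟨hm.monotoneOn hx₁ hx.2 hx.1.1.le,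
    hm.monotoneOn hx.2 hx₂ hx.1.2.le⟩, hm.le_iff_le hx.2 hx']

end ArcGrid

lemma TransverseAt.exists_chart {M : Type} [TopologicalSpace M] {ℓ ℓ' : Set M} {z : M} (h : TransverseAt ℓ ℓ' z) :
    (∃ k : ℂ → M, IsOpenEmbedding k ∧ (∃ r : ℝ, k r = z) ∧ ∀ r : ℝ, k r ∈ ℓ) ∧
    ∃ k : ℂ → M, IsOpenEmbedding k ∧ (∃ r : ℝ, k r = z) ∧ ∀ r : ℝ, k r ∈ ℓ' := by
  obtain ⟨α, β, hzα, hzβ, ⟨_, _, f, -, -, hf, a, b, -, -, -, hα⟩,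
    ⟨_, _, f', -, -, hf', a', b', -, -, -, hβ⟩, U, hU, hzU, e, heα, heβ⟩ := h
  have hαℓ : α ⊆ ℓ := hα ▸ hf ▸ image_subset_range _ _
  have hβℓ : β ⊆ ℓ' := hβ ▸ hf' ▸ image_subset_range _ _
  let e₁ := Complex.equivRealProdCLM.toHomeomorph
  constructor
  · refine ⟨_, (hU.isOpenEmbedding_subtypeVal.comp (e₁.trans e.symm).isOpenEmbedding), ?_, ?_⟩
    · obtain ⟨q, hq, hqz⟩ := heα.superset ⟨hzα, hzU⟩
      refine ⟨(e q).1, ?_⟩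
      rw [← hqz]
      have : e₁ ((e q).1 : ℂ) = e q := Prod.ext rfl hq.symm
      simp [this]
    · intro r
      refine hαℓ (heα.subset ⟨e.symm (e₁ r), ?_, rfl⟩).1
      simp [e₁]
  · refine ⟨_, (hU.isOpenEmbedding_subtypeVal.comp
      ((e₁.trans (Homeomorph.prodComm ℝ ℝ)).trans e.symm).isOpenEmbedding), ?_, ?_⟩
    · obtain ⟨q, hq, hqz⟩ := heβ.superset ⟨hzβ, hzU⟩
      refine ⟨(e q).2, ?_⟩
      rw [← hqz]
      have : (e₁ ((e q).2 : ℂ)).swap = e q := Prod.ext hq.symm rfl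
      simp [this]
    · intro r
      refine hβℓ (heβ.subset ⟨e.symm (e₁ r).swap, ?_, rfl⟩).1
      simp [e₁]

namespace TartanGrid
variable {μ : Measure S} {Ts Tu : MeasuredTurbulation μ} {R : Tartan Ts Tu} {𝔰 𝔲 : Set S}

lemma pt_mem (Q : TartanGrid R 𝔰 𝔲) {x y : ℝ} (hx : x ∈ Q.X) (hy : y ∈ Q.Y) :
    Q.pt x y ∈ Q.B x ∩ Q.A y := by
  rw [Q.A_eq y hy, Q.B_eq x hx]
  exact ⟨⟨_, Q.σ_mem x hx y hy, (Q.cross x hx y hy).symm⟩, _, Q.τ_mem y hy x hx, rfl⟩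

lemma seg_subset_A (Q : TartanGrid R 𝔰 𝔲) {x₁ x₂ y : ℝ} (hx₁ : x₁ ∈ Q.X) (hx₂ : x₂ ∈ Q.X)
    (hy : y ∈ Q.Y) : Q.seg x₁ x₂ y ⊆ Q.A y :=
  Q.A_eq y hy ▸ ArcGrid.seg_subset hx₁ hx₂ hy

lemma swap_seg_subset_B (Q : TartanGrid R 𝔰 𝔲) {y₁ y₂ x : ℝ} (hy₁ : y₁ ∈ Q.Y) (hy₂ : y₂ ∈ Q.Y)
    (hx : x ∈ Q.X) : Q.swap.seg y₁ y₂ x ⊆ Q.B x :=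
  Q.B_eq x hx ▸ ArcGrid.seg_subset (G := Q.swap) hy₁ hy₂ hx

lemma A_subset_line (Q : TartanGrid R 𝔰 𝔲) {y : ℝ} (hy : y ∈ Q.Y) {ℓ : Set S} (hℓ : ℓ ∈ Ts.lines)
    {z : S} (hz : z ∈ Q.A y) (hzℓ : z ∈ ℓ) : Q.A y ⊆ ℓ := by
  have hA : Q.A y ⊆ range (Q.g y) := Q.A_eq y hy ▸ image_subset_range _ _
  exact Ts.lines_disjoint.elim_set (Q.g_line y hy) hℓ z (hA hz) hzℓ ▸ hA

lemma B_subset_line (Q : TartanGrid R 𝔰 𝔲) {x : ℝ} (hx : x ∈ Q.X) {ℓ : Set S} (hℓ : ℓ ∈ Tu.lines)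
    {z : S} (hz : z ∈ Q.B x) (hzℓ : z ∈ ℓ) : Q.B x ⊆ ℓ := by
  have hB : Q.B x ⊆ range (Q.h x) := Q.B_eq x hx ▸ image_subset_range _ _
  exact Tu.lines_disjoint.elim_set (Q.h_line x hx) hℓ z (hB hz) hzℓ ▸ hB

/-- The tartan of subarcs of the fibers with indices in `Kx` and `Ky`, cut off by the fibers with
indices `x₁`, `x₂`, `y₁` and `y₂`. -/
def sub [BorelSpace S] (Q : TartanGrid R 𝔰 𝔲) {x₁ x₂ y₁ y₂ : ℝ} (hx₁ : x₁ ∈ Q.X) (hx₂ : x₂ ∈ Q.X)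
    (hy₁ : y₁ ∈ Q.Y) (hy₂ : y₂ ∈ Q.Y) (hx₁₂ : x₁ < x₂) (hy₁₂ : y₁ < y₂) {Kx Ky : Set ℝ}
    (hKx : Kx ⊆ Ioo x₁ x₂ ∩ Q.X) (hKy : Ky ⊆ Ioo y₁ y₂ ∩ Q.Y)
    (hs : IsClosed (⋃ y ∈ Ky, Q.seg x₁ x₂ y))
    (hu : IsClosed (⋃ x ∈ Kx, Q.swap.seg y₁ y₂ x)) : Tartan Ts Tu where
  Rs := ⋃ y ∈ Ky, Q.seg x₁ x₂ y
  Ru := ⋃ x ∈ Kx, Q.swap.seg y₁ y₂ x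
  borel_s := hs.measurableSet
  borel_u := hu.measurableSet
  fibs := (fun y => Q.seg x₁ x₂ y) '' Ky
  fibu := (fun x => Q.swap.seg y₁ y₂ x) '' Kx
  fibs_disjoint := by
    rintro _ ⟨y, hy, rfl⟩ _ ⟨y', hy', rfl⟩ hne
    refine Set.disjoint_left.2 fun z hz hz' => hne ?_
    simp only [id] at hz hz'
    rw [ArcGrid.eq_of_mem_of_mem (hKy hy).2 (hKy hy').2 (ArcGrid.seg_subset hx₁ hx₂ (hKy hy).2 hz)
      (ArcGrid.seg_subset hx₁ hx₂ (hKy hy').2 hz')]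
  fibu_disjoint := by
    rintro _ ⟨x, hx, rfl⟩ _ ⟨x', hx', rfl⟩ hne
    refine Set.disjoint_left.2 fun z hz hz' => hne ?_
    simp only [id] at hz hz'
    rw [ArcGrid.eq_of_mem_of_mem (G := Q.swap) (hKx hx).2 (hKx hx').2
      (ArcGrid.seg_subset (G := Q.swap) hy₁ hy₂ (hKx hx).2 hz)
      (ArcGrid.seg_subset (G := Q.swap) hy₁ hy₂ (hKx hx').2 hz')]
  fibs_cover := sUnion_image _ _
  fibu_cover := sUnion_image _ _
  inter_unique := by
    rintro _ ⟨y, hy, rfl⟩ _ ⟨x, hx, rfl⟩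
    have hx' := hKx hx
    have hy' := hKy hy
    refine ⟨Q.pt x y, ⟨ArcGrid.pt_mem_seg hx₁ hx'.2 hx₂ hy'.2 hx'.1.1.le hx'.1.2.le,
      ArcGrid.pt_mem_swap_seg hx'.2 hy₁ hy'.2 hy₂ hy'.1.1.le hy'.1.2.le⟩, fun z hz => ?_⟩
    exact ArcGrid.eq_pt hx'.2 hy'.2 (ArcGrid.seg_subset hx₁ hx₂ hy'.2 hz.1)
      (ArcGrid.seg_subset (G := Q.swap) hy₁ hy₂ hx'.2 hz.2)
  oriented := by
    have hpt : ∀ x ∈ Kx, ∀ y ∈ Ky, ∀ z ∈ Q.seg x₁ x₂ y ∩ Q.swap.seg y₁ y₂ x, z = Q.pt x y :=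
      fun x hx y hy z hz => ArcGrid.eq_pt (hKx hx).2 (hKy hy).2
        (ArcGrid.seg_subset hx₁ hx₂ (hKy hy).2 hz.1)
        (ArcGrid.seg_subset (G := Q.swap) hy₁ hy₂ (hKx hx).2 hz.2)
    refine ⟨Q.Ord, Q.swap.Ord, ?_, ?_, ?_, ?_⟩
    · rintro _ ⟨y, hy, rfl⟩
      replace hy := (hKy hy).2
      exact ⟨_, Q.g_line y hy, Q.g y, Q.g_cont y hy, Q.g_inj y hy, rfl, Q.τ y x₁, Q.τ y x₂,
        (Q.τ_mono y hy hx₁ hx₂ hx₁₂).le, rfl, fun s hs t _ => ArcGrid.ord_iff hx₁ hx₂ hy hs⟩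
    · rintro _ ⟨x, hx, rfl⟩
      replace hx := (hKx hx).2
      exact ⟨_, Q.h_line x hx, Q.h x, Q.h_cont x hx, Q.h_inj x hx, rfl, Q.σ x y₁, Q.σ x y₂,
        (Q.σ_mono x hx hy₁ hy₂ hy₁₂).le, rfl,
        fun s hs t _ => ArcGrid.ord_iff (G := Q.swap) hy₁ hy₂ hx hs⟩
    · rintro _ ⟨y, hy, rfl⟩ _ ⟨y', hy', rfl⟩ _ ⟨x, hx, rfl⟩ _ ⟨x', hx', rfl⟩ p hp q hq p' hp' q' hq'
      rw [hpt x hx y hy p hp, hpt x' hx' y hy q hq, hpt x hx y' hy' p' hp', hpt x' hx' y' hy' q' hq']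
      change Q.Ord (Q.seg x₁ x₂ y) _ _ ↔ Q.Ord (Q.seg x₁ x₂ y') _ _
      rw [ArcGrid.ord_pt_iff hx₁ hx₂ (hKy hy).2 (hKx hx) (hKx hx').2,
        ArcGrid.ord_pt_iff hx₁ hx₂ (hKy hy').2 (hKx hx) (hKx hx').2]
    · rintro _ ⟨x, hx, rfl⟩ _ ⟨x', hx', rfl⟩ _ ⟨y, hy, rfl⟩ _ ⟨y', hy', rfl⟩ p hp q hq p' hp' q' hq'
      rw [hpt x hx y hy p hp.symm, hpt x hx y' hy' q hq.symm, hpt x' hx' y hy p' hp'.symm,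
        hpt x' hx' y' hy' q' hq'.symm]
      rw [← ArcGrid.swap_pt (hKx hx).2 (hKy hy).2, ← ArcGrid.swap_pt (hKx hx).2 (hKy hy').2,
        ← ArcGrid.swap_pt (hKx hx').2 (hKy hy).2, ← ArcGrid.swap_pt (hKx hx').2 (hKy hy').2]
      change Q.swap.Ord (Q.swap.seg y₁ y₂ x) _ _ ↔ Q.swap.Ord (Q.swap.seg y₁ y₂ x') _ _
      rw [ArcGrid.ord_pt_iff (G := Q.swap) hy₁ hy₂ (hKx hx).2 (hKy hy) (hKy hy').2,
        ArcGrid.ord_pt_iff (G := Q.swap) hy₁ hy₂ (hKx hx').2 (hKy hy) (hKy hy').2]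
  bounded := by
    obtain ⟨L, hL, hLs, hLu⟩ := R.bounded
    refine ⟨L, hL, ?_, ?_⟩
    · rintro _ ⟨y, hy, rfl⟩ ℓ hℓ hsub
      replace hy := (hKy hy).2
      have hp := ArcGrid.pt_mem_seg hx₁ hx₁ hx₂ hy le_rfl hx₁₂.le
      exact (measure_mono (Q.seg_subset_A hx₁ hx₂ hy)).trans (hLs _ (Q.A_mem y hy) ℓ hℓ
        (Q.A_subset_line hy hℓ (Q.seg_subset_A hx₁ hx₂ hy hp) (hsub hp)))
    · rintro _ ⟨x, hx, rfl⟩ ℓ hℓ hsub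
      replace hx := (hKx hx).2
      have hp := ArcGrid.pt_mem_seg (G := Q.swap) hy₁ hy₁ hy₂ hx le_rfl hy₁₂.le
      exact (measure_mono (Q.swap_seg_subset_B hy₁ hy₂ hx)).trans (hLu _ (Q.B_mem x hx) ℓ hℓ
        (Q.B_subset_line hx hℓ (Q.swap_seg_subset_B hy₁ hy₂ hx hp) (hsub hp)))
  in_disk := by
    obtain ⟨V, hV, hRV, h⟩ := R.in_disk
    refine ⟨V, hV, Subset.trans (union_subset_union ?_ ?_) hRV, h⟩
    · rw [← R.fibs_cover]
      exact iUnion₂_subset fun y hy => (Q.seg_subset_A hx₁ hx₂ (hKy hy).2).trans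
        (subset_sUnion_of_mem (Q.A_mem y (hKy hy).2))
    · rw [← R.fibu_cover]
      exact iUnion₂_subset fun x hx => (Q.swap_seg_subset_B hy₁ hy₂ (hKx hx).2).trans
        (subset_sUnion_of_mem (Q.B_mem x (hKx hx).2))

end TartanGrid

namespace Tartan
variable {μ : Measure S} {Ts Tu : MeasuredTurbulation μ}

lemma measurableSet_core (R : Tartan Ts Tu) : MeasurableSet R.core := R.borel_s.inter R.borel_u

lemma exists_isArc_of_mem_fibs (R : Tartan Ts Tu) {A : Set S} (hA : A ∈ R.fibs) :
    ∃ ℓ ∈ Ts.lines, IsArc ℓ A := by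
  obtain ⟨_, _, h, -⟩ := R.oriented
  obtain ⟨ℓ, hℓ, f, hf, hfi, hr, a, b, hab, e, -⟩ := h A hA
  exact ⟨ℓ, hℓ, f a, f b, f, hf, hfi, hr, a, b, hab, rfl, rfl, e⟩

lemma exists_isArc_of_mem_fibu (R : Tartan Ts Tu) {B : Set S} (hB : B ∈ R.fibu) :
    ∃ ℓ ∈ Tu.lines, IsArc ℓ B := by
  obtain ⟨_, _, -, h, -⟩ := R.oriented
  obtain ⟨ℓ, hℓ, f, hf, hfi, hr, a, b, hab, e, -⟩ := h B hB
  exact ⟨ℓ, hℓ, f a, f b, f, hf, hfi, hr, a, b, hab, rfl, rfl, e⟩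

end Tartan

lemma IsArc.subset {M : Type} [TopologicalSpace M] {ℓ A : Set M} (h : IsArc ℓ A) : A ⊆ ℓ := by
  obtain ⟨_, _, f, -, -, rfl, a, b, -, -, -, rfl⟩ := h
  exact image_subset_range _ _

lemma IsArc.measurableSet [T2Space S] [BorelSpace S] {ℓ A : Set S} (h : IsArc ℓ A) :
    MeasurableSet A := by
  obtain ⟨_, _, f, hf, -, -, a, b, -, -, -, rfl⟩ := h
  exact (isCompact_Icc.image hf).isClosed.measurableSet

namespace MeasuredTurbulation
variable {μ : Measure S}

lemma isArc_of_inter_nonempty (T : MeasuredTurbulation μ) {ℓ ℓ' A : Set S} (hℓ : ℓ ∈ T.lines)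
    (hℓ' : ℓ' ∈ T.lines) (hA : IsArc ℓ' A) (h : (A ∩ ℓ).Nonempty) : IsArc ℓ A := by
  obtain ⟨z, hzA, hz⟩ := h
  exact T.lines_disjoint.elim_set hℓ' hℓ z (hA.subset hzA) hz ▸ hA

lemma isFiniteMeasure_restrict (T : MeasuredTurbulation μ) {ℓ A E : Set S} (hℓ : ℓ ∈ T.lines)
    (hA : IsArc ℓ A) (hE : E ⊆ A) : IsFiniteMeasure ((T.ν ℓ).restrict E) := by
  obtain ⟨x, y, h⟩ := hA
  exact ⟨by
    rw [Measure.restrict_apply_univ]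
    exact (measure_mono hE).trans_lt (T.ν_arc_finite ℓ hℓ A x y h)⟩

end MeasuredTurbulation

lemma Tartan.Compatible.mono [T2Space S] [BorelSpace S] {μ : Measure S}
    {Ts Tu : MeasuredTurbulation μ} {R R' : Tartan Ts Tu} (hR : R.Compatible)
    (hs : ∀ A' ∈ R'.fibs, ∃ A ∈ R.fibs, A' ⊆ A) (hu : ∀ B' ∈ R'.fibu, ∃ B ∈ R.fibu, B' ⊆ B) :
    R'.Compatible := by
  intro 𝔰' h𝔰' 𝔲' h𝔲' ℓs hℓs h𝔰ℓ ℓu hℓu h𝔲ℓ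
  obtain ⟨𝔰, h𝔰, hs𝔰⟩ := hs 𝔰' h𝔰'
  obtain ⟨𝔲, h𝔲, hu𝔲⟩ := hu 𝔲' h𝔲'
  obtain ⟨z₀, ⟨hz₀, hz₀'⟩, -⟩ := R'.inter_unique 𝔰' h𝔰' 𝔲' h𝔲'
  have harc : IsArc ℓs 𝔰 := by
    obtain ⟨ℓ, hℓ, h⟩ := R.exists_isArc_of_mem_fibs h𝔰
    exact Ts.isArc_of_inter_nonempty hℓs hℓ h ⟨z₀, hs𝔰 hz₀, h𝔰ℓ hz₀⟩
  have harcu : IsArc ℓu 𝔲 := by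
    obtain ⟨ℓ, hℓ, h⟩ := R.exists_isArc_of_mem_fibu h𝔲
    exact Tu.isArc_of_inter_nonempty hℓu hℓ h ⟨z₀, hu𝔲 hz₀', h𝔲ℓ hz₀'⟩
  have hcore : R'.core ⊆ R.core := by
    rintro z ⟨hz, hz'⟩
    rw [← R'.fibs_cover] at hz
    rw [← R'.fibu_cover] at hz'
    obtain ⟨A', hA', hzA⟩ := hz
    obtain ⟨B', hB', hzB⟩ := hz'
    obtain ⟨A, hA, hAA⟩ := hs A' hA'
    obtain ⟨B, hB, hBB⟩ := hu B' hB'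
    exact ⟨R.fibs_cover ▸ ⟨A, hA, hAA hzA⟩, R.fibu_cover ▸ ⟨B, hB, hBB hzB⟩⟩
  obtain ⟨ψ, hψ, hinj, himg, hψm, hψi, hmap⟩ := hR 𝔰 h𝔰 𝔲 h𝔲 ℓs hℓs harc.subset ℓu hℓu harcu.subset
  set E := 𝔰 ∩ R.core
  set F := 𝔲 ∩ R.core
  set E' := 𝔰' ∩ R'.core
  set F' := 𝔲' ∩ R'.core
  have hE : E' ⊆ E := inter_subset_inter hs𝔰 hcore
  have hF : F' ⊆ F := inter_subset_inter hu𝔲 hcore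
  have hE'm : MeasurableSet E' := by
    obtain ⟨ℓ, -, h⟩ := R'.exists_isArc_of_mem_fibs h𝔰'
    exact h.measurableSet.inter R'.measurableSet_core
  have hF'm : MeasurableSet F' := by
    obtain ⟨ℓ, -, h⟩ := R'.exists_isArc_of_mem_fibu h𝔲'
    exact h.measurableSet.inter R'.measurableSet_core
  have hEm : MeasurableSet E := harc.measurableSet.inter R.measurableSet_core
  have hFm : MeasurableSet F := harcu.measurableSet.inter R.measurableSet_core
  have hψ' : ∀ x ∈ E', ∀ y ∈ F', ∀ B' ∈ R'.fibu, x ∈ B' → ∀ A' ∈ R'.fibs, y ∈ A' →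
      ψ (x, y) ∈ B' ∩ A' := by
    intro x hx y hy B' hB' hxB A' hA' hyA
    obtain ⟨A, hA, hAA⟩ := hs A' hA'
    obtain ⟨B, hB, hBB⟩ := hu B' hB'
    obtain ⟨z, hz, -⟩ := R'.inter_unique A' hA' B' hB'
    rw [(R.inter_unique A hA B hB).unique
      (hψ x (hE hx) y (hF hy) B hB (hBB hxB) A hA (hAA hyA)).symm ⟨hAA hz.1, hBB hz.2⟩]
    exact hz.symm
  have himg' : ψ '' (E' ×ˢ F') = R'.core := by
    refine subset_antisymm ?_ ?_
    · rintro _ ⟨⟨x, y⟩, ⟨hx, hy⟩, rfl⟩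
      obtain ⟨B', hB', hxB⟩ := R'.fibu_cover.superset hx.2.2
      obtain ⟨A', hA', hyA⟩ := R'.fibs_cover.superset hy.2.1
      have := hψ' x hx y hy B' hB' hxB A' hA' hyA
      exact ⟨R'.fibs_cover ▸ ⟨A', hA', this.2⟩, R'.fibu_cover ▸ ⟨B', hB', this.1⟩⟩
    · rintro z ⟨hz, hz'⟩
      obtain ⟨B', hB', hzB⟩ := R'.fibu_cover.superset hz'
      obtain ⟨A', hA', hzA⟩ := R'.fibs_cover.superset hz
      obtain ⟨x, hx, -⟩ := R'.inter_unique 𝔰' h𝔰' B' hB'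
      obtain ⟨y, hy, -⟩ := R'.inter_unique A' hA' 𝔲' h𝔲'
      have hxE : x ∈ E' := ⟨hx.1, R'.fibs_cover ▸ ⟨_, h𝔰', hx.1⟩, R'.fibu_cover ▸ ⟨_, hB', hx.2⟩⟩
      have hyF : y ∈ F' := ⟨hy.2, R'.fibs_cover ▸ ⟨_, hA', hy.1⟩, R'.fibu_cover ▸ ⟨_, h𝔲', hy.2⟩⟩
      exact ⟨(x, y), ⟨hxE, hyF⟩, (R'.inter_unique A' hA' B' hB').unique
        (hψ' x hxE y hyF B' hB' hx.2 A' hA' hy.1).symm ⟨hzA, hzB⟩⟩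
  have hsub : E' ×ˢ F' ⊆ E ×ˢ F := prod_mono hE hF
  refine ⟨ψ, hψ', hinj.mono hsub, himg', hψm, fun G hG => hψi G (hG.trans hsub), ?_⟩
  have := Ts.isFiniteMeasure_restrict hℓs harc (inter_subset_left : E ⊆ 𝔰)
  have := Tu.isFiniteMeasure_restrict hℓu harcu (inter_subset_left : F ⊆ 𝔲)
  have hpre : (ψ ⁻¹' R'.core) ∩ E ×ˢ F = E' ×ˢ F' := by
    refine subset_antisymm ?_ (subset_inter (image_subset_iff.1 himg'.subset) hsub)
    rintro p ⟨hp, hpE⟩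
    obtain ⟨q, hq, e⟩ := himg'.superset hp
    exact hinj (hsub hq) hpE e ▸ hq
  have hEF : ∀ᵐ p ∂(((Ts.ν ℓs).restrict E).prod ((Tu.ν ℓu).restrict F)), p ∈ E ×ˢ F :=
    Measure.ae_prod_mem_iff_ae_ae_mem (hEm.prod hFm) |>.2 <| by
      filter_upwards [ae_restrict_mem hEm] with x hx
      filter_upwards [ae_restrict_mem hFm] with y hy using ⟨hx, hy⟩
  have hR' : (Ts.ν ℓs).restrict E' = ((Ts.ν ℓs).restrict E).restrict E' := by
    rw [Measure.restrict_restrict hE'm, inter_eq_left.2 hE]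
  have hR'' : (Tu.ν ℓu).restrict F' = ((Tu.ν ℓu).restrict F).restrict F' := by
    rw [Measure.restrict_restrict hF'm, inter_eq_left.2 hF]
  rw [hR', hR'', Measure.prod_restrict, ← hpre, ← inter_eq_left.2 hcore,
    ← Measure.restrict_restrict R'.measurableSet_core, ← hmap,
    Measure.restrict_map hψm R'.measurableSet_core, inter_eq_left.2 hcore]
  congr 1
  refine Measure.restrict_congr_set ?_
  filter_upwards [hEF] with p hp
  exact propext ⟨fun h => h.1, fun h => ⟨h, hp⟩⟩

namespace TartanGrid
variable {μ : Measure S} {Ts Tu : MeasuredTurbulation μ} {R : Tartan Ts Tu} {𝔰 𝔲 : Set S}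

lemma flat (Q : TartanGrid R 𝔰 𝔲) {x y : ℝ} (hx : x ∈ Q.X) (hy : y ∈ Q.Y) {ℓ ℓ' : Set S}
    (hℓ : ℓ ∈ Ts.lines) (hℓ' : ℓ' ∈ Tu.lines) (hp : Q.pt x y ∈ ℓ) (hp' : Q.pt x y ∈ ℓ')
    (h : TransverseAt ℓ ℓ' (Q.pt x y)) : Q.Flat x y ∧ Q.swap.Flat y x := by
  have hA : Q.pt x y ∈ range (Q.g y) :=
    image_subset_range _ _ (Q.A_eq y hy ▸ (Q.pt_mem hx hy).2)
  have hB : Q.pt x y ∈ range (Q.h x) :=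
    image_subset_range _ _ (Q.B_eq x hx ▸ (Q.pt_mem hx hy).1)
  obtain rfl := Ts.lines_disjoint.elim_set (Q.g_line y hy) hℓ _ hA hp
  obtain rfl := Tu.lines_disjoint.elim_set (Q.h_line x hx) hℓ' _ hB hp'
  refine ⟨h.exists_chart.1, ?_⟩
  have := h.exists_chart.2
  rw [← ArcGrid.swap_pt hx hy] at this
  exact this

lemma fibs_sub [BorelSpace S] (Q : TartanGrid R 𝔰 𝔲) {x₁ x₂ y₁ y₂ : ℝ} (hx₁ : x₁ ∈ Q.X)
    (hx₂ : x₂ ∈ Q.X) (hy₁ : y₁ ∈ Q.Y) (hy₂ : y₂ ∈ Q.Y) (hx₁₂ : x₁ < x₂) (hy₁₂ : y₁ < y₂)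
    {Kx Ky : Set ℝ} (hKx : Kx ⊆ Ioo x₁ x₂ ∩ Q.X) (hKy : Ky ⊆ Ioo y₁ y₂ ∩ Q.Y)
    (hs : IsClosed (⋃ y ∈ Ky, Q.seg x₁ x₂ y)) (hu : IsClosed (⋃ x ∈ Kx, Q.swap.seg y₁ y₂ x)) :
    (∀ A' ∈ (Q.sub hx₁ hx₂ hy₁ hy₂ hx₁₂ hy₁₂ hKx hKy hs hu).fibs, ∃ A ∈ R.fibs, A' ⊆ A) ∧
      ∀ B' ∈ (Q.sub hx₁ hx₂ hy₁ hy₂ hx₁₂ hy₁₂ hKx hKy hs hu).fibu, ∃ B ∈ R.fibu, B' ⊆ B := by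
  constructor
  · rintro _ ⟨y, hy, rfl⟩
    exact ⟨_, Q.A_mem y (hKy hy).2, Q.seg_subset_A hx₁ hx₂ (hKy hy).2⟩
  · rintro _ ⟨x, hx, rfl⟩
    exact ⟨_, Q.B_mem x (hKx hx).2, Q.swap_seg_subset_B hy₁ hy₂ (hKx hx).2⟩

/-- The coordinates of a compatible tartan given by a pair of its fibers. -/
lemma exists_coordinates [T2Space S] [SecondCountableTopology S]
    [TopologicalSpace.MetrizableSpace S] [BorelSpace S]
    (Q : TartanGrid R 𝔰 𝔲) (hR : R.Compatible) (h𝔰 : 𝔰 ∈ R.fibs) (h𝔲 : 𝔲 ∈ R.fibu) :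
    ∃ (lX lY : Measure ℝ) (Φ : ℝ × ℝ → S), IsFiniteMeasure lX ∧ IsFiniteMeasure lY ∧
      NullSingletonClass lX ∧ NullSingletonClass lY ∧ MeasurableSet Q.X ∧ MeasurableSet Q.Y ∧
      lX Q.Xᶜ = 0 ∧ lY Q.Yᶜ = 0 ∧ Measurable Φ ∧
      (∀ x ∈ Q.X, ∀ y ∈ Q.Y, Φ (x, y) = Q.pt x y) ∧
      (lX.prod lY).map Φ = μ.restrict R.core := by
  obtain ⟨z₀, ⟨hz₀, hz₀'⟩, -⟩ := R.inter_unique 𝔰 h𝔰 𝔲 h𝔲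
  have h𝔰ℓ : IsArc (range Q.g₀) 𝔰 := by
    obtain ⟨a, b, h⟩ := Q.𝔰_arc
    obtain ⟨t, ht, -⟩ := h.subset hz₀
    exact ⟨_, _, Q.g₀, Q.g₀_cont, Q.g₀_inj, rfl, a, b, ht.1.trans ht.2, rfl, rfl, h⟩
  have h𝔲ℓ : IsArc (range Q.h₀) 𝔲 := by
    obtain ⟨a, b, h⟩ := Q.𝔲_arc
    obtain ⟨t, ht, -⟩ := h.subset hz₀'
    exact ⟨_, _, Q.h₀, Q.h₀_cont, Q.h₀_inj, rfl, a, b, ht.1.trans ht.2, rfl, rfl, h⟩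
  obtain ⟨ψ, hψ, -, -, hψm, -, hmap⟩ :=
    hR 𝔰 h𝔰 𝔲 h𝔲 _ Q.g₀_line h𝔰ℓ.subset _ Q.h₀_line h𝔲ℓ.subset
  have hEm : MeasurableSet (𝔰 ∩ R.core) := h𝔰ℓ.measurableSet.inter R.measurableSet_core
  have hFm : MeasurableSet (𝔲 ∩ R.core) := h𝔲ℓ.measurableSet.inter R.measurableSet_core
  have hg := Q.g₀_cont.measurableEmbedding Q.g₀_inj
  have hh := Q.h₀_cont.measurableEmbedding Q.h₀_inj
  have := Ts.isFiniteMeasure_restrict Q.g₀_line h𝔰ℓ (inter_subset_left : 𝔰 ∩ R.core ⊆ 𝔰)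
  have := Tu.isFiniteMeasure_restrict Q.h₀_line h𝔲ℓ (inter_subset_left : 𝔲 ∩ R.core ⊆ 𝔲)
  set m := (Ts.ν (range Q.g₀)).restrict (𝔰 ∩ R.core) with hm
  set n := (Tu.ν (range Q.h₀)).restrict (𝔲 ∩ R.core) with hn
  have hmg : (m.comap Q.g₀).map Q.g₀ = m := by
    rw [hg.map_comap, hm, Measure.restrict_restrict hg.measurableSet_range,
      inter_eq_right.2 (inter_subset_left.trans h𝔰ℓ.subset)]
  have hnh : (n.comap Q.h₀).map Q.h₀ = n := by
    rw [hh.map_comap, hn, Measure.restrict_restrict hh.measurableSet_range,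
      inter_eq_right.2 (inter_subset_left.trans h𝔲ℓ.subset)]
  have hfin : IsFiniteMeasure (m.comap Q.g₀) := ⟨by
    rw [hg.comap_apply]; exact measure_lt_top _ _⟩
  have hfin' : IsFiniteMeasure (n.comap Q.h₀) := ⟨by
    rw [hh.comap_apply]; exact measure_lt_top _ _⟩
  refine ⟨m.comap Q.g₀, n.comap Q.h₀, fun p => ψ (Q.g₀ p.1, Q.h₀ p.2), hfin, hfin', ⟨fun x => ?_⟩,
    ⟨fun y => ?_⟩, Q.X_eq ▸ hg.measurable hEm, Q.Y_eq ▸ hh.measurable hFm, ?_, ?_,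
    hψm.comp ((hg.measurable.comp measurable_fst).prodMk (hh.measurable.comp measurable_snd)),
    fun x hx y hy => ?_, ?_⟩
  · rw [hg.comap_apply, image_singleton]
    exact le_antisymm ((Measure.restrict_apply_le _ _).trans_eq
      (Ts.ν_nonatomic _ Q.g₀_line _)) zero_le
  · rw [hh.comap_apply, image_singleton]
    exact le_antisymm ((Measure.restrict_apply_le _ _).trans_eq
      (Tu.ν_nonatomic _ Q.h₀_line _)) zero_le
  · rw [hg.comap_apply, Q.X_eq, ← preimage_compl]
    exact measure_mono_null (image_preimage_subset _ _) (Measure.restrict_apply_eq_zero' hEm |>.2 (by simp))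
  · rw [hh.comap_apply, Q.Y_eq, ← preimage_compl]
    exact measure_mono_null (image_preimage_subset _ _) (Measure.restrict_apply_eq_zero' hFm |>.2 (by simp))
  · have h1 := hψ (Q.g₀ x) (Q.X_eq.subset hx) (Q.h₀ y) (Q.Y_eq.subset hy) _ (Q.B_mem x hx)
      (Q.g₀_mem x hx) _ (Q.A_mem y hy) (Q.h₀_mem y hy)
    exact (R.inter_unique _ (Q.A_mem y hy) _ (Q.B_mem x hx)).unique h1.symm (Q.pt_mem hx hy).symm
  · rw [← hmap, ← hmg, ← hnh, Measure.map_prod_map _ _ hg.measurable hh.measurable,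
      Measure.map_map hψm (hg.measurable.prodMap hh.measurable), hmg, hnh]
    rfl

end TartanGrid

/-- A compatible tartan whose intersection points charge the open set `U` has a compatible
subtartan of positive measure contained in `U`. -/
lemma Tartan.Compatible.exists_subset_open [T2Space S] [SecondCountableTopology S]
    [TopologicalSpace.MetrizableSpace S] [BorelSpace S] {μ : Measure S}
    {Ts Tu : MeasuredTurbulation μ} {R : Tartan Ts Tu} (hR : R.Compatible) {U W : Set S}
    (hU : IsOpen U) (hW : MeasurableSet W)
    (hWt : ∀ x ∈ W, ∃ ℓ ∈ Ts.lines, ∃ ℓ' ∈ Tu.lines, x ∈ ℓ ∧ x ∈ ℓ' ∧ TransverseAt ℓ ℓ' x)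
    (hpos : μ (U ∩ W ∩ R.core) ≠ 0) :
    ∃ R' : Tartan Ts Tu, R'.Compatible ∧ 0 < μ R'.core ∧ R'.Rs ∪ R'.Ru ⊆ U := by
  obtain ⟨z, -, hz, hz'⟩ := nonempty_of_measure_ne_zero hpos
  obtain ⟨𝔰, h𝔰, -⟩ := R.fibs_cover.superset hz
  obtain ⟨𝔲, h𝔲, -⟩ := R.fibu_cover.superset hz'
  obtain ⟨Q⟩ := R.nonempty_tartanGrid h𝔰 h𝔲
  obtain ⟨lX, lY, Φ, _, _, _, _, hX, hY, hX0, hY0, hΦ, hΦpt, hmap⟩ := Q.exists_coordinates hR h𝔰 h𝔲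
  have hμ : ∀ E, MeasurableSet E → μ (E ∩ R.core) = (lX.prod lY) (Φ ⁻¹' E) := fun E hE => by
    rw [← Measure.map_apply hΦ hE, hmap, Measure.restrict_apply hE]
  have hXY : (lX.prod lY) (Q.X ×ˢ Q.Y)ᶜ = 0 := by
    rw [compl_prod_eq_union]
    exact measure_union_null (by rw [Measure.prod_prod, hX0, zero_mul])
      (by rw [Measure.prod_prod, hY0, mul_zero])
  have hUW : MeasurableSet (U ∩ W) := hU.measurableSet.inter hW
  have hP : ∀ p ∈ Φ ⁻¹' (U ∩ W) ∩ Q.X ×ˢ Q.Y, Q.pt p.1 p.2 ∈ U ∩ W := fun p hp =>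
    hΦpt p.1 hp.2.1 p.2 hp.2.2 ▸ hp.1
  have hflat : ∀ p ∈ Φ ⁻¹' (U ∩ W) ∩ Q.X ×ˢ Q.Y, Q.Flat p.1 p.2 ∧ Q.swap.Flat p.2 p.1 := by
    intro p hp
    obtain ⟨ℓ, hℓ, ℓ', hℓ', h, h', ht⟩ := hWt _ (hP p hp).2
    exact Q.flat hp.2.1 hp.2.2 hℓ hℓ' h h' ht
  obtain ⟨x₁, hx₁, x₂, hx₂, y₁, hy₁, y₂, hy₂, Kx, Ky, hKx, hKy, hKx0, hKy0, hs, hu, hsU, huU⟩ :=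
    Q.exists_compact_subgrid' hX hY (lX := lX) (lY := lY) hU
      ((hΦ hUW).inter (hX.prod hY)) inter_subset_right (fun p hp => (hP p hp).1)
      (fun p hp => (hflat p hp).1) (fun p hp => (hflat p hp).2)
      (by rwa [inter_comm, Measure.measure_inter_eq_of_ae (t := Q.X ×ˢ Q.Y) (mem_ae_iff.2 hXY),
        ← hμ _ hUW])
  obtain ⟨a, ha⟩ := nonempty_of_measure_ne_zero hKx0.ne'
  obtain ⟨b, hb⟩ := nonempty_of_measure_ne_zero hKy0.ne'
  set R' := Q.sub hx₁ hx₂ hy₁ hy₂ ((hKx ha).1.1.trans (hKx ha).1.2)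
    ((hKy hb).1.1.trans (hKy hb).1.2) hKx hKy hs hu
  have hfib := Q.fibs_sub hx₁ hx₂ hy₁ hy₂ ((hKx ha).1.1.trans (hKx ha).1.2)
    ((hKy hb).1.1.trans (hKy hb).1.2) hKx hKy hs hu
  refine ⟨R', hR.mono hfib.1 hfib.2, ?_, union_subset hsU huU⟩
  calc 0 < lX Kx * lY Ky := ENNReal.mul_pos hKx0.ne' hKy0.ne'
    _ = (lX.prod lY) (Kx ×ˢ Ky) := (Measure.prod_prod _ _).symm
    _ ≤ (lX.prod lY) (Φ ⁻¹' R'.core) := by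
        refine measure_mono ?_
        rintro ⟨x, y⟩ ⟨hx, hy⟩
        have hx' := hKx hx
        have hy' := hKy hy
        rw [mem_preimage, hΦpt x hx'.2 y hy'.2]
        exact ⟨mem_iUnion₂.2 ⟨y, hy, ArcGrid.pt_mem_seg hx₁ hx'.2 hx₂ hy'.2 hx'.1.1.le hx'.1.2.le⟩,
          mem_iUnion₂.2 ⟨x, hx,
            ArcGrid.pt_mem_swap_seg hx'.2 hy₁ hy'.2 hy₂ hy'.1.1.le hy'.1.2.le⟩⟩
    _ = μ (R'.core ∩ R.core) := (hμ _ R'.measurableSet_core).symm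
    _ ≤ μ R'.core := measure_mono inter_subset_left

/-- if the turbulations have partial flowboxes and a countable family of
compatible tartans covers a full measure subset of `S`, then every non-empty open set
contains a positive measure compatible tartan; hence the pair of turbulations is full. -/
theorem full_of_partial_flowboxes
    {S : Type} [TopologicalSpace S] [T2Space S] [CompactSpace S]
    [ChartedSpace (EuclideanHalfSpace 2) S] [MeasurableSpace S] [BorelSpace S]
    (μ : Measure S) [IsProbabilityMeasure μ] (hμ : IsOUMeasure μ)
    (Ts Tu : MeasuredTurbulation μ) (htrans : Ts.TransversePair Tu)
    (hpfs : HasPartialFlowboxes Ts) (hpfu : HasPartialFlowboxes Tu)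
    (Rseq : ℕ → Tartan Ts Tu)
    (hcomp : ∀ i, (Rseq i).Compatible)
    (hcover : μ (⋃ i, (Rseq i).core) = 1) :
    (∀ U : Set S, IsOpen U → U.Nonempty →
      ∃ R : Tartan Ts Tu, R.Compatible ∧ 0 < μ R.core ∧ R.Rs ∪ R.Ru ⊆ U) ∧
    FullPair Ts Tu := by
  have main : ∀ U : Set S, IsOpen U → U.Nonempty →
      ∃ R : Tartan Ts Tu, R.Compatible ∧ 0 < μ R.core ∧ R.Rs ∪ R.Ru ⊆ U := by
    intro U hU hne
    have : SecondCountableTopology (EuclideanHalfSpace 2) :=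
      TopologicalSpace.Subtype.secondCountableTopology _
    have : SecondCountableTopology S :=
      ChartedSpace.secondCountable_of_sigmaCompact (EuclideanHalfSpace 2) S
    have := TopologicalSpace.metrizableSpace_of_t3_secondCountable S
    obtain ⟨W, hW, hW1, hWt⟩ := htrans
    by_contra hcon
    have hnull : ∀ i, μ (U ∩ W ∩ (Rseq i).core) = 0 := fun i => by
      by_contra h
      exact hcon ((hcomp i).exists_subset_open hU hW hWt h)
    refine (hμ.openPos U hU hne).ne' ?_
    refine measure_mono_null (t := (⋃ i, U ∩ W ∩ (Rseq i).core) ∪ (Wᶜ ∪ (⋃ i, (Rseq i).core)ᶜ)) ?_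
      (measure_union_null (measure_iUnion_null hnull) (measure_union_null
        ((prob_compl_eq_zero_iff hW).2 hW1) ((prob_compl_eq_zero_iff
          (MeasurableSet.iUnion fun i => (Rseq i).measurableSet_core)).2 hcover)))
    intro x hx
    by_cases hxW : x ∈ W
    · by_cases hxR : x ∈ ⋃ i, (Rseq i).core
      · obtain ⟨i, hi⟩ := mem_iUnion.1 hxR
        exact Or.inl (mem_iUnion.2 ⟨i, ⟨hx, hxW⟩, hi⟩)
      · exact Or.inr (Or.inr hxR)
    · exact Or.inr (Or.inl hxW)
  exact ⟨main, ⟨Rseq, hcomp, hcover⟩, main⟩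

end
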